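/- Let G be a generalised triangle group of type (3,5,2). Then either G is virtually soluble (i.e. G has a soluble subgroup of finite index) or G contains a subgroup isomorphic to the free group of rank 2. -/

import Mathlib

/-- The generators `x`, `y` of the free group of rank 2. -/
def xgen : FreeGroup (Fin 2) := FreeGroup.of 0
def ygen : FreeGroup (Fin 2) := FreeGroup.of 1

/-- The word `W = x^{α(1)} y^{β(1)} ⋯ x^{α(k)} y^{β(k)}`. -/
def Wword (k : ℕ) (a b : Fin k → ℕ) : FreeGroup (Fin 2) :=
  (List.ofFn fun i : Fin k => xgen ^ a i * ygen ^ b i).prod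

/-- The relators `x³, y⁵, W²` of a generalised triangle group of type (3,5,2). -/
def triRels (k : ℕ) (a b : Fin k → ℕ) : Set (FreeGroup (Fin 2)) :=
  {xgen ^ 3, ygen ^ 5, (Wword k a b) ^ 2}

/-- The generalised triangle group `⟨x, y ∣ x³ = y⁵ = W² = 1⟩` of type (3,5,2). -/
abbrev TriGroup (k : ℕ) (a b : Fin k → ℕ) : Type := PresentedGroup (triRels k a b)

/-- evaluation of a word -/
def ev {T : Type*} [Monoid T] (X Y : T) (w : List (ℕ × ℕ)) : T :=
  (w.map fun p => X ^ p.1 * Y ^ p.2).prod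

@[simp] lemma ev_nil {T : Type*} [Monoid T] (X Y : T) : ev X Y [] = 1 := rfl
@[simp] lemma ev_cons {T : Type*} [Monoid T] (X Y : T) (p) (w) :
    ev X Y (p :: w) = X ^ p.1 * Y ^ p.2 * ev X Y w := by simp [ev]
lemma ev_append {T : Type*} [Monoid T] (X Y : T) (v w) :
    ev X Y (v ++ w) = ev X Y v * ev X Y w := by simp [ev]
lemma ev_map {T S : Type*} [Monoid T] [Monoid S] (f : T →* S) (X Y : T) (w) :
    f (ev X Y w) = ev (f X) (f Y) w := by
  simp [ev, map_list_prod, Function.comp_def]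

def Free2 {T : Type*} [Group T] (P Q : T) : Prop :=
  Function.Injective (FreeGroup.lift ![P, Q] : FreeGroup (Fin 2) →* T)

def Good (w : List (ℕ × ℕ)) : Prop :=
  ∃ (T : Type) (_ : Group T) (X Y : T), X ^ 3 = 1 ∧ Y ^ 5 = 1 ∧ ev X Y w ^ 2 = 1 ∧
    ∃ P ∈ Subgroup.closure {X, Y}, ∃ Q ∈ Subgroup.closure {X, Y}, Free2 P Q

def toW {k : ℕ} (a b : Fin k → ℕ) : List (ℕ × ℕ) := List.ofFn fun i => (a i, b i)

lemma ev_toW {k : ℕ} (a b : Fin k → ℕ) : ev xgen ygen (toW a b) = Wword k a b := by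
  simp [ev, toW, Wword, List.map_ofFn, Function.comp_def]

lemma free_of_good {k : ℕ} (a b : Fin k → ℕ) (h : Good (toW a b)) :
    ∃ H : Subgroup (TriGroup k a b), Nonempty (H ≃* FreeGroup (Fin 2)) := by
  obtain ⟨T, _, X, Y, hX, hY, hW, P, hP, Q, hQ, hf⟩ := h
  have hr : ∀ r ∈ triRels k a b, FreeGroup.lift ![X, Y] r = 1 := by
    intro r hr
    have hx : FreeGroup.lift ![X, Y] xgen = X := by simp [xgen]
    have hy : FreeGroup.lift ![X, Y] ygen = Y := by simp [ygen]
    rcases hr with rfl | rfl | rfl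
    · simp [hx, hX]
    · simp [hy, hY]
    · rw [← ev_toW, map_pow, ev_map, hx, hy, hW]
  let F : TriGroup k a b →* T := PresentedGroup.toGroup hr
  have hle : Subgroup.closure {X, Y} ≤ F.range := by
    rw [Subgroup.closure_le]
    rintro z (rfl | rfl)
    · exact ⟨PresentedGroup.of 0, by simp [F, PresentedGroup.toGroup.of]⟩
    · exact ⟨PresentedGroup.of 1, by simp [F, PresentedGroup.toGroup.of]⟩
  obtain ⟨p, hp⟩ := hle hP
  obtain ⟨q, hq⟩ := hle hQ
  have hcomp : F.comp (FreeGroup.lift ![p, q]) = FreeGroup.lift ![P, Q] := by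
    ext i
    fin_cases i <;> simp [hp, hq]
  have hinj : Function.Injective (FreeGroup.lift ![p, q] : FreeGroup (Fin 2) →* TriGroup k a b) := by
    have : Function.Injective (F.comp (FreeGroup.lift ![p, q])) := by rw [hcomp]; exact hf
    exact Function.Injective.of_comp (f := F) this
  exact ⟨_, ⟨(MonoidHom.ofInjective hinj).symm⟩⟩

/-- twisting -/
def tw (e j : ℕ) (w : List (ℕ × ℕ)) : List (ℕ × ℕ) := w.map fun p => (e * p.1 % 3, j * p.2 % 5)

lemma pow_mod_of {T : Type*} [Monoid T] {X : T} {n : ℕ} (h : X ^ n = 1) (m : ℕ) :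
    X ^ (m % n) = X ^ m := by
  conv_rhs => rw [← Nat.mod_add_div m n, pow_add, pow_mul, h, one_pow, mul_one]

lemma ev_tw {T : Type*} [Monoid T] {X Y : T} (hX : X ^ 3 = 1) (hY : Y ^ 5 = 1) (e j w) :
    ev X Y (tw e j w) = ev (X ^ e) (Y ^ j) w := by
  induction w with
  | nil => rfl
  | cons p w ih =>
    simp only [tw, List.map_cons, ev_cons] at ih ⊢
    rw [ih, pow_mod_of hX, pow_mod_of hY, pow_mul, pow_mul]

lemma mem_closure_pow {T : Type*} [Group T] {X Y : T} (hX : X ^ 3 = 1) (hY : Y ^ 5 = 1) {e j : ℕ}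
    (e' j' : ℕ) (he : e * e' % 3 = 1) (hj : j * j' % 5 = 1) :
    Subgroup.closure {X, Y} ≤ Subgroup.closure {X ^ e, Y ^ j} := by
  rw [Subgroup.closure_le]
  rintro z (rfl | rfl)
  · have : z = (z ^ e) ^ e' := by rw [← pow_mul, ← pow_mod_of hX, he, pow_one]
    rw [this]
    exact pow_mem (Subgroup.subset_closure (by rw [← this]; simp)) _
  · have : z = (z ^ j) ^ j' := by rw [← pow_mul, ← pow_mod_of hY, hj, pow_one]
    rw [this]
    exact pow_mem (Subgroup.subset_closure (by rw [← this]; simp)) _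

lemma good_tw {w} (e j e' j' : ℕ) (he : e * e' % 3 = 1) (hj : j * j' % 5 = 1)
    (h : Good (tw e j w)) : Good w := by
  obtain ⟨T, _, X, Y, hX, hY, hW, P, hP, Q, hQ, hf⟩ := h
  refine ⟨T, _, X ^ e, Y ^ j, ?_, ?_, ?_, P, ?_, Q, ?_, hf⟩
  · rw [← pow_mul, mul_comm, pow_mul, hX, one_pow]
  · rw [← pow_mul, mul_comm, pow_mul, hY, one_pow]
  · rw [← ev_tw hX hY, hW]
  · exact mem_closure_pow hX hY e' j' he hj hP
  · exact mem_closure_pow hX hY e' j' he hj hQ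

lemma good_rot {u v} (h : Good (u ++ v)) : Good (v ++ u) := by
  obtain ⟨T, _, X, Y, hX, hY, hW, h⟩ := h
  refine ⟨T, _, X, Y, hX, hY, ?_, h⟩
  rw [ev_append] at hW ⊢
  have : (ev X Y v * ev X Y u) ^ 2 = (ev X Y u)⁻¹ * (ev X Y u * ev X Y v) ^ 2 * ev X Y u := by
    simp [sq, mul_assoc]
  rw [this, hW]; simp

section
open scoped LinearAlgebra.Projectivization Pointwise MatrixGroups

abbrev SL2 := Matrix.SpecialLinearGroup (Fin 2) ℂ
abbrev PL := ℙ ℂ (Fin 2 → ℂ)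
noncomputable def ppi : SL2 →* Equiv.Perm PL := MulAction.toPermHom SL2 PL

def bX (K : ℝ) : Set PL := {p | K * ‖p.rep 1‖ < ‖p.rep 0‖}
def bY (K : ℝ) : Set PL := {p | K * ‖p.rep 0‖ < ‖p.rep 1‖}

lemma rep_smul (g : SL2) (p : PL) : ∃ a : ℂˣ, (g • p).rep = a • (g • p.rep) := by
  have h : g • p = Projectivization.mk ℂ (g • p.rep)
      ((smul_ne_zero_iff_ne g).mpr p.rep_nonzero) := by
    conv_lhs => rw [← p.mk_rep]
    rfl
  rw [h]
  obtain ⟨a, ha⟩ := Projectivization.exists_smul_eq_mk_rep ℂ (g • p.rep)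
      ((smul_ne_zero_iff_ne g).mpr p.rep_nonzero)
  exact ⟨a, ha.symm⟩

lemma sl_smul0 (g : SL2) (v : Fin 2 → ℂ) : (g • v) 0 = g 0 0 * v 0 + g 0 1 * v 1 := by
  change (g.1.mulVec v) 0 = _
  simp [Matrix.mulVec, dotProduct, Fin.sum_univ_two]
lemma sl_smul1 (g : SL2) (v : Fin 2 → ℂ) : (g • v) 1 = g 1 0 * v 0 + g 1 1 * v 1 := by
  change (g.1.mulVec v) 1 = _
  simp [Matrix.mulVec, dotProduct, Fin.sum_univ_two]

lemma mem_bX_smul (K : ℝ) (g : SL2) (p : PL) : g • p ∈ bX K ↔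
    K * ‖g 1 0 * p.rep 0 + g 1 1 * p.rep 1‖ < ‖g 0 0 * p.rep 0 + g 0 1 * p.rep 1‖ := by
  obtain ⟨a, ha⟩ := rep_smul g p
  have ha0 : 0 < ‖(a : ℂ)‖ := norm_pos_iff.mpr a.ne_zero
  have e : ∀ i, (a • (g • p.rep)) i = (a : ℂ) * (g • p.rep) i := fun i => rfl
  simp only [bX, Set.mem_ofPred_eq, ha, e, norm_mul, sl_smul0, sl_smul1]
  rw [mul_left_comm, mul_lt_mul_iff_right₀ ha0]

lemma mem_bY_smul (K : ℝ) (g : SL2) (p : PL) : g • p ∈ bY K ↔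
    K * ‖g 0 0 * p.rep 0 + g 0 1 * p.rep 1‖ < ‖g 1 0 * p.rep 0 + g 1 1 * p.rep 1‖ := by
  obtain ⟨a, ha⟩ := rep_smul g p
  have ha0 : 0 < ‖(a : ℂ)‖ := norm_pos_iff.mpr a.ne_zero
  have e : ∀ i, (a • (g • p.rep)) i = (a : ℂ) * (g • p.rep) i := fun i => rfl
  simp only [bY, Set.mem_ofPred_eq, ha, e, norm_mul, sl_smul0, sl_smul1]
  rw [mul_left_comm, mul_lt_mul_iff_right₀ ha0]

lemma rep_ne (p : PL) : p.rep 0 ≠ 0 ∨ p.rep 1 ≠ 0 := by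
  by_contra h
  push Not at h
  apply p.rep_nonzero
  ext i; fin_cases i <;> simp [h.1, h.2]

/-- key estimate -/
lemma est {p q r s u v : ℂ} {K M : ℝ} (hK : 0 < K) (hp : 2 * ‖q‖ ≤ K * ‖p‖)
    (h1 : ‖p‖ ≤ M) (hM : ‖r‖ ≤ M) (hM' : ‖s‖ ≤ M) (h2 : 4 * M ≤ K * ‖p‖) (hK1 : 1 ≤ K)
    (h : K * ‖v‖ < ‖u‖) : ‖r * u + s * v‖ ≤ K * ‖p * u + q * v‖ := by
  have hu : 0 < ‖u‖ := lt_of_le_of_lt (by positivity) h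
  have hv : ‖v‖ ≤ ‖u‖ := by nlinarith [norm_nonneg v]
  have a1 : ‖r * u + s * v‖ ≤ 2 * M * ‖u‖ := by
    calc _ ≤ ‖r‖ * ‖u‖ + ‖s‖ * ‖v‖ := by
          refine (norm_add_le _ _).trans ?_; rw [norm_mul, norm_mul]
      _ ≤ M * ‖u‖ + M * ‖u‖ := by gcongr; exact (norm_nonneg _).trans hM
      _ = _ := by ring
  have a2 : ‖p‖ * ‖u‖ - ‖q‖ * ‖v‖ ≤ ‖p * u + q * v‖ := by
    have := norm_sub_le (p * u + q * v) (q * v)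
    rw [add_sub_cancel_right, norm_mul, norm_mul] at this
    linarith
  have a3 : 2 * (‖q‖ * ‖v‖) ≤ ‖p‖ * ‖u‖ := by
    have : 2 * (‖q‖ * ‖v‖) ≤ (K * ‖p‖) * ‖v‖ := by nlinarith [norm_nonneg v]
    nlinarith [norm_nonneg p]
  have a4 : 2 * (K * ‖p * u + q * v‖) ≥ K * (‖p‖ * ‖u‖) := by nlinarith
  have a5 : 4 * M * ‖u‖ ≤ K * ‖p‖ * ‖u‖ := by gcongr
  nlinarith

lemma pp_diag (D C : SL2) (m : ℂ) (hm : 1 < ‖m‖) (d00 : D 0 0 = m) (d01 : D 0 1 = 0)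
    (d10 : D 1 0 = 0) (d11 : D 1 1 = m⁻¹) (hC : ∀ i j, C i j ≠ 0) :
    ∃ n : ℕ, Free2 (ppi (D ^ n)) (ppi (C * D ^ n * C⁻¹)) := by
  obtain ⟨M, hM⟩ : ∃ M : ℝ, ∀ i j, ‖C i j‖ ≤ M :=
    ⟨∑ i, ∑ j, ‖C i j‖, fun i j => by
      refine le_trans ?_ (Finset.single_le_sum (f := fun i => ∑ j, ‖C i j‖) (fun i _ => by positivity) (Finset.mem_univ i))
      exact Finset.single_le_sum (f := fun j => ‖C i j‖) (fun i _ => by positivity) (Finset.mem_univ j)⟩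
  have hpos : ∀ i j, 0 < ‖C i j‖ := fun i j => norm_pos_iff.mpr (hC i j)
  obtain ⟨K, hK1, hK⟩ : ∃ K : ℝ, 1 < K ∧ ∀ i j, 4 * M ≤ K * ‖C i j‖ := by
    refine ⟨2 + ∑ i, ∑ j, 4 * M / ‖C i j‖, ?_, fun i j => ?_⟩
    · have : 0 ≤ ∑ i, ∑ j, 4 * M / ‖C i j‖ := Finset.sum_nonneg fun i _ => Finset.sum_nonneg fun j _ =>
        div_nonneg (by have := hM i j; have := hpos i j; linarith) (hpos i j).le
      linarith
    · have hn : ∀ i j, 0 ≤ 4 * M / ‖C i j‖ := fun i j =>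
        div_nonneg (by have := hM i j; have := hpos i j; linarith) (hpos i j).le
      have h1 : 4 * M / ‖C i j‖ ≤ ∑ i, ∑ j, 4 * M / ‖C i j‖ := by
        refine le_trans ?_ (Finset.single_le_sum (f := fun i => ∑ j, 4 * M / ‖C i j‖)
          (fun i _ => Finset.sum_nonneg fun j _ => hn i j) (Finset.mem_univ i))
        exact Finset.single_le_sum (f := fun j => 4 * M / ‖C i j‖) (fun j _ => hn i j) (Finset.mem_univ j)
      rw [← div_le_iff₀ (hpos i j)]; linarith
  have hM0 : 0 < M := (hpos 0 0).trans_le (hM 0 0)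
  have hK2 : ∀ i j k l, 2 * ‖C k l‖ ≤ K * ‖C i j‖ := fun i j k l => by
    have := hM k l; have := hK i j; linarith
  obtain ⟨n, hn⟩ := pow_unbounded_of_one_lt (K ^ 2) hm
  have hm0 : m ≠ 0 := by rintro rfl; simp at hm; linarith
  refine ⟨n, ?_⟩
  have hdn : (D ^ n) 0 0 = m ^ n ∧ (D ^ n) 0 1 = 0 ∧ (D ^ n) 1 0 = 0 ∧ (D ^ n) 1 1 = (m ^ n)⁻¹ := by
    clear hn
    induction n with
    | zero => simp
    | succ n ih =>
      obtain ⟨i1, i2, i3, i4⟩ := ih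
      rw [Matrix.SpecialLinearGroup.coe_pow] at i1 i2 i3 i4
      rw [pow_succ]
      simp [Matrix.mul_apply, Fin.sum_univ_two, i1, i2, i3, i4, d00, d01, d10, d11, pow_succ, mul_comm]
  obtain ⟨e00, e01, e10, e11⟩ := hdn
  set E := D ^ n with hE
  set N := m ^ n with hN
  have hNn : K ^ 2 < ‖N‖ := by rw [hN, norm_pow]; exact hn
  have hN0 : 0 < ‖N‖ := lt_trans (by positivity) hNn
  have f00 : (E⁻¹) 0 0 = N⁻¹ := by simp [Matrix.SpecialLinearGroup.SL2_inv_expl, e11]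
  have f01 : (E⁻¹) 0 1 = 0 := by simp [Matrix.SpecialLinearGroup.SL2_inv_expl, e01]
  have f10 : (E⁻¹) 1 0 = 0 := by simp [Matrix.SpecialLinearGroup.SL2_inv_expl, e10]
  have f11 : (E⁻¹) 1 1 = N := by simp [Matrix.SpecialLinearGroup.SL2_inv_expl, e00]
  have hEX : ∀ p, p ∉ bY K → E • p ∈ bX K := by
    intro p hp
    simp only [bY, Set.mem_ofPred_eq, not_lt] at hp
    rw [mem_bX_smul, e00, e01, e10, e11]
    simp only [zero_mul, add_zero, zero_add, norm_mul, norm_inv]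
    have h0 : 0 < ‖p.rep 0‖ := by
      rcases rep_ne p with h | h
      · exact norm_pos_iff.mpr h
      · have := norm_pos_iff.mpr h
        by_contra h'
        nlinarith [norm_nonneg (p.rep 0)]
    have h2 : ‖N‖⁻¹ ≤ 1 := inv_le_one_of_one_le₀ (by nlinarith)
    have h3 : ‖N‖⁻¹ * ‖p.rep 1‖ ≤ ‖p.rep 1‖ := by nlinarith [norm_nonneg (p.rep 1)]
    nlinarith
  have hEY : ∀ p, p ∉ bX K → E⁻¹ • p ∈ bY K := by
    intro p hp
    simp only [bX, Set.mem_ofPred_eq, not_lt] at hp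
    rw [mem_bY_smul, f00, f01, f10, f11]
    simp only [zero_mul, add_zero, zero_add, norm_mul, norm_inv]
    have h0 : 0 < ‖p.rep 1‖ := by
      rcases rep_ne p with h | h
      · have := norm_pos_iff.mpr h
        by_contra h'
        nlinarith [norm_nonneg (p.rep 1)]
      · exact norm_pos_iff.mpr h
    have h2 : ‖N‖⁻¹ ≤ 1 := inv_le_one_of_one_le₀ (by nlinarith)
    have h3 : ‖N‖⁻¹ * ‖p.rep 0‖ ≤ ‖p.rep 0‖ := by nlinarith [norm_nonneg (p.rep 0)]
    nlinarith
  have hXY : Disjoint (bX K) (bY K) := by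
    rw [Set.disjoint_left]
    intro p h1 h2
    simp only [bX, bY, Set.mem_ofPred_eq] at h1 h2
    nlinarith [norm_nonneg (p.rep 0), norm_nonneg (p.rep 1)]
  have hCN : ∀ p, p ∈ bX K ∪ bY K → C • p ∉ bX K ∪ bY K := by
    rintro p hp (h | h)
    · rw [mem_bX_smul] at h
      rcases hp with hp | hp
      · exact absurd h (not_lt.mpr (est (by linarith) (hK2 _ _ _ _) (hM _ _) (hM _ _) (hM _ _) (hK _ _) hK1.le hp))
      · rw [add_comm, add_comm (C 0 0 * _)] at h
        exact absurd h (not_lt.mpr (est (by linarith) (hK2 _ _ _ _) (hM _ _) (hM _ _) (hM _ _) (hK _ _) hK1.le hp))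
    · rw [mem_bY_smul] at h
      rcases hp with hp | hp
      · exact absurd h (not_lt.mpr (est (by linarith) (hK2 _ _ _ _) (hM _ _) (hM _ _) (hM _ _) (hK _ _) hK1.le hp))
      · rw [add_comm, add_comm (C 1 0 * _)] at h
        exact absurd h (not_lt.mpr (est (by linarith) (hK2 _ _ _ _) (hM _ _) (hM _ _) (hM _ _) (hK _ _) hK1.le hp))
  let X : Fin 2 → Set PL := ![bX K, {p | C⁻¹ • p ∈ bX K}]
  let Y : Fin 2 → Set PL := ![bY K, {p | C⁻¹ • p ∈ bY K}]
  have hdis : ∀ p, p ∈ bX K ∪ bY K → C⁻¹ • p ∈ bX K ∪ bY K → False := by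
    intro p h1 h2
    apply hCN _ h2
    rwa [smul_inv_smul]
  have hne : (bX K).Nonempty := by
    refine ⟨Projectivization.mk ℂ ![1, 0] (by simp), ?_⟩
    obtain ⟨a, ha⟩ := Projectivization.exists_smul_eq_mk_rep ℂ (![1, 0] : Fin 2 → ℂ) (by simp)
    simp [bX, ← ha, Units.smul_def]
  unfold Free2
  refine FreeGroup.injective_lift_of_ping_pong (α := PL) ![ppi E, ppi (C * E * C⁻¹)] X Y ?_ ?_ ?_ ?_ ?_ ?_
  · intro i
    fin_cases i
    · exact hne
    · obtain ⟨p, hp⟩ := hne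
      exact ⟨C • p, by simpa [X] using hp⟩
  · intro i j hij
    rw [Function.onFun, Set.disjoint_left]
    intro p
    fin_cases i <;> fin_cases j <;> simp [X] at hij ⊢
    · exact fun h1 h2 => hdis p (Or.inl h1) (Or.inl h2)
    · exact fun h1 h2 => hdis p (Or.inl h2) (Or.inl h1)
  · intro i j hij
    rw [Function.onFun, Set.disjoint_left]
    intro p
    fin_cases i <;> fin_cases j <;> simp [Y] at hij ⊢
    · exact fun h1 h2 => hdis p (Or.inr h1) (Or.inr h2)
    · exact fun h1 h2 => hdis p (Or.inr h2) (Or.inr h1)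
  · intro i j
    rw [Set.disjoint_left] at hXY ⊢
    intro p
    fin_cases i <;> fin_cases j <;> simp [X, Y]
    · exact fun h1 => hXY h1
    · exact fun h1 h2 => hdis p (Or.inl h1) (Or.inr h2)
    · exact fun h1 h2 => hdis p (Or.inr h2) (Or.inl h1)
    · exact fun h1 => hXY h1
  · intro i
    rintro _ ⟨p, hp, rfl⟩
    fin_cases i
    · exact hEX p hp
    · change C⁻¹ • ((C * E * C⁻¹) • p) ∈ bX K
      rw [smul_smul, show C⁻¹ * (C * E * C⁻¹) = E * C⁻¹ by group, mul_smul]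
      exact hEX _ hp
  · intro i
    rintro _ ⟨p, hp, rfl⟩
    fin_cases i
    · change (ppi E)⁻¹ p ∈ bY K
      rw [← map_inv]
      exact hEY p hp
    · change C⁻¹ • ((ppi (C * E * C⁻¹))⁻¹ p) ∈ bY K
      rw [← map_inv]
      change C⁻¹ • ((C * E * C⁻¹)⁻¹ • p) ∈ bY K
      rw [smul_smul, show C⁻¹ * (C * E * C⁻¹)⁻¹ = E⁻¹ * C⁻¹ by group, mul_smul]
      exact hEY _ hp

end

section
open scoped LinearAlgebra.Projectivization Pointwise MatrixGroups
lemma free2_conj {T : Type*} [Group T] {P Q : T} (g : T) (h : Free2 P Q) :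
    Free2 (g * P * g⁻¹) (g * Q * g⁻¹) := by
  have e : (FreeGroup.lift ![g * P * g⁻¹, g * Q * g⁻¹] : FreeGroup (Fin 2) →* T) =
      (MulAut.conj g).toMonoidHom.comp (FreeGroup.lift ![P, Q]) := by
    ext i; fin_cases i <;> simp
  unfold Free2
  rw [e]
  exact (MulAut.conj g).injective.comp h

lemma exists_eig (t : ℂ) (h1 : ∀ c : ℝ, 0 ≤ c → c ≤ 4 → t ^ 2 ≠ c) :
    ∃ m : ℂ, 1 < ‖m‖ ∧ t = m + m⁻¹ := by
  obtain ⟨s, hs⟩ := IsAlgClosed.exists_pow_nat_eq (t ^ 2 - 4) (n := 2) (by norm_num)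
  have key : ∀ m : ℂ, m ≠ 0 → t = m + m⁻¹ → ‖m‖ ≠ 1 := by
    intro m _ ht hn
    have hi : m⁻¹ = (starRingEnd ℂ) m := by
      rw [Complex.inv_def, Complex.normSq_eq_norm_sq, hn]; simp
    rw [hi, Complex.add_conj] at ht
    have hre : |m.re| ≤ 1 := hn ▸ Complex.abs_re_le_norm m
    refine h1 ((2 * m.re) ^ 2) (by positivity) ?_ ?_
    · rw [abs_le] at hre; nlinarith
    · rw [ht]; push_cast; ring
  have hm : ((t + s) / 2) * ((t - s) / 2) = 1 := by
    linear_combination (-1 / 4 : ℂ) * hs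
  have hm0 : (t + s) / 2 ≠ 0 := left_ne_zero_of_mul_eq_one hm
  have hinv : ((t + s) / 2)⁻¹ = (t - s) / 2 := inv_eq_of_mul_eq_one_right hm
  have ht : t = (t + s) / 2 + ((t + s) / 2)⁻¹ := by rw [hinv]; ring
  rcases lt_or_gt_of_ne (key _ hm0 ht) with h | h
  · refine ⟨((t + s) / 2)⁻¹, ?_, ?_⟩
    · rw [norm_inv]; exact (one_lt_inv₀ (norm_pos_iff.mpr hm0)).mpr h
    · rw [inv_inv, add_comm]; exact ht
  · exact ⟨_, h, ht⟩

lemma pp_main (A C : SL2) (h1 : ∀ c : ℝ, 0 ≤ c → c ≤ 4 → (A 0 0 + A 1 1) ^ 2 ≠ c)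
    (h2 : (A.1 * C.1 - C.1 * A.1).det ≠ 0)
    (h3 : (A.1 * C.1 + C.1 * A.1 - (A 0 0 + A 1 1) • C.1).det ≠ 0) :
    ∃ n : ℕ, Free2 (ppi (A ^ n)) (ppi (C * A ^ n * C⁻¹)) := by
  obtain ⟨m, hm, ht⟩ := exists_eig _ h1
  have hm0 : m ≠ 0 := by rintro rfl; simp at hm; linarith
  have hdet : A 0 0 * A 1 1 - A 0 1 * A 1 0 = 1 := by
    have := A.2; rwa [Matrix.det_fin_two] at this
  have hmm : m * m⁻¹ = 1 := mul_inv_cancel₀ hm0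
  have hne : m - m⁻¹ ≠ 0 := by
    intro h
    have : m * m = 1 := by
      have : m = m⁻¹ := sub_eq_zero.mp h
      nth_rewrite 2 [this]; exact hmm
    have : ‖m‖ * ‖m‖ = 1 := by rw [← norm_mul, this, norm_one]
    nlinarith
  have ex : ∀ z : ℂ, z * z = (A 0 0 + A 1 1) * z - 1 → ∃ v : Fin 2 → ℂ, v ≠ 0 ∧
      A 0 0 * v 0 + A 0 1 * v 1 = z * v 0 ∧ A 1 0 * v 0 + A 1 1 * v 1 = z * v 1 := by
    intro z hz
    have : (A.1 - z • (1 : Matrix (Fin 2) (Fin 2) ℂ)).det = 0 := by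
      rw [Matrix.det_fin_two]; simp
      linear_combination hdet + hz
    obtain ⟨v, hv, hv'⟩ := Matrix.exists_mulVec_eq_zero_iff.mpr this
    refine ⟨v, hv, ?_, ?_⟩
    · have := congrFun hv' 0
      simp [Matrix.mulVec, dotProduct, Fin.sum_univ_two] at this
      linear_combination this
    · have := congrFun hv' 1
      simp [Matrix.mulVec, dotProduct, Fin.sum_univ_two] at this
      linear_combination this
  obtain ⟨v, hv, v0, v1⟩ := ex m (by rw [ht]; linear_combination -hmm)
  obtain ⟨w, hw, w0, w1⟩ := ex m⁻¹ (by rw [ht]; linear_combination -hmm)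
  have hd : v 0 * w 1 - v 1 * w 0 ≠ 0 := by
    intro hd
    have a0 : (m - m⁻¹) * (v 0 * w 0) = 0 := by
      linear_combination -w 0 * v0 + v 0 * w0 - A 0 1 * hd
    have a1 : (m - m⁻¹) * (v 1 * w 1) = 0 := by
      linear_combination -w 1 * v1 + v 1 * w1 + A 1 0 * hd
    have b0 := (mul_eq_zero.mp a0).resolve_left hne
    have b1 := (mul_eq_zero.mp a1).resolve_left hne
    have hv2 : v 0 ≠ 0 ∨ v 1 ≠ 0 := by
      by_contra h; push Not at h; exact hv (by ext i; fin_cases i <;> simp [h])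
    have hw2 : w 0 ≠ 0 ∨ w 1 ≠ 0 := by
      by_contra h; push Not at h; exact hw (by ext i; fin_cases i <;> simp [h])
    grind
  set δ := v 0 * w 1 - v 1 * w 0 with hδ
  let g : SL2 := ⟨!![v 0 / δ, w 0; v 1 / δ, w 1], by
    rw [Matrix.det_fin_two]; simp; field_simp; rw [hδ]; ring⟩
  let D : SL2 := ⟨!![m, 0; 0, m⁻¹], by rw [Matrix.det_fin_two]; simp [hm0]⟩
  have hAg : A * g = g * D := by
    have g00 : g 0 0 = v 0 / δ := rfl
    have g01 : g 0 1 = w 0 := rfl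
    have g10 : g 1 0 = v 1 / δ := rfl
    have g11 : g 1 1 = w 1 := rfl
    have D00 : D 0 0 = m := rfl
    have D01 : D 0 1 = 0 := rfl
    have D10 : D 1 0 = 0 := rfl
    have D11 : D 1 1 = m⁻¹ := rfl
    clear_value g D
    ext i j
    rw [Matrix.SpecialLinearGroup.coe_mul, Matrix.SpecialLinearGroup.coe_mul, Matrix.mul_apply,
      Matrix.mul_apply, Fin.sum_univ_two, Fin.sum_univ_two]
    fin_cases i <;> fin_cases j <;> simp only [Fin.zero_eta, Fin.mk_one, g00, g01, g10, g11, D00, D01, D10, D11]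
    · linear_combination v0 / δ
    · linear_combination w0
    · linear_combination v1 / δ
    · linear_combination w1
  have hA : A = g * D * g⁻¹ := by rw [← hAg]; group
  obtain ⟨B, hC⟩ : ∃ B : SL2, C = g * B * g⁻¹ := ⟨g⁻¹ * C * g, by group⟩
  have e1 : A.1 * C.1 = (g * (D * B) * g⁻¹).1 := by
    rw [← Matrix.SpecialLinearGroup.coe_mul]
    have : A * C = g * (D * B) * g⁻¹ := by rw [hA, hC]; group
    rw [this]
  have e2 : C.1 * A.1 = (g * (B * D) * g⁻¹).1 := by
    rw [← Matrix.SpecialLinearGroup.coe_mul]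
    have : C * A = g * (B * D) * g⁻¹ := by rw [hA, hC]; group
    rw [this]
  have c2 : A.1 * C.1 - C.1 * A.1 = g.1 * (D.1 * B.1 - B.1 * D.1) * (g⁻¹).1 := by
    rw [e1, e2]; simp [mul_sub, sub_mul]
  have c3 : A.1 * C.1 + C.1 * A.1 - (A 0 0 + A 1 1) • C.1 =
      g.1 * (D.1 * B.1 + B.1 * D.1 - (m + m⁻¹) • B.1) * (g⁻¹).1 := by
    have e3 : C.1 = (g * B * g⁻¹).1 := by rw [← hC]
    rw [e1, e2, ht, e3]; simp [mul_sub, sub_mul, mul_add, add_mul]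
  rw [c2, Matrix.det_mul, Matrix.det_mul, g.2, (g⁻¹).2, one_mul, mul_one, Matrix.det_fin_two] at h2
  rw [c3, Matrix.det_mul, Matrix.det_mul, g.2, (g⁻¹).2, one_mul, mul_one, Matrix.det_fin_two] at h3
  have D00 : D.1 0 0 = m := rfl
  have D01 : D.1 0 1 = 0 := rfl
  have D10 : D.1 1 0 = 0 := rfl
  have D11 : D.1 1 1 = m⁻¹ := rfl
  simp only [Matrix.sub_apply, Matrix.add_apply, Matrix.smul_apply, Matrix.mul_apply,
    Fin.sum_univ_two, D00, D01, D10, D11, smul_eq_mul] at h2 h3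
  have hBB : ∀ i j, B i j ≠ 0 := by
    intro i j hij
    fin_cases i <;> fin_cases j <;> simp only [Fin.zero_eta, Fin.mk_one] at hij
    · apply h3; rw [hij]; ring
    · apply h2; rw [hij]; ring
    · apply h2; rw [hij]; ring
    · apply h3; rw [hij]; ring
  obtain ⟨n, hn⟩ := pp_diag D B m hm rfl rfl rfl rfl hBB
  refine ⟨n, ?_⟩
  have := free2_conj (ppi g) hn
  rw [← map_inv, ← map_mul, ← map_mul, ← map_mul, ← map_mul] at this
  rw [hC, hA]
  convert this using 2
  · rw [conj_pow]
  · rw [conj_pow]; group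

def trc (A : SL2) : ℂ := A 0 0 + A 1 1

lemma sl_det (A : SL2) : A 0 0 * A 1 1 - A 0 1 * A 1 0 = 1 := by
  have := A.2; rwa [Matrix.det_fin_two] at this

lemma sl_mul_apply (A B : SL2) (i j : Fin 2) : (A * B) i j = A i 0 * B 0 j + A i 1 * B 1 j := by
  rw [Matrix.SpecialLinearGroup.coe_mul, Matrix.mul_apply, Fin.sum_univ_two]

lemma pp_tr (P Q : SL2) (a b t : ℂ) (ha : trc P = a) (hb : trc Q = b) (ht : trc (P * Q) = t)
    (h1 : ∀ c : ℝ, 0 ≤ c → c ≤ 4 → t ^ 2 ≠ c)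
    (h2 : a ^ 2 + b ^ 2 + t ^ 2 - a * b * t - 4 ≠ 0)
    (h3 : a ^ 2 - a * b * t + b ^ 2 ≠ 0) :
    ∃ n : ℕ, Free2 (ppi ((P * Q) ^ n)) (ppi (P * (P * Q) ^ n * P⁻¹)) := by
  have dP := sl_det P
  have dQ := sl_det Q
  simp only [trc, sl_mul_apply] at ha hb ht
  apply pp_main
  · simp only [sl_mul_apply, ht]; exact h1
  · rw [show (P * Q).1 * P.1 - P.1 * (P * Q).1 = P.1 * (Q.1 * P.1 - P.1 * Q.1) by
      rw [Matrix.SpecialLinearGroup.coe_mul]; noncomm_ring, Matrix.det_mul, P.2, one_mul]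
    intro h
    apply h2
    rw [Matrix.det_fin_two] at h
    simp only [Matrix.sub_apply, Matrix.mul_apply, Fin.sum_univ_two] at h
    generalize P.1 0 0 = p at *
    generalize P.1 0 1 = q at *
    generalize P.1 1 0 = r at *
    generalize P.1 1 1 = s at *
    generalize Q.1 0 0 = p' at *
    generalize Q.1 0 1 = q' at *
    generalize Q.1 1 0 = r' at *
    generalize Q.1 1 1 = s' at *
    subst ha hb ht
    grind
  · rw [show (P * Q).1 * P.1 + P.1 * (P * Q).1 - ((P * Q) 0 0 + (P * Q) 1 1) • P.1
        = P.1 * (Q.1 * P.1 + P.1 * Q.1 - t • 1) by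
      simp only [sl_mul_apply, ht]
      rw [Matrix.SpecialLinearGroup.coe_mul, mul_sub, mul_smul_comm, mul_one]; noncomm_ring,
      Matrix.det_mul, P.2, one_mul]
    intro h
    apply h3
    rw [Matrix.det_fin_two] at h
    simp [Matrix.mul_apply, Fin.sum_univ_two] at h
    generalize P.1 0 0 = p at *
    generalize P.1 0 1 = q at *
    generalize P.1 1 0 = r at *
    generalize P.1 1 1 = s at *
    generalize Q.1 0 0 = p' at *
    generalize Q.1 0 1 = q' at *
    generalize Q.1 1 0 = r' at *
    generalize Q.1 1 1 = s' at *
    subst ha hb ht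
    grind

end

section
section hnn
variable {K : Type} [Group K] (A B : Subgroup K) (φ : A ≃* B) (b b' : K)

def hε (c : Fin 2 × Bool) : ℤˣ := if c.2 then 1 else -1
def hα (c : Fin 2 × Bool) : K := if c.1 = 0 then 1 else if c.2 then b' else b⁻¹
def hβ (c : Fin 2 × Bool) : K := if c.1 = 0 then 1 else if c.2 then b else b'⁻¹
def hhd (l : List (Fin 2 × Bool)) : K := (l.head?.map (hα b b')).getD 1
def hrl : List (Fin 2 × Bool) → List (ℤˣ × K)
  | [] => []
  | c :: l => (hε c, hβ b b' c * hhd b b' l) :: hrl l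

lemma hrl_prod (l : List (Fin 2 × Bool)) :
    (HNNExtension.of (hhd b b' l) : HNNExtension K A B φ) *
      ((hrl b b' l).map fun x => HNNExtension.t ^ (x.1 : ℤ) * HNNExtension.of x.2).prod =
    (l.map fun x => cond x.2 (![HNNExtension.t, HNNExtension.of b' * HNNExtension.t * HNNExtension.of b] x.1)
      (![HNNExtension.t, HNNExtension.of b' * HNNExtension.t * HNNExtension.of b] x.1)⁻¹).prod := by
  induction l with
  | nil => simp [hhd, hrl]
  | cons c l ih =>
    rw [List.map_cons, List.prod_cons, ← ih]
    simp only [hrl, List.map_cons, List.prod_cons]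
    obtain ⟨i, s⟩ := c
    fin_cases i <;> cases s <;> simp [hhd, hα, hβ, hε, mul_assoc]

lemma hnn_free (hb : b ∉ A) (hb' : b' ∉ B) :
    Free2 (HNNExtension.t : HNNExtension K A B φ)
      (HNNExtension.of b' * HNNExtension.t * HNNExtension.of b) := by
  unfold Free2
  rw [injective_iff_map_eq_one]
  intro g hg
  have hred : (g.toWord).IsChain (fun a c => a.1 = c.1 → a.2 = c.2) := FreeGroup.isReduced_toWord
  rw [← FreeGroup.mk_toWord (x := g), FreeGroup.lift_mk, ← hrl_prod A B φ] at hg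
  have hch : (hrl b b' g.toWord).IsChain
      (fun x y => x.2 ∈ HNNExtension.toSubgroup A B x.1 → x.1 = y.1) := by
    generalize g.toWord = l at hred
    clear hg
    induction l with
    | nil => simp [hrl]
    | cons c l ih =>
      cases l with
      | nil => simp [hrl]
      | cons d l =>
        rw [List.isChain_cons_cons] at hred
        have := ih hred.2
        simp only [hrl] at this ⊢
        rw [List.isChain_cons_cons]
        refine ⟨?_, this⟩
        obtain ⟨i, s⟩ := c
        obtain ⟨j, r⟩ := d
        have h1 := hred.1
        fin_cases i <;> fin_cases j <;> cases s <;> cases r <;>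
          simp_all [hhd, hα, hβ, hε, HNNExtension.toSubgroup]
  have := HNNExtension.ReducedWord.toList_eq_nil_of_mem_of_range φ
    ⟨hhd b b' g.toWord, hrl b b' g.toWord, hch⟩ ⟨1, by rw [map_one]; exact hg.symm⟩
  simp only at this
  have h0 : g.toWord = [] := by
    cases h : g.toWord with
    | nil => rfl
    | cons c l => rw [h] at this; simp [hrl] at this
  exact FreeGroup.toWord_eq_nil_iff.mp h0
end hnn

lemma free2_of_map {T S : Type*} [Group T] [Group S] (f : T →* S) {P Q : T}
    (h : Free2 (f P) (f Q)) : Free2 P Q := by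
  have e : (FreeGroup.lift ![f P, f Q] : FreeGroup (Fin 2) →* S) =
      f.comp (FreeGroup.lift ![P, Q]) := by
    ext i; fin_cases i <;> simp
  unfold Free2 at h ⊢
  rw [e] at h
  exact Function.Injective.of_comp (f := f) h

/-- finite presentation property -/
def FPP {L : Type} [Group L] {ι : Type} (E : ι → L) : Prop :=
  (∀ l : L, ∃ es : List ι, l = (es.map E).prod) ∧
  ∃ N : ℕ, ∀ (H : Type) (_ : Group H) (S : ℕ → H → L → Prop) (η : ι → H), S 0 1 1 →
    (∀ n < N, ∀ e h l, S n h l → S (n + 1) (η e * h) (E e * l)) →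
    (∀ n ≤ N, ∀ h, S n h 1 → h = 1) → ∃ σ : L →* H, ∀ e, σ (E e) = η e

section bs
variable {L : Type} [Group L] {ι : Type} [Fintype ι] (E : ι → L) (χ : L →* Multiplicative ℤ) (t : L)

def bx (l : L) : ℤ := Multiplicative.toAdd (χ l)
def bgen (m : ℕ) : Set L := {l | ∃ j : ℤ, |j| ≤ m ∧ ∃ e : ι, l = t ^ j * (E e * t ^ (-bx χ (E e))) * t ^ (-j)}
def bB (m : ℕ) : Subgroup L := Subgroup.closure (bgen E χ t m)

lemma bx_mul (a b : L) : bx χ (a * b) = bx χ a + bx χ b := by simp [bx]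
lemma bx_inv (a : L) : bx χ (a⁻¹) = - bx χ a := by simp [bx]
lemma bx_one : bx χ 1 = 0 := by simp [bx]
lemma bx_zpow (a : L) (n : ℤ) : bx χ (a ^ n) = n * bx χ a := by simp [bx]

lemma bgen_finite (m : ℕ) : (bgen E χ t m).Finite := by
  have : bgen E χ t m ⊆ (fun p : ℤ × ι => t ^ p.1 * (E p.2 * t ^ (-bx χ (E p.2))) * t ^ (-p.1)) ''
      (Set.Icc (-(m : ℤ)) m ×ˢ Set.univ) := by
    rintro l ⟨j, hj, e, rfl⟩
    exact ⟨(j, e), ⟨abs_le.mp hj, trivial⟩, rfl⟩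
  exact Set.Finite.subset (((Set.finite_Icc _ _).prod Set.finite_univ).image _) this

lemma bB_mono {m n : ℕ} (h : m ≤ n) : bB E χ t m ≤ bB E χ t n := by
  apply Subgroup.closure_mono
  rintro l ⟨j, hj, e, rfl⟩
  exact ⟨j, hj.trans (by exact_mod_cast h), e, rfl⟩

lemma bB_conj {m : ℕ} {b : L} (hb : b ∈ bB E χ t m) (i : ℤ) (n : ℕ) (hn : m + |i| ≤ n) :
    t ^ i * b * t ^ (-i) ∈ bB E χ t n := by
  have : bB E χ t m ≤ (bB E χ t n).comap (MulAut.conj (t ^ i)).toMonoidHom := by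
    rw [bB, Subgroup.closure_le]
    rintro l ⟨j, hj, e, rfl⟩
    refine Subgroup.subset_closure ⟨i + j, ?_, e, ?_⟩
    · refine (abs_add_le _ _).trans ?_; omega
    · change t ^ i * _ * (t ^ i)⁻¹ = _
      group
  have := this hb
  rw [zpow_neg]
  exact this

lemma bB_ker (ht : bx χ t = 1) {m : ℕ} {b : L} (hb : b ∈ bB E χ t m) : bx χ b = 0 := by
  have : bB E χ t m ≤ χ.ker := by
    rw [bB, Subgroup.closure_le]
    rintro l ⟨j, hj, e, rfl⟩
    have : bx χ (t ^ j * (E e * t ^ (-bx χ (E e))) * t ^ (-j)) = 0 := by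
      simp only [bx_mul, bx_zpow, ht]; ring
    exact this
  exact this hb

theorem bs (hE : FPP E) (ht : bx χ t = 1) (hL : ∀ P Q : L, ¬ Free2 P Q) :
    ∃ m : ℕ, (∀ b ∈ bB E χ t m, t * b * t⁻¹ ∈ bB E χ t m) ∨
      (∀ b ∈ bB E χ t m, t⁻¹ * b * t ∈ bB E χ t m) := by
  obtain ⟨hgen, N, hN⟩ := hE
  obtain ⟨es, hes⟩ := hgen t
  obtain ⟨c, hc⟩ : ∃ c : ℕ, ∀ e, |bx χ (E e)| ≤ c := by
    refine ⟨∑ e, (bx χ (E e)).natAbs, fun e => ?_⟩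
    rw [Int.abs_eq_natAbs]
    exact_mod_cast Finset.single_le_sum (f := fun e => (bx χ (E e)).natAbs) (fun _ _ => Nat.zero_le _) (Finset.mem_univ e)
  set N' := max N es.length with hN'
  set m := (N' + 1) * c + 1 with hm
  refine ⟨m, ?_⟩
  set K := bB E χ t m with hK
  by_contra hcon
  push Not at hcon
  obtain ⟨⟨b, hb, hb1⟩, ⟨b', hb', hb1'⟩⟩ := hcon
  let A : Subgroup K := (K.comap (MulAut.conj t).toMonoidHom).subgroupOf K
  let A' : Subgroup K := (K.comap (MulAut.conj t⁻¹).toMonoidHom).subgroupOf K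
  have mA : ∀ k : K, k ∈ A ↔ t * k * t⁻¹ ∈ K := fun k => by simp [A, Subgroup.mem_subgroupOf]
  have mA' : ∀ k : K, k ∈ A' ↔ t⁻¹ * k * t ∈ K := fun k => by simp [A', Subgroup.mem_subgroupOf]
  let φ : A ≃* A' :=
    { toFun := fun k => ⟨⟨t * k * t⁻¹, (mA _).mp k.2⟩, (mA' _).mpr (by
        simp only [mul_assoc, inv_mul_cancel_left, inv_mul_cancel, mul_one]; exact k.1.2)⟩
      invFun := fun k => ⟨⟨t⁻¹ * k * t, (mA' _).mp k.2⟩, (mA _).mpr (by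
        simp only [mul_assoc, mul_inv_cancel_left, mul_inv_cancel, mul_one]; exact k.1.2)⟩
      left_inv := fun k => by ext; simp [mul_assoc]
      right_inv := fun k => by ext; simp [mul_assoc]
      map_mul' := fun k k' => by ext; simp [mul_assoc] }
  let H := HNNExtension K A A' φ
  let T : H := HNNExtension.t
  let o : K →* H := HNNExtension.of
  have step : ∀ (k : K) (h : t * k * t⁻¹ ∈ K), T * o k * T⁻¹ = o ⟨t * k * t⁻¹, h⟩ := by
    intro k h
    exact (HNNExtension.equiv_eq_conj (φ := φ) ⟨k, (mA k).mpr h⟩).symm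
  have step' : ∀ (k : K) (h : t⁻¹ * k * t ∈ K), T⁻¹ * o k * T = o ⟨t⁻¹ * k * t, h⟩ := by
    intro k h
    exact (HNNExtension.equiv_symm_eq_conj (φ := φ) ⟨k, (mA' k).mpr h⟩).symm
  have hfree : Free2 T (o ⟨b', hb'⟩ * T * o ⟨b, hb⟩) :=
    hnn_free A A' φ _ _ (fun h => hb1 ((mA _).mp h)) (fun h => hb1' ((mA' _).mp h))
  clear_value T o
  have conjn : ∀ (i : ℕ) (n : ℕ) (k : K), (k : L) ∈ bB E χ t n → n + i ≤ m →
      (∃ h : t ^ (i : ℤ) * k * t ^ (-(i : ℤ)) ∈ K, T ^ (i : ℤ) * o k * T ^ (-(i : ℤ)) = o ⟨_, h⟩) ∧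
      (∃ h : t ^ (-(i : ℤ)) * k * t ^ (i : ℤ) ∈ K, T ^ (-(i : ℤ)) * o k * T ^ (i : ℤ) = o ⟨_, h⟩) := by
    intro i
    induction i with
    | zero => intro n k hk hn; simp
    | succ i ih =>
      intro n k hk hn
      obtain ⟨⟨h1, h2⟩, ⟨h3, h4⟩⟩ := ih n k hk (by omega)
      constructor
      · have h5 : t ^ ((i + 1 : ℕ) : ℤ) * k * t ^ (-((i + 1 : ℕ) : ℤ)) ∈ K :=
          bB_conj E χ t hk _ _ (by rw [abs_of_nonneg (by positivity)]; exact_mod_cast hn)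
        refine ⟨h5, ?_⟩
        have e : t ^ ((i + 1 : ℕ) : ℤ) * k * t ^ (-((i + 1 : ℕ) : ℤ)) =
            t * (t ^ (i : ℤ) * k * t ^ (-(i : ℤ))) * t⁻¹ := by push_cast; group
        have := step ⟨_, h1⟩ (by rw [← e]; exact h5)
        rw [← h2] at this
        calc _ = T * (T ^ (i : ℤ) * o k * T ^ (-(i : ℤ))) * T⁻¹ := by push_cast; group
          _ = _ := this
          _ = _ := by congr 2; exact e.symm
      · have h5 : t ^ (-((i + 1 : ℕ) : ℤ)) * k * t ^ (((i + 1 : ℕ) : ℤ)) ∈ K := by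
          have := bB_conj E χ t hk (-((i + 1 : ℕ) : ℤ)) m (by rw [abs_neg, abs_of_nonneg (by positivity)]; exact_mod_cast hn)
          rwa [neg_neg] at this
        refine ⟨h5, ?_⟩
        have e : t ^ (-((i + 1 : ℕ) : ℤ)) * k * t ^ (((i + 1 : ℕ) : ℤ)) =
            t⁻¹ * (t ^ (-(i : ℤ)) * k * t ^ (i : ℤ)) * t := by push_cast; group
        have := step' ⟨_, h3⟩ (by rw [← e]; exact h5)
        rw [← h4] at this
        calc _ = T⁻¹ * (T ^ (-(i : ℤ)) * o k * T ^ (i : ℤ)) * T := by push_cast; group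
          _ = _ := this
          _ = _ := by congr 2; exact e.symm
  have conjz : ∀ (i : ℤ) (n : ℕ) (k : K), (k : L) ∈ bB E χ t n → n + |i| ≤ m →
      ∃ h : t ^ i * k * t ^ (-i) ∈ K, T ^ i * o k * T ^ (-i) = o ⟨_, h⟩ := by
    intro i n k hk hn
    have h := conjn i.natAbs n k hk (by rw [Int.abs_eq_natAbs] at hn; exact_mod_cast hn)
    rcases Int.natAbs_eq i with hi | hi
    · rw [hi]; exact h.1
    · rw [hi, neg_neg]; exact h.2
  have agen : ∀ e, E e * t ^ (-bx χ (E e)) ∈ bB E χ t 0 := fun e =>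
    Subgroup.subset_closure ⟨0, by simp, e, by simp⟩
  have agK : ∀ e, E e * t ^ (-bx χ (E e)) ∈ K := fun e => bB_mono E χ t (Nat.zero_le _) (agen e)
  let η : ι → H := fun e => o ⟨_, agK e⟩ * T ^ (bx χ (E e))
  let S : ℕ → H → L → Prop := fun n h l =>
    ∃ k : K, (k : L) ∈ bB E χ t (n * c) ∧ h = o k * T ^ bx χ l ∧ l = k * t ^ bx χ l
  have S0 : S 0 1 1 := ⟨1, one_mem _, by simp [bx_one], by simp [bx_one]⟩
  have Sstep : ∀ n < N', ∀ e h l, S n h l → S (n + 1) (η e * h) (E e * l) := by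
    rintro n hn e h l ⟨k, hk, rfl, hl⟩
    have hb := hc e
    have hle : ((n * c : ℕ) : ℤ) + |bx χ (E e)| ≤ ((n + 1) * c : ℕ) := by push_cast; linarith
    have hle2 : (n + 1) * c ≤ m := by rw [hm]; nlinarith
    have hmem := bB_conj E χ t hk (bx χ (E e)) ((n + 1) * c) hle
    obtain ⟨h1, h2⟩ := conjz (bx χ (E e)) (n * c) k hk (hle.trans (by exact_mod_cast hle2))
    refine ⟨⟨_, agK e⟩ * ⟨_, h1⟩, ?_, ?_, ?_⟩
    · exact mul_mem (bB_mono E χ t (Nat.zero_le _) (agen e)) hmem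
    · rw [map_mul, ← h2, bx_mul]; simp only [η]; group
    · rw [bx_mul]; conv_lhs => rw [hl]
      simp only [Subgroup.coe_mul]; group
  have S1 : ∀ n ≤ N', ∀ h, S n h 1 → h = 1 := by
    rintro n hn h ⟨k, hk, rfl, hl⟩
    rw [bx_one, zpow_zero, mul_one] at hl ⊢
    have : k = 1 := by ext; exact hl.symm
    rw [this, map_one]
  obtain ⟨σ, hσ⟩ := hN H _ S η S0 (fun n hn => Sstep n (hn.trans_le (le_max_left _ _)))
    (fun n hn => S1 n (hn.trans (le_max_left _ _)))
  have Sl : ∀ l : List ι, l.length ≤ N' → S l.length (σ (l.map E).prod) (l.map E).prod := by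
    intro l
    induction l with
    | nil => intro _; simpa using S0
    | cons e l ih =>
      intro hl
      simp only [List.length_cons] at hl
      have := Sstep _ (by omega) e _ _ (ih (by omega))
      simpa [hσ] using this
  have hσt : σ t = T := by
    obtain ⟨k, hk, h1, h2⟩ := Sl es (le_max_right _ _)
    rw [← hes, ht] at h1 h2
    have : k = 1 := by ext; simpa using h2
    rw [h1, this]; simp
  have hσK : ∀ k : K, σ k = o k := by
    have : K ≤ (Subgroup.map K.subtype (MonoidHom.eqLocus (σ.comp K.subtype) o)) := by
      refine (Subgroup.closure_le _).mpr ?_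
      rintro l ⟨j, hj, e, rfl⟩
      obtain ⟨h1, h2⟩ := conjz j 0 ⟨_, agK e⟩ (agen e) (by simpa using hj)
      refine ⟨⟨_, h1⟩, ?_, rfl⟩
      change σ _ = o _
      rw [← h2]
      have h3 : η e * T ^ (-bx χ (E e)) = o ⟨_, agK e⟩ := by
        simp only [η, zpow_neg, mul_inv_cancel_right]
      rw [← h3, Subgroup.subtype_apply, map_mul, map_mul, map_mul, map_zpow, map_zpow, map_zpow, hσ, hσt]
    intro k
    obtain ⟨k', h1, h2⟩ := this k.2
    have : k' = k := by ext; exact h2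
    rw [← this]; exact h1
  apply hL t (b' * t * b)
  apply free2_of_map σ
  rw [map_mul, map_mul, hσt, hσK ⟨b, hb⟩, hσK ⟨b', hb'⟩]
  exact hfree
end bs

end

section
theorem bs_aff {K : Type} [NormedField K] [IsUltrametricDist K] {L : Type} [Group L] {ι : Type} [Fintype ι]
    (E : ι → L) (χ : L →* Multiplicative ℤ) (t : L) (hE : FPP E) (ht : bx χ t = 1)
    (hL : ∀ P Q : L, ¬ Free2 P Q) (ρ : Bool → L →* K) (z : Bool → L → K)
    (hz : ∀ i a b, z i (a * b) = z i a + ρ i a * z i b)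
    (hρ : ∀ i l, bx χ l = 0 → ‖ρ i l‖ = 1) (h0 : 1 < ‖ρ true t‖) (h1 : ‖ρ false t‖ < 1) :
    ∃ i v, ∀ l, z i l = v - ρ i l * v := by
  obtain ⟨m, hm⟩ := bs E χ t hE ht hL
  obtain ⟨i, s, hs, hs1⟩ : ∃ i, ∃ s : L, (∀ b ∈ bB E χ t m, s * b * s⁻¹ ∈ bB E χ t m) ∧
      ((i = true ∧ s = t) ∨ (i = false ∧ s = t⁻¹)) := by
    rcases hm with hm | hm
    · exact ⟨true, t, hm, by simp⟩
    · exact ⟨false, t⁻¹, by simpa using hm, by simp⟩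
  have hs2 : 1 < ‖ρ i s‖ := by
    rcases hs1 with ⟨rfl, rfl⟩ | ⟨rfl, rfl⟩
    · exact h0
    · have hne : ρ false t ≠ 0 := by
        intro h
        have : ρ false (t * t⁻¹) = 0 := by rw [map_mul, h, zero_mul]
        simp at this
      have : ρ false t * ρ false t⁻¹ = 1 := by rw [← map_mul]; simp
      have h2 : ‖ρ false t‖ * ‖ρ false t⁻¹‖ = 1 := by rw [← norm_mul, this, norm_one]
      nlinarith [norm_nonneg (ρ false t⁻¹), norm_pos_iff.mpr hne]
  have hne : 1 - ρ i s ≠ 0 := by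
    intro h
    rw [sub_eq_zero] at h
    rw [← h, norm_one] at hs2; exact lt_irrefl _ hs2
  refine ⟨i, z i s / (1 - ρ i s), ?_⟩
  set v := z i s / (1 - ρ i s) with hv
  let y : L → K := fun l => z i l - (v - ρ i l * v)
  have ymul : ∀ a b, y (a * b) = y a + ρ i a * y b := by
    intro a b; simp only [y, hz, map_mul]; ring
  have ys : y s = 0 := by
    simp only [y]; rw [hv]; field_simp; ring
  have y1 : y 1 = 0 := by
    have := ymul 1 1; simp at this; exact this
  have yinv : ∀ a, y a⁻¹ = - (ρ i a⁻¹ * y a) := by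
    intro a
    have := ymul a⁻¹ a
    rw [inv_mul_cancel, y1] at this
    linear_combination -this
  have ysz : y s⁻¹ = 0 := by rw [yinv, ys]; simp
  have yt : y t = 0 := by
    rcases hs1 with ⟨_, rfl⟩ | ⟨_, rfl⟩
    · exact ys
    · simpa using ysz
  have yti : y t⁻¹ = 0 := by rw [yinv, yt]; simp
  have ytn : ∀ n : ℕ, y (t ^ n) = 0 := by
    intro n
    induction n with
    | zero => simpa using y1
    | succ n ih => rw [pow_succ, ymul, ih, yt]; simp
  have ytz : ∀ n : ℤ, y (t ^ n) = 0 := by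
    intro n
    rcases Int.eq_nat_or_neg n with ⟨k, rfl | rfl⟩
    · simpa using ytn k
    · rw [zpow_neg, yinv]; simp [ytn k]
  obtain ⟨M, hM⟩ : ∃ M : ℝ, ∀ b ∈ bgen E χ t m, ‖y b‖ ≤ M := by
    obtain ⟨M, hM⟩ := ((bgen_finite E χ t m).image (fun b => ‖y b‖)).bddAbove
    exact ⟨M, fun b hb => hM ⟨b, hb, rfl⟩⟩
  have hbd : ∀ b ∈ bB E χ t m, ‖y b‖ ≤ max M 0 := by
    intro b hb
    induction hb using Subgroup.closure_induction with
    | mem b hb => exact (hM b hb).trans (le_max_left _ _)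
    | one => rw [y1, norm_zero]; exact le_max_right _ _
    | mul a b ha hb iha ihb =>
      rw [ymul]
      refine (IsUltrametricDist.norm_add_le_max _ _).trans (max_le iha ?_)
      rw [norm_mul, hρ i a (bB_ker E χ t ht ha), one_mul]; exact ihb
    | inv a ha iha =>
      rw [yinv, norm_neg, norm_mul, hρ i _ (by rw [bx_inv, bB_ker E χ t ht ha, neg_zero]), one_mul]; exact iha
  have hconj : ∀ b, y (s * b * s⁻¹) = ρ i s * y b := by
    intro b; rw [ymul, ymul, ys, ysz]; ring
  have hpow : ∀ n : ℕ, ∀ b ∈ bB E χ t m, ‖ρ i s‖ ^ n * ‖y b‖ ≤ max M 0 := by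
    intro n
    induction n with
    | zero => intro b hb; simpa using hbd b hb
    | succ n ih =>
      intro b hb
      have := ih _ (hs b hb)
      rw [hconj, norm_mul] at this
      rw [pow_succ, mul_assoc]; exact this
  have hB0 : ∀ b ∈ bB E χ t m, y b = 0 := by
    intro b hb
    by_contra hne
    have hpos : 0 < ‖y b‖ := norm_pos_iff.mpr hne
    obtain ⟨n, hn⟩ := pow_unbounded_of_one_lt (max M 0 / ‖y b‖) hs2
    have := hpow n b hb
    rw [div_lt_iff₀ hpos] at hn
    linarith
  have hyE : ∀ e, y (E e) = 0 := by
    intro e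
    have h1 : E e * t ^ (-bx χ (E e)) ∈ bB E χ t m :=
      Subgroup.subset_closure ⟨0, by simp, e, by simp⟩
    have h2 : E e = (E e * t ^ (-bx χ (E e))) * t ^ (bx χ (E e)) := by group
    rw [h2, ymul, hB0 _ h1, ytz]; simp
  intro l
  obtain ⟨es, rfl⟩ := hE.1 l
  have : y (es.map E).prod = 0 := by
    induction es with
    | nil => simpa using y1
    | cons e es ih => rw [List.map_cons, List.prod_cons, ymul, ih, hyE]; simp
  exact sub_eq_zero.mp this

/-- letters -/
def wl (w : List (ℕ × ℕ)) : List Bool :=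
  w.flatMap fun p => List.replicate p.1 true ++ List.replicate p.2 false

def lt2 {G : Type*} (x y : G) (c : Bool) : G := cond c x y
def vl {G : Type*} [Monoid G] (x y : G) (v : List Bool) : G := (v.map (lt2 x y)).prod

lemma vl_wl {G : Type*} [Monoid G] (x y : G) (w) : vl x y (wl w) = ev x y w := by
  induction w with
  | nil => rfl
  | cons p w ih =>
    simp only [vl, wl, ev_cons, List.flatMap_cons, List.map_append, List.prod_append] at ih ⊢
    rw [ih]; simp [lt2]

lemma vl_rep {G : Type*} [Monoid G] (x y : G) (n : ℕ) (c : Bool) :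
    vl x y (List.replicate n c) = lt2 x y c ^ n := by
  rw [vl, List.map_replicate, List.prod_replicate]

def Univ (w : List (ℕ × ℕ)) {G : Type} [Group G] (x y : G) : Prop :=
  x ^ 3 = 1 ∧ y ^ 5 = 1 ∧ ev x y w ^ 2 = 1 ∧
  (∀ (T : Type) (_ : Group T) (X Y : T), X ^ 3 = 1 → Y ^ 5 = 1 → ev X Y w ^ 2 = 1 →
    ∃ F : G →* T, F x = X ∧ F y = Y) ∧
  (∀ g : G, ∃ v : List Bool, g = vl x y v)

section ind
variable {G : Type} [Group G] (x y : G) {ι : Type} (p : G →* Equiv.Perm ι) (i0 : ι) (g : ι → G)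

def stab : Subgroup G := (MulAction.stabilizer (Equiv.Perm ι) i0).comap p

lemma mem_stab {l : G} : l ∈ stab p i0 ↔ p l i0 = i0 := Iff.rfl

def Egen (hg : ∀ i, p (g i) i0 = i) (e : ι × Bool) : stab p i0 :=
  ⟨(g (p (lt2 x y e.2) e.1))⁻¹ * lt2 x y e.2 * g e.1, by
    rw [mem_stab, map_mul, map_mul, Equiv.Perm.mul_apply, Equiv.Perm.mul_apply, hg, map_inv,
      Equiv.Perm.inv_eq_iff_eq, hg]⟩

/-- path labels -/
def plab {H : Type} [Group H] (η : ι × Bool → H) : List Bool → ι → H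
  | [], _ => 1
  | c :: v, i => η (p (vl x y v) i, c) * plab η v i

def pX {H : Type} [Group H] (η : ι × Bool → H) (c : Bool) : Equiv.Perm (ι × H) where
  toFun a := (p (lt2 x y c) a.1, η (a.1, c) * a.2)
  invFun a := ((p (lt2 x y c)).symm a.1, (η ((p (lt2 x y c)).symm a.1, c))⁻¹ * a.2)
  left_inv a := by simp
  right_inv a := by simp

lemma pX_word {H : Type} [Group H] (η : ι × Bool → H) (v : List Bool) (a : ι × H) :
    vl (pX x y p η true) (pX x y p η false) v a = (p (vl x y v) a.1, plab x y p η v a.1 * a.2) := by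
  induction v with
  | nil => simp [vl, plab]
  | cons c v ih =>
    have e1 : vl (pX x y p η true) (pX x y p η false) (c :: v) =
      pX x y p η c * vl (pX x y p η true) (pX x y p η false) v := by
      simp only [vl, List.map_cons, List.prod_cons]; congr 1; cases c <;> rfl
    have e2 : vl x y (c :: v) = lt2 x y c * vl x y v := by simp [vl]
    rw [e1, e2, Equiv.Perm.mul_apply, ih, map_mul, Equiv.Perm.mul_apply]
    simp [pX, plab, mul_assoc]

lemma plab_E (hg : ∀ i, p (g i) i0 = i) (v : List Bool) (i : ι) :
    ((plab x y p (Egen x y p i0 g hg) v i : stab p i0) : G) = (g (p (vl x y v) i))⁻¹ * vl x y v * g i := by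
  induction v with
  | nil => simp [plab, vl]
  | cons c v ih =>
    have e2 : vl x y (c :: v) = lt2 x y c * vl x y v := by simp [vl]
    rw [plab, Subgroup.coe_mul, ih, e2, map_mul, Equiv.Perm.mul_apply, Egen]
    group

theorem fpp_stab [Fintype ι] {w} (hU : Univ w x y) (hg : ∀ i, p (g i) i0 = i) (hg0 : g i0 = 1) :
    FPP (Egen x y p i0 g hg) := by
  obtain ⟨hx, hy, hw, hF, hgen⟩ := hU
  constructor
  · intro l
    obtain ⟨v, hv⟩ := hgen l
    have h1 : l = (plab x y p (Egen x y p i0 g hg) v i0 : stab p i0) := by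
      ext
      rw [plab_E, ← hv, (mem_stab p i0).mp l.2, hg0]; simp
    rw [h1]
    clear h1 hv
    induction v with
    | nil => exact ⟨[], rfl⟩
    | cons c v ih =>
      obtain ⟨es, hes⟩ := ih
      exact ⟨(p (vl x y v) i0, c) :: es, by rw [List.map_cons, List.prod_cons, ← hes]; rfl⟩
  choose u hu using fun i => hgen (g i)
  refine ⟨5 + 2 * (wl w).length + ∑ i, (u i).length, ?_⟩
  set N := 5 + 2 * (wl w).length + ∑ i, (u i).length with hN
  intro H _ S η S0 Sstep S1
  have Sv : ∀ v : List Bool, v.length ≤ N → ∀ i,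
      S v.length (plab x y p η v i) (plab x y p (Egen x y p i0 g hg) v i) := by
    intro v
    induction v with
    | nil => intro _ _; exact S0
    | cons c v ih =>
      intro hl i
      simp only [List.length_cons] at hl
      exact Sstep _ (by omega) _ _ _ (ih (by omega) i)
  have rel : ∀ v : List Bool, v.length ≤ N → vl x y v = 1 →
      vl (pX x y p η true) (pX x y p η false) v = 1 := by
    intro v hv h1
    ext1 a
    rw [pX_word, h1]
    have h2 := Sv v hv a.1
    have h3 : plab x y p (Egen x y p i0 g hg) v a.1 = 1 := by
      ext; rw [plab_E, h1]; simp
    rw [h3] at h2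
    rw [S1 _ hv _ h2]; simp
  have r1 := rel (List.replicate 3 true) (by simp; omega) (by rw [vl_rep]; exact hx)
  have r2 := rel (List.replicate 5 false) (by simp; omega) (by rw [vl_rep]; exact hy)
  have r3 := rel (wl w ++ wl w) (by simp; omega) (by
    have : vl x y (wl w ++ wl w) = vl x y (wl w) * vl x y (wl w) := by simp [vl]
    rw [this, vl_wl, ← sq, hw])
  have e3 : vl (pX x y p η true) (pX x y p η false) (wl w ++ wl w) =
    vl (pX x y p η true) (pX x y p η false) (wl w) * vl (pX x y p η true) (pX x y p η false) (wl w) := by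
    simp [vl]
  rw [e3, vl_wl, ← sq] at r3
  obtain ⟨F, hFx, hFy⟩ := hF (Equiv.Perm (ι × H)) _ (pX x y p η true) (pX x y p η false)
    (by rw [vl_rep] at r1; exact r1) (by rw [vl_rep] at r2; exact r2) r3
  have Fv : ∀ v, F (vl x y v) = vl (pX x y p η true) (pX x y p η false) v := by
    intro v
    simp only [vl, map_list_prod, List.map_map]
    congr 1
    apply List.map_congr_left
    intro c _
    cases c
    · exact hFy
    · exact hFx
  have Fa : ∀ l : G, ∀ i h, F l (i, h) = (p l i, (F l (i, 1)).2 * h) := by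
    intro l i h
    obtain ⟨v, rfl⟩ := hgen l
    rw [Fv, pX_word, pX_word]; simp
  have Fg : ∀ i h, F (g i) (i0, h) = (i, h) := by
    intro i h
    have h2 := Sv (u i) (by
      have := Finset.single_le_sum (f := fun i => (u i).length) (fun _ _ => Nat.zero_le _) (Finset.mem_univ i)
      omega) i0
    have h3 : plab x y p (Egen x y p i0 g hg) (u i) i0 = 1 := by
      ext; rw [plab_E, ← hu, hg, hg0]; simp
    rw [h3] at h2
    have h4 := S1 _ (by
      have := Finset.single_le_sum (f := fun i => (u i).length) (fun _ _ => Nat.zero_le _) (Finset.mem_univ i)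
      omega) _ h2
    rw [hu i, Fv, pX_word, h4, ← hu, hg]; simp
  refine ⟨MonoidHom.mk' (fun l => (F (l : G) (i0, 1)).2) ?_, ?_⟩
  · intro a b
    rw [Subgroup.coe_mul, map_mul, Equiv.Perm.mul_apply]
    have hb := Fa b i0 1
    rw [(mem_stab p i0).mp b.2] at hb
    rw [hb, Fa]
  · intro e
    change (F (Egen x y p i0 g hg e : G) (i0, 1)).2 = η e
    obtain ⟨i, c⟩ := e
    have hc : F (lt2 x y c) = pX x y p η c := by cases c; exacts [hFy, hFx]
    rw [Egen, map_mul, map_mul, Equiv.Perm.mul_apply, Equiv.Perm.mul_apply, Fg, hc, map_inv]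
    have : (F (g (p (lt2 x y c) i)))⁻¹ (pX x y p η c (i, 1)) = (i0, η (i, c)) := by
      rw [Equiv.Perm.inv_eq_iff_eq, Fg]; simp [pX]
    rw [this]
end ind

lemma exists_univ (w : List (ℕ × ℕ)) : ∃ (G : Type) (_ : Group G) (x y : G), Univ w x y := by
  let R : Set (FreeGroup (Fin 2)) := {xgen ^ 3, ygen ^ 5, ev xgen ygen w ^ 2}
  let q : FreeGroup (Fin 2) →* PresentedGroup R := PresentedGroup.mk R
  have hr : ∀ r ∈ R, q r = 1 := fun r hr => PresentedGroup.one_of_mem hr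
  have hx : q xgen ^ 3 = 1 := by rw [← map_pow]; exact hr _ (by simp [R])
  have hy : q ygen ^ 5 = 1 := by rw [← map_pow]; exact hr _ (by simp [R])
  refine ⟨PresentedGroup R, inferInstance, q xgen, q ygen, hx, hy, ?_, ?_, ?_⟩
  · rw [← ev_map, ← map_pow]; exact hr _ (by simp [R])
  · intro T _ X Y hX hY hW
    have hx : FreeGroup.lift ![X, Y] xgen = X := by simp [xgen]
    have hy : FreeGroup.lift ![X, Y] ygen = Y := by simp [ygen]
    have hr : ∀ r ∈ R, FreeGroup.lift ![X, Y] r = 1 := by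
      intro r hr
      rcases hr with rfl | rfl | rfl
      · simp [hx, hX]
      · simp [hy, hY]
      · rw [map_pow, ev_map, hx, hy, hW]
    refine ⟨PresentedGroup.toGroup hr, ?_, ?_⟩
    · exact PresentedGroup.toGroup.of hr
    · exact PresentedGroup.toGroup.of hr
  · intro g
    obtain ⟨f, rfl⟩ := PresentedGroup.mk_surjective R g
    change ∃ v, q f = _
    have hmul : ∀ a b, vl (q xgen) (q ygen) (a ++ b) = vl (q xgen) (q ygen) a * vl (q xgen) (q ygen) b := by
      intro a b; simp [vl]
    have hof : ∀ i : Fin 2, (∃ v, q (FreeGroup.of i) = vl (q xgen) (q ygen) v) ∧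
        (∃ v, (q (FreeGroup.of i))⁻¹ = vl (q xgen) (q ygen) v) := by
      intro i
      fin_cases i
      · refine ⟨⟨[true], by simp [vl, lt2, xgen]⟩, ⟨[true, true], ?_⟩⟩
        rw [inv_eq_iff_mul_eq_one, ← hx]; simp [vl, lt2, xgen, pow_succ, mul_assoc]
      · refine ⟨⟨[false], by simp [vl, lt2, ygen]⟩, ⟨[false, false, false, false], ?_⟩⟩
        rw [inv_eq_iff_mul_eq_one, ← hy]; simp [vl, lt2, ygen, pow_succ, mul_assoc]
    induction f using FreeGroup.induction_on with
    | C1 => exact ⟨[], by simp [vl]⟩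
    | of i => exact (hof i).1
    | inv_of i _ => rw [map_inv]; exact (hof i).2
    | mul a b ha hb =>
      obtain ⟨v, hv⟩ := ha
      obtain ⟨v', hv'⟩ := hb
      exact ⟨v ++ v', by rw [map_mul, hv, hv', hmul]⟩

lemma good_of_univ {w} {G : Type} [Group G] {x y : G} (hU : Univ w x y) {P Q : G}
    (h : Free2 P Q) : Good w := by
  obtain ⟨hx, hy, hw, -, hgen⟩ := hU
  have hall : ∀ g : G, g ∈ Subgroup.closure {x, y} := by
    intro g
    obtain ⟨v, rfl⟩ := hgen g
    apply Subgroup.list_prod_mem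
    intro z hz
    obtain ⟨c, -, rfl⟩ := List.mem_map.mp hz
    cases c <;> exact Subgroup.subset_closure (by simp [lt2])
  exact ⟨G, _, x, y, hx, hy, hw, P, hall P, Q, hall Q, h⟩

end

section
abbrev Z4 := ℤ × ℤ × ℤ × ℤ
abbrev ZM := Z4 × Z4 × Z4 × Z4
instance instZ4 : DecidableEq Z4 := inferInstance
instance instZM : DecidableEq ZM := @instDecidableEqProd _ _ instZ4 (@instDecidableEqProd _ _ instZ4 (@instDecidableEqProd _ _ instZ4 instZ4))

def zmul (a b : Z4) : Z4 :=
  let c4 := a.2.1 * b.2.2.2 + a.2.2.1 * b.2.2.1 + a.2.2.2 * b.2.1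
  (a.1 * b.1 + (a.2.2.1 * b.2.2.2 + a.2.2.2 * b.2.2.1) - c4,
   a.1 * b.2.1 + a.2.1 * b.1 + a.2.2.2 * b.2.2.2 - c4,
   a.1 * b.2.2.1 + a.2.1 * b.2.1 + a.2.2.1 * b.1 - c4,
   a.1 * b.2.2.2 + a.2.1 * b.2.2.1 + a.2.2.1 * b.2.1 + a.2.2.2 * b.1 - c4)

def zmm (A B : ZM) : ZM :=
  (zmul A.1 B.1 + zmul A.2.1 B.2.2.1, zmul A.1 B.2.1 + zmul A.2.1 B.2.2.2,
   zmul A.2.2.1 B.1 + zmul A.2.2.2 B.2.2.1, zmul A.2.2.1 B.2.1 + zmul A.2.2.2 B.2.2.2)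

def zsc (a : Z4) (B : ZM) : ZM := (zmul a B.1, zmul a B.2.1, zmul a B.2.2.1, zmul a B.2.2.2)

def ztr (A : ZM) : Z4 := A.1 + A.2.2.2

def zpw : Fin 5 → Z4 := ![(1, 0, 0, 0), (0, 1, 0, 0), (0, 0, 1, 0), (0, 0, 0, 1), (-1, -1, -1, -1)]

section
variable {K : Type} [Field K]
def zv (ζ : K) (a : Z4) : K := a.1 + a.2.1 * ζ + a.2.2.1 * ζ ^ 2 + a.2.2.2 * ζ ^ 3
def zM (ζ : K) (A : ZM) : Matrix (Fin 2) (Fin 2) K :=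
  !![zv ζ A.1, zv ζ A.2.1; zv ζ A.2.2.1, zv ζ A.2.2.2]

lemma zv_add (ζ : K) (a b : Z4) : zv ζ (a + b) = zv ζ a + zv ζ b := by
  simp only [zv, Prod.fst_add, Prod.snd_add]; push_cast; ring

lemma zv_sub (ζ : K) (a b : Z4) : zv ζ (a - b) = zv ζ a - zv ζ b := by
  simp only [zv, Prod.fst_sub, Prod.snd_sub]; push_cast; ring

variable {ζ : K} (hζ : ζ ^ 4 + ζ ^ 3 + ζ ^ 2 + ζ + 1 = 0)
include hζ
lemma zv_mul (a b : Z4) : zv ζ (zmul a b) = zv ζ a * zv ζ b := by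
  simp only [zv, zmul]; push_cast
  have h5 : ζ ^ 5 = 1 := by linear_combination (ζ - 1) * hζ
  have h6 : ζ ^ 6 = ζ := by linear_combination ζ * h5
  have h4 : ζ ^ 4 = - ζ ^ 3 - ζ ^ 2 - ζ - 1 := by linear_combination hζ
  ring_nf
  rw [h6, h5, h4]; ring

lemma zM_mul (A B : ZM) : zM ζ (zmm A B) = zM ζ A * zM ζ B := by
  simp only [zM, zmm, zv_add, zv_mul hζ]
  ext i j; fin_cases i <;> fin_cases j <;> simp [Matrix.mul_apply, Fin.sum_univ_two]

lemma zM_sc (a : Z4) (B : ZM) : zM ζ (zsc a B) = zv ζ a • zM ζ B := by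
  simp only [zM, zsc, zv_mul hζ]
  ext i j; fin_cases i <;> fin_cases j <;> simp

omit hζ in
lemma zM_tr (A : ZM) : (zM ζ A).trace = zv ζ (ztr A) := by
  simp [zM, ztr, zv_add, Matrix.trace_fin_two]

lemma zv_pw (n : Fin 5) : zv ζ (zpw n) = ζ ^ (n : ℕ) := by
  fin_cases n <;> simp [zv, zpw]
  linear_combination -hζ
end

def dvs : Fin 12 → ZM := ![
  ((0, 0, -1, 1), (2, 0, 0, 0), (0, 0, 0, 0), (0, 0, 1, -1)),
  ((0, 0, 1, -1), (0, 0, 0, 0), (-2, 0, 0, 0), (0, 0, -1, 1)),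
  ((0, 0, -1, -1), (0, 2, 0, 0), (2, 2, 2, 2), (0, 0, 1, 1)),
  ((0, -2, -1, -1), (0, 0, 0, -2), (0, 0, 0, -2), (0, 2, 1, 1)),
  ((0, 0, 1, 1), (-2, -2, -2, -2), (0, -2, 0, 0), (0, 0, -1, -1)),
  ((-2, -2, -1, -1), (0, 0, -2, 0), (0, 0, -2, 0), (2, 2, 1, 1)),
  ((0, 0, 1, -1), (-2, 0, 0, 0), (0, 0, 0, 0), (0, 0, -1, 1)),
  ((0, 0, -1, 1), (0, 0, 0, 0), (2, 0, 0, 0), (0, 0, 1, -1)),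
  ((0, 0, 1, 1), (0, -2, 0, 0), (-2, -2, -2, -2), (0, 0, -1, -1)),
  ((0, 2, 1, 1), (0, 0, 0, 2), (0, 0, 0, 2), (0, -2, -1, -1)),
  ((0, 0, -1, -1), (2, 2, 2, 2), (0, 2, 0, 0), (0, 0, 1, 1)),
  ((2, 2, 1, 1), (0, 0, 2, 0), (0, 0, 2, 0), (-2, -2, -1, -1))]
def dns : Fin 12 → ZM := ![
  ((0, 0, 0, 0), (1, 0, 0, 0), (0, 0, 0, 0), (0, 0, 0, 0)),
  ((0, 0, 0, 0), (0, 0, 0, 0), (1, 1, 1, 1), (0, 0, 0, 0)),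
  ((0, 0, -1, 0), (1, 0, 0, 0), (1, 1, 1, 1), (0, 0, 1, 0)),
  ((0, -1, -1, 0), (1, 0, -1, -1), (0, 0, 0, -1), (0, 1, 1, 0)),
  ((0, 0, 1, 0), (-1, -1, -1, -1), (-1, 0, 0, 0), (0, 0, -1, 0)),
  ((-1, -1, -1, 0), (1, 0, -1, -1), (0, 0, -1, 0), (1, 1, 1, 0)),
  ((0, -1, -2, -2), (1, 2, 1, 0), (1, 3, 1, 0), (0, 1, 2, 2)),
  ((-2, -2, -1, 0), (0, -1, -3, -1), (0, -1, -2, -1), (2, 2, 1, 0)),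
  ((1, 2, 2, 1), (-1, -1, 0, 1), (-1, 0, 1, 1), (-1, -2, -2, -1)),
  ((0, 1, 1, 0), (0, 0, 0, 1), (-1, 0, 1, 1), (0, -1, -1, 0)),
  ((-1, -2, -2, -1), (1, 0, -1, -1), (1, 1, 0, -1), (1, 2, 2, 1)),
  ((0, 0, -1, -1), (0, 1, 0, 0), (1, 2, 2, 1), (0, 0, 1, 1))]
def da : Fin 12 → Z4 := ![(0, 0, 0, -2), (0, 0, 0, -2), (0, 0, 0, -2), (2, 2, 2, 0), (2, 2, 2, 0), (4, 4, 4, 2), (0, 0, 0, 2), (0, 0, 0, 2), (0, 0, 0, 2), (4, 4, 4, 2), (0, 0, -2, -4), (2, 2, 2, 0)]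
def db : Fin 12 → Z4 := ![(0, 0, 0, 0), (0, 0, 2, 2), (-2, -2, -2, 0), (-2, -2, -2, 0), (0, 0, 2, 2), (-2, -2, -2, 0), (0, 0, 0, 0), (2, 2, 2, 0), (0, 0, -2, -2), (2, 2, 2, 0), (2, 2, 2, 0), (2, 2, 2, 0)]
def dc : Fin 12 → ℤ × ℤ := ![(1, 0), (-1, 0), (1, 0), (0, 1), (-1, 0), (1, 0), (-1, 0), (1, 0), (-1, 0), (0, -1), (1, 0), (-1, 0)]
def dpx : Fin 12 → Fin 12 := ![1, 2, 0, 4, 11, 9, 7, 8, 6, 10, 5, 3]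
def dpy : Fin 12 → Fin 12 := ![0, 2, 3, 5, 1, 4, 6, 8, 9, 11, 7, 10]
def dpxi : Fin 12 → Fin 12 := ![2, 0, 1, 11, 3, 10, 8, 6, 7, 5, 9, 4]
def dpyi : Fin 12 → Fin 12 := ![0, 4, 1, 2, 5, 3, 6, 10, 7, 8, 11, 9]
def dfx : Fin 12 → Fin 5 := ![0, 0, 0, 0, 0, 0, 0, 0, 0, 4, 1, 0]
def dfy : Fin 12 → Fin 5 := ![4, 1, 0, 0, 0, 4, 1, 4, 1, 0, 0, 0]
def sx : Equiv.Perm (Fin 12) := ⟨dpx, dpxi, by decide, by decide⟩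
def sy : Equiv.Perm (Fin 12) := ⟨dpy, dpyi, by decide, by decide⟩
def dX : ZM := ((0, 0, 0, 0), (0, 0, 0, -1), (0, 0, 1, 0), (-1, 0, 0, 0))
def dXi : ZM := ((-1, 0, 0, 0), (0, 0, 0, 1), (0, 0, -1, 0), (0, 0, 0, 0))
def dY : ZM := ((0, 0, 0, 1), (1, 0, 0, 0), (0, 0, 0, 0), (0, 0, 1, 0))
def dYi : ZM := ((0, 0, 1, 0), (-1, 0, 0, 0), (0, 0, 0, 0), (0, 0, 0, 1))
def dI : ZM := ((1, 0, 0, 0), (0, 0, 0, 0), (0, 0, 0, 0), (1, 0, 0, 0))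
def dd : Z4 := (2, 0, 2, 2)
def dd5 : Z4 := (-6, 0, -2, -2)
def zsm (n : ℤ) (a : Z4) : Z4 := (n * a.1, n * a.2.1, n * a.2.2.1, n * a.2.2.2)
def dA : Bool → ZM := fun c => cond c dX dY
def dAi : Bool → ZM := fun c => cond c dXi dYi
def dp : Bool → Fin 12 → Fin 12 := fun c => cond c dpx dpy
def df : Bool → Fin 12 → Fin 5 := fun c => cond c dfx dfy
/-- matrix entry of the additive labels -/
def dl2 : Bool → Fin 12 → ℤ × ℤ := fun c i => cond c (dc (dpx i) - dc i) 0

lemma ck_v : ∀ c i, zmm (dA c) (dvs i) = zmm (dvs (dp c i)) (dA c) := by decide +kernel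
lemma ck_n : ∀ c i, zsc (zpw (df c i)) (zmm (dA c) (dns i)) = zmm (dns (dp c i)) (dA c) := by decide +kernel
lemma ck_c : ∀ i, ztr (zmm (dvs i) (dvs 3)) = zsm (dc i).1 dd + zsm (dc i).2 dd5 := by decide +kernel
lemma ck_i : ∀ c, zmm (dA c) (dAi c) = dI ∧ zmm (dAi c) (dA c) = dI := by decide +kernel
lemma ck_a : ∀ i, da (dpx i) = zmul (zpw (dfx i)) (da i) := by decide +kernel
lemma ck_b : ∀ i, db (dpy i) = zmul (zpw (dfy i)) (db i) := by decide +kernel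
lemma ck_u : ∀ i, (i ∈ ([0, 6, 1, 7, 3, 5] : List (Fin 12)) → ztr (zmm (dns i) (dvs 3)) = da i + db i) ∧
  ztr (zmm (dns 2) (dvs 3)) - (da 2 + db 2) = dd := by decide +kernel

end

section
abbrev Mt (K : Type) := Matrix (Fin 2) (Fin 2) K

section dual
variable {K : Type} [Field K]
def dm (A B : Mt K) : Matrix (Fin 2) (Fin 2) (DualNumber K) :=
  Matrix.of fun i j => TrivSqZeroExt.inl (A i j) + TrivSqZeroExt.inr (B i j)

lemma dm_mul (A B A' B' : Mt K) : dm A B * dm A' B' = dm (A * A') (A * B' + B * A') := by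
  ext i j
  · simp [dm, Matrix.mul_apply]
  · simp [dm, Matrix.mul_apply]; ring

lemma dm_one : dm (1 : Mt K) 0 = 1 := by
  ext i j
  · by_cases h : i = j <;> simp [dm, h, Matrix.one_apply]
  · by_cases h : i = j <;> simp [dm, h, Matrix.one_apply]

lemma dm_inj {A B A' B' : Mt K} (h : dm A B = dm A' B') : A = A' ∧ B = B' := by
  constructor
  · ext i j
    have := congrArg TrivSqZeroExt.fst (congrFun (congrFun h i) j)
    simpa [dm] using this
  · ext i j
    have := congrArg TrivSqZeroExt.snd (congrFun (congrFun h i) j)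
    simpa [dm] using this

lemma dm_neg : dm (-1 : Mt K) 0 = -1 := by
  rw [← dm_one]
  ext i j <;> simp [dm]

lemma dm_det (A u : Mt K) (hA : A.det = 1) (hu : u.trace = 0) : (dm A (u * A)).det = 1 := by
  rw [Matrix.det_fin_two] at hA ⊢
  rw [Matrix.trace_fin_two] at hu
  ext
  · simp [dm]; exact hA
  · simp [dm, Matrix.mul_apply, Fin.sum_univ_two]
    linear_combination (A 0 0 * A 1 1 - A 0 1 * A 1 0) * hu

lemma dm_tr (A B : Mt K) : (dm A B).trace = TrivSqZeroExt.inl A.trace + TrivSqZeroExt.inr B.trace := by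
  ext <;> simp [dm, Matrix.trace_fin_two]
end dual

lemma ch2 {R : Type*} [CommRing R] (A : Matrix (Fin 2) (Fin 2) R) (h1 : A.det = 1) (h0 : A.trace = 0) :
    A * A = -1 := by
  rw [Matrix.det_fin_two] at h1
  rw [Matrix.trace_fin_two] at h0
  ext i j
  fin_cases i <;> fin_cases j <;> simp [Matrix.mul_apply, Fin.sum_univ_two]
  · linear_combination A 0 0 * h0 - h1
  · linear_combination A 0 1 * h0
  · linear_combination A 1 0 * h0
  · linear_combination A 1 1 * h0 - h1

lemma chp {R : Type*} [CommRing R] (A B : Matrix (Fin 2) (Fin 2) R) (h1 : A.trace = 0) (h0 : B.trace = 0) :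
    A * B + B * A = (A * B).trace • 1 := by
  rw [Matrix.trace_fin_two] at h1 h0
  ext i j
  fin_cases i <;> fin_cases j <;> simp [Matrix.mul_apply, Fin.sum_univ_two, Matrix.trace_fin_two]
  · linear_combination A 0 0 * h0 - B 1 1 * h1
  · linear_combination A 0 1 * h0 + B 0 1 * h1
  · linear_combination A 1 0 * h0 + B 1 0 * h1
  · linear_combination A 1 1 * h0 - B 0 0 * h1

/-- the label group -/
abbrev HH (K : Type) [Field K] := Kˣ × Multiplicative (ℤ × ℤ)

section
variable {K : Type} [Field K] (ζ : Kˣ)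

def eta (e : Fin 12 × Bool) : HH K := (ζ ^ (df e.2 e.1 : ℕ), Multiplicative.ofAdd (dl2 e.2 e.1))
abbrev lab (v : List Bool) (i : Fin 12) : HH K := plab sx sy (MonoidHom.id _) (eta ζ) v i
abbrev pm (v : List Bool) : Equiv.Perm (Fin 12) := vl sx sy v
def mA (c : Bool) : Mt K := zM ζ (dA c)
def mAi (c : Bool) : Mt K := zM ζ (dAi c)
def mv (i : Fin 12) : Mt K := zM ζ (dvs i)
def mn (i : Fin 12) : Mt K := zM ζ (dns i)
def mU (c : Bool) : Mt K := cond c (mv ζ 3 - mA ζ true * mv ζ 3 * mAi ζ true) 0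
def wA (v : List Bool) : Mt K := vl (mA ζ true) (mA ζ false) v
def wU : List Bool → Mt K
  | [] => 0
  | c :: v => mU ζ c + mA ζ c * wU v * mAi ζ c

lemma dp_eq (c : Bool) (i) : lt2 sx sy c i = dp c i := by cases c <;> rfl
lemma pm_nil (i) : pm [] i = i := rfl
lemma pm_cons (c v i) : pm (c :: v) i = dp c (pm v i) := by
  simp [pm, vl, ← dp_eq]
lemma lab_nil (i) : lab ζ [] i = 1 := rfl
lemma lab_cons (c v i) : lab ζ (c :: v) i = eta ζ (pm v i, c) * lab ζ v i := rfl
lemma wA_nil : wA ζ [] = 1 := rfl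
lemma wA_cons (c v) : wA ζ (c :: v) = mA ζ c * wA ζ v := by
  cases c <;> simp [wA, vl, lt2]
lemma pm_app (v v' i) : pm (v ++ v') i = pm v (pm v' i) := by simp [pm, vl]
lemma lab_app (v v' i) : lab ζ (v ++ v') i = lab ζ v (pm v' i) * lab ζ v' i := by
  induction v with
  | nil => simp [lab_nil]
  | cons c v ih => rw [List.cons_append, lab_cons, lab_cons, ih, pm_app, mul_assoc]
lemma wA_app (v v') : wA ζ (v ++ v') = wA ζ v * wA ζ v' := by simp [wA, vl]

lemma pm_anti (v i) : pm v (i + 6) = pm v i + 6 := by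
  induction v with
  | nil => rfl
  | cons c v ih =>
    rw [pm_cons, pm_cons, ih]
    have : ∀ c j, dp c (j + 6) = dp c j + 6 := by decide
    exact this _ _

lemma lab_anti (v i) : (lab ζ v (i + 6)).2 = (lab ζ v i).2⁻¹ := by
  induction v with
  | nil => rfl
  | cons c v ih =>
    rw [lab_cons, lab_cons, Prod.snd_mul, Prod.snd_mul, ih, pm_anti, mul_inv]
    have : ∀ c j, dl2 c (j + 6) = - dl2 c j := by decide
    simp only [eta, this, ofAdd_neg]

variable (hζ : (ζ : K) ^ 4 + (ζ : K) ^ 3 + (ζ : K) ^ 2 + (ζ : K) + 1 = 0)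
include hζ

lemma zu5 : ζ ^ 5 = 1 := by
  ext; push_cast; linear_combination ((ζ : K) - 1) * hζ

lemma lab5 (v i) : (lab ζ v i).1 ^ 5 = 1 := by
  induction v with
  | nil => simp [lab_nil]
  | cons c v ih =>
    rw [lab_cons, Prod.fst_mul, mul_pow, ih, mul_one, eta, ← pow_mul, mul_comm, pow_mul, zu5 ζ hζ, one_pow]

lemma mAv (c i) : mA ζ c * mv ζ i = mv ζ (dp c i) * mA ζ c := by
  simp only [mA, mv, ← zM_mul hζ, ck_v]

lemma mAn (c i) : (ζ : K) ^ (df c i : ℕ) • (mA ζ c * mn ζ i) = mn ζ (dp c i) * mA ζ c := by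
  simp only [mA, mn, ← zM_mul hζ, ← zv_pw hζ, ← zM_sc hζ, ck_n]

omit hζ in
lemma zM_I : zM (ζ : K) dI = 1 := by
  ext i j; fin_cases i <;> fin_cases j <;> simp [zM, dI, zv]

lemma mAA (c) : mA ζ c * mAi ζ c = 1 ∧ mAi ζ c * mA ζ c = 1 := by
  simp only [mA, mAi, ← zM_mul hζ, ck_i, zM_I, and_self]

lemma mdet (c) : (mA ζ c).det = 1 := by
  rw [Matrix.det_fin_two]
  cases c <;> simp [mA, dA, zM, dX, dY, zv]
  · linear_combination ((ζ : K) - 1) * hζ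
  · linear_combination ((ζ : K) - 1) * hζ

lemma trU (c) : (mU ζ c).trace = 0 := by
  cases c
  · simp [mU]
  · simp only [mU, cond_true, Matrix.trace_sub]
    rw [Matrix.trace_mul_comm, ← mul_assoc, (mAA ζ hζ true).2, one_mul, sub_self]

lemma inv_v (v i) : wA ζ v * mv ζ i = mv ζ (pm v i) * wA ζ v := by
  induction v with
  | nil => rw [wA_nil, pm_nil, one_mul, mul_one]
  | cons c v ih => rw [wA_cons, pm_cons, mul_assoc, ih, ← mul_assoc, mAv ζ hζ, mul_assoc]

lemma inv_n (v i) : ((lab ζ v i).1 : K) • (wA ζ v * mn ζ i) = mn ζ (pm v i) * wA ζ v := by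
  induction v with
  | nil => rw [wA_nil, pm_nil, lab_nil, one_mul, mul_one]; simp
  | cons c v ih =>
    rw [wA_cons, pm_cons, lab_cons, ← mul_assoc (mn _ _), ← mAn ζ hζ, Prod.fst_mul, smul_mul_assoc, mul_assoc,
      mul_assoc, ← ih]
    simp [eta, mul_smul]

lemma tr_v3 (i) : (mv ζ i * mv ζ 3).trace = (dc i).1 * zv (ζ : K) dd + (dc i).2 * zv (ζ : K) dd5 := by
  simp only [mv, ← zM_mul hζ, zM_tr, ck_c, zv_add]
  simp [zsm, zv]; ring

lemma tr_conj (c) (A B : Mt K) (a : K) (A' : Mt K) (h : A * mA ζ c = a • (mA ζ c * A')) :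
    (A * (mA ζ c * B * mAi ζ c)).trace = a * (A' * B).trace := by
  rw [← mul_assoc, ← mul_assoc, h, Matrix.trace_mul_comm, smul_mul_assoc, mul_smul_comm, Matrix.trace_smul,
    mul_assoc, ← mul_assoc, (mAA ζ hζ c).2, one_mul, smul_eq_mul]

lemma inv_u (v i) : (mv ζ (pm v i) * wU ζ v).trace =
    (lab ζ v i).2.toAdd.1 * zv (ζ : K) dd + (lab ζ v i).2.toAdd.2 * zv (ζ : K) dd5 := by
  induction v with
  | nil => simp [wU, lab_nil]
  | cons c v ih =>
    have h1 := tr_conj ζ hζ c (mv ζ (dp c (pm v i))) (wU ζ v) 1 (mv ζ (pm v i)) (by rw [one_smul, mAv ζ hζ])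
    have h2 : (mv ζ (dp c (pm v i)) * mU ζ c).trace =
        (dl2 c (pm v i)).1 * zv (ζ : K) dd + (dl2 c (pm v i)).2 * zv (ζ : K) dd5 := by
      cases c
      · simp [mU, dl2]
      · have h3 := tr_conj ζ hζ true (mv ζ (dp true (pm v i))) (mv ζ 3) 1 (mv ζ (pm v i)) (by rw [one_smul, mAv ζ hζ])
        simp only [mU, cond_true, mul_sub, Matrix.trace_sub, h3, tr_v3 ζ hζ, dl2, Prod.fst_sub, Prod.snd_sub]
        simp only [dp, cond_true]
        push_cast; ring
    rw [wU, pm_cons, mul_add, Matrix.trace_add, h1, ih, h2, lab_cons]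
    simp [eta]; ring

lemma dual_w (v) : vl (dm (mA ζ true) (mU ζ true * mA ζ true)) (dm (mA ζ false) 0) v =
    dm (wA ζ v) (wU ζ v * wA ζ v) := by
  induction v with
  | nil => simp [vl, wA_nil, wU, dm_one]
  | cons c v ih =>
    have e : vl (dm (mA ζ true) (mU ζ true * mA ζ true)) (dm (mA ζ false) 0) (c :: v) =
      dm (mA ζ c) (mU ζ c * mA ζ c) * dm (wA ζ v) (wU ζ v * wA ζ v) := by
      rw [← ih]; cases c <;> simp [vl, lt2, mU]
    rw [e, dm_mul, wA_cons, wU]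
    congr 1
    have := (mAA ζ hζ c).2
    calc _ = mA ζ c * wU ζ v * 1 * wA ζ v + mU ζ c * mA ζ c * wA ζ v := by simp [mul_assoc]
      _ = mA ζ c * wU ζ v * (mAi ζ c * mA ζ c) * wA ζ v + mU ζ c * mA ζ c * wA ζ v := by rw [this]
      _ = _ := by simp only [add_mul, mul_assoc]; abel

lemma dual_det (v) : (dm (wA ζ v) (wU ζ v * wA ζ v)).det = 1 := by
  rw [← dual_w ζ hζ]
  induction v with
  | nil => simp [vl]
  | cons c v ih =>
    have e : vl (dm (mA ζ true) (mU ζ true * mA ζ true)) (dm (mA ζ false) 0) (c :: v) =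
      dm (mA ζ c) (mU ζ c * mA ζ c) * vl (dm (mA ζ true) (mU ζ true * mA ζ true)) (dm (mA ζ false) 0) v := by
      cases c <;> simp [vl, lt2, mU]
    rw [e, Matrix.det_mul, ih, mul_one]
    exact dm_det _ _ (mdet ζ hζ c) (trU ζ hζ c)

lemma wA_unit (v) : IsUnit (wA ζ v) := by
  induction v with
  | nil => rw [wA_nil]; exact isUnit_one
  | cons c v ih =>
    rw [wA_cons]
    exact (IsUnit.of_mul_eq_one _ (mAA ζ hζ c).1).mul ih

end

section
variable {K : Type} [Field K] [CharZero K] (ζ : Kˣ)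
variable (hζ : (ζ : K) ^ 4 + (ζ : K) ^ 3 + (ζ : K) ^ 2 + (ζ : K) + 1 = 0)
include hζ

lemma dd_ne : zv (ζ : K) dd ≠ 0 := by
  intro h
  have : zv (ζ : K) (zmul dd (0, 0, 1, 1)) = 0 := by rw [zv_mul hζ, h, zero_mul]
  have e : zmul dd (0, 0, 1, 1) = (2, 0, 0, 0) := by decide
  rw [e] at this; simp [zv] at this

lemma dd5_eq : zv (ζ : K) dd5 = zv (ζ : K) dd * zv (ζ : K) (-1, 0, -2, -2) := by
  rw [← zv_mul hζ]; congr 1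

lemma r5_sq : zv (ζ : K) (-1, 0, -2, -2) ^ 2 = 5 := by
  rw [sq, ← zv_mul hζ]
  have : zmul (-1, 0, -2, -2) (-1, 0, -2, -2) = (5, 0, 0, 0) := by decide
  rw [this]; simp [zv]

lemma indep (a b : ℤ) (h : (a : K) * zv (ζ : K) dd + b * zv (ζ : K) dd5 = 0) : a = 0 ∧ b = 0 := by
  rw [dd5_eq ζ hζ] at h
  have h1 : (a : K) + b * zv (ζ : K) (-1, 0, -2, -2) = 0 := by
    have := mul_left_cancel₀ (dd_ne ζ hζ) (b := (a : K) + b * zv (ζ : K) (-1, 0, -2, -2)) (c := 0)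
      (by linear_combination h)
    exact this
  have h2 : (a : K) ^ 2 = 5 * b ^ 2 := by
    have := r5_sq ζ hζ
    linear_combination (a - b * zv (ζ : K) (-1, 0, -2, -2)) * h1 + b ^ 2 * this
  have h3 : a ^ 2 = 5 * b ^ 2 := by exact_mod_cast h2
  have hb : b = 0 := by
    by_contra hb
    have hirr : Irrational (√(5 : ℕ) : ℝ) := Nat.Prime.irrational_sqrt (by norm_num)
    have h4 : ((a : ℝ) / b) ^ 2 = 5 := by
      have hb' : (b : ℝ) ≠ 0 := by exact_mod_cast hb
      have : (a : ℝ) ^ 2 = 5 * b ^ 2 := by exact_mod_cast h3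
      rw [div_pow, this]; field_simp
    have h5 : (√(5 : ℕ) : ℝ) = |(a : ℝ) / b| := by
      rw [← Real.sqrt_sq_eq_abs, h4]; norm_num
    apply hirr
    exact ⟨|(a : ℚ) / b|, by rw [h5]; push_cast; rfl⟩
  subst hb
  simp at h3
  exact ⟨h3, rfl⟩

lemma mv_inj (i j : Fin 12) (h : mv ζ i = mv ζ j) : i = j := by
  by_contra hij
  have ck : ∀ i j : Fin 12, i ≠ j → ∃ k : Fin 12, ztr (zmm (dvs i) (dvs k)) - ztr (zmm (dvs j) (dvs k)) ∈
    ([zsm 2 dd, zsm (-2) dd, zsm 2 dd5, zsm (-2) dd5] : List Z4) := by decide +kernel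
  obtain ⟨k, hk⟩ := ck i j hij
  have h0 : zv (ζ : K) (ztr (zmm (dvs i) (dvs k)) - ztr (zmm (dvs j) (dvs k))) = 0 := by
    rw [zv_sub, ← zM_tr, ← zM_tr, zM_mul hζ, zM_mul hζ, sub_eq_zero]
    have h' : zM (ζ : K) (dvs i) = zM (ζ : K) (dvs j) := h
    rw [h']
  have z1 : ∀ n a, zv (ζ : K) (zsm n a) = n * zv (ζ : K) a := by intro n a; simp [zsm, zv]; ring
  have h5 := dd_ne ζ hζ
  have h6 : zv (ζ : K) dd5 ≠ 0 := by
    intro h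
    have := indep ζ hζ 0 1 (by simp [h])
    omega
  simp only [List.mem_cons, List.not_mem_nil, or_false] at hk
  rcases hk with hk | hk | hk | hk <;> rw [hk, z1] at h0 <;> simp_all

lemma W_main (w) (h : (ev (dm (mA ζ true) (mU ζ true * mA ζ true)) (dm (mA ζ false) 0) w).trace = 0) :
    wU ζ (wl w ++ wl w) = 0 ∧ pm (wl w ++ wl w) = 1 ∧ (∀ i, lab ζ (wl w ++ wl w) i = 1) ∧ ∀ i, pm (wl w) i ≠ i := by
  rw [← vl_wl, dual_w ζ hζ] at h
  set W := wl w
  have h2 := ch2 _ (dual_det ζ hζ W) h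
  rw [dm_mul, ← dm_neg] at h2
  obtain ⟨hA, hB⟩ := dm_inj h2
  have hAA : wA ζ (W ++ W) = -1 := by rw [wA_app, hA]
  have hd := dual_w ζ hζ (W ++ W)
  have e : vl (dm (mA ζ true) (mU ζ true * mA ζ true)) (dm (mA ζ false) 0) (W ++ W) =
    vl (dm (mA ζ true) (mU ζ true * mA ζ true)) (dm (mA ζ false) 0) W *
    vl (dm (mA ζ true) (mU ζ true * mA ζ true)) (dm (mA ζ false) 0) W := by simp [vl]
  rw [e, dual_w ζ hζ, dm_mul, hB] at hd
  have hu : wU ζ (W ++ W) = 0 := by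
    have := (dm_inj hd).2
    rw [hAA] at this
    simpa using this.symm
  have hp : ∀ i, pm (W ++ W) i = i := by
    intro i
    have := inv_v ζ hζ (W ++ W) i
    rw [hAA] at this
    simp at this
    exact (mv_inj ζ hζ _ _ this).symm
  have hn0 : ∀ i, mn ζ i ≠ 0 := by
    intro i hi
    have ck : ∀ i : Fin 12, ∃ j, (ztr (zmm (dns i) (dvs j))) ∈ ((List.finRange 5).map
      (fun k => zsm 2 (zpw k)) ++ (List.finRange 5).map (fun k => zsm (-2) (zpw k))) := by decide +kernel
    obtain ⟨j, hj⟩ := ck i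
    have h0 : zv (ζ : K) (ztr (zmm (dns i) (dvs j))) = 0 := by
      rw [← zM_tr, zM_mul hζ]
      have h' : zM (ζ : K) (dns i) = 0 := hi
      rw [h']; simp
    have z1 : ∀ n a, zv (ζ : K) (zsm n a) = n * zv (ζ : K) a := by intro n a; simp [zsm, zv]; ring
    rw [List.mem_append, List.mem_map, List.mem_map] at hj
    rcases hj with ⟨k, -, hk⟩ | ⟨k, -, hk⟩ <;> rw [← hk, z1, zv_pw hζ] at h0 <;> simp at h0
  have hl : ∀ i, lab ζ (W ++ W) i = 1 := by
    intro i
    have h1 := inv_n ζ hζ (W ++ W) i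
    rw [hAA, hp] at h1
    have h2 := inv_u ζ hζ (W ++ W) i
    rw [hu] at h2
    simp only [mul_zero, Matrix.trace_zero] at h2
    have h3 := indep ζ hζ _ _ h2.symm
    ext1
    · simp only [neg_mul, one_mul, mul_neg, mul_one, smul_neg, neg_inj] at h1
      have h4 : (((lab ζ (W ++ W) i).1 : K) - 1) • mn ζ i = 0 := by rw [sub_smul, one_smul, h1, sub_self]
      rcases smul_eq_zero.mp h4 with h5 | h5
      · ext; simpa [sub_eq_zero] using h5
      · exact absurd h5 (hn0 i)
    · exact Multiplicative.toAdd.injective (Prod.ext h3.1 h3.2)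
  refine ⟨hu, Equiv.ext hp, hl, ?_⟩
  intro i hi
  have h1 := hl i
  rw [lab_app, hi] at h1
  have l1 : (lab ζ W i).1 = 1 := by
    have h2 : (lab ζ W i).1 * (lab ζ W i).1 = 1 := congrArg Prod.fst h1
    have h5 := lab5 ζ hζ W i
    calc (lab ζ W i).1 = (lab ζ W i).1 ^ 5 * ((lab ζ W i).1 * (lab ζ W i).1)⁻¹ ^ 2 := by group
      _ = 1 := by rw [h5, h2]; simp
  have h3 := inv_n ζ hζ W i
  rw [hi, l1] at h3
  simp only [Units.val_one, one_smul] at h3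
  have trA : (wA ζ W).trace = 0 := by
    rw [dm_tr] at h
    simpa using congrArg TrivSqZeroExt.fst h
  have trn : (mn ζ i).trace = 0 := by
    have : ∀ i, ztr (dns i) = 0 := by decide +kernel
    rw [mn, zM_tr, this]; simp [zv]
  have nn : mn ζ i * mn ζ i = 0 := by
    have : ∀ i, zmm (dns i) (dns i) = 0 := by decide +kernel
    rw [mn, ← zM_mul hζ, this]
    ext i j; fin_cases i <;> fin_cases j <;> simp [zM, zv]
  have h4 := chp _ _ trA trn
  rw [← h3] at h4
  have h5 : (wA ζ W * mn ζ i).trace • mn ζ i = 0 := by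
    calc _ = ((wA ζ W * mn ζ i).trace • (1 : Mt K)) * mn ζ i := by simp
      _ = (wA ζ W * mn ζ i + wA ζ W * mn ζ i) * mn ζ i := by rw [h4]
      _ = wA ζ W * (mn ζ i * mn ζ i) + wA ζ W * (mn ζ i * mn ζ i) := by simp only [add_mul, mul_assoc]
      _ = 0 := by rw [nn]; simp
  rcases smul_eq_zero.mp h5 with h6 | h6
  · rw [h6, zero_smul, ← two_smul K] at h4
    have h7 : wA ζ W * mn ζ i = 0 := by simpa using h4
    have h8 : wA ζ W * (wA ζ W * mn ζ i) = 0 := by rw [h7, mul_zero]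
    rw [← mul_assoc, hA] at h8
    exact hn0 i (by simpa using h8)
  · exact hn0 i h6
end

end

section
section
variable {K : Type} [Field K] (ζ : Kˣ)

def hv (s t : Kˣ) : HH K →* Kˣ :=
  MonoidHom.mk' (fun h => h.1 * s ^ h.2.toAdd.1 * t ^ h.2.toAdd.2) (by
    intro a b; simp only [Prod.fst_mul, Prod.snd_mul, toAdd_mul, Prod.fst_add, Prod.snd_add, zpow_add]
    simp only [mul_left_comm, mul_comm, mul_assoc])

abbrev MM (K : Type) := Fin 12 → K

def TT (s t : Kˣ) (c : Bool) (f : MM K) : MM K := fun j =>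
  (hv s t (eta ζ ((lt2 sx sy c).symm j, c)) : K) * f ((lt2 sx sy c).symm j)

lemma TT_apply (s t : Kˣ) (c f i) : TT ζ s t c f (dp c i) = (hv s t (eta ζ (i, c)) : K) * f i := by
  simp [TT, ← dp_eq]

lemma dp_surj (c j) : ∃ i, dp c i = j := ⟨(lt2 sx sy c).symm j, by simp [← dp_eq]⟩

lemma TT_add (s t : Kˣ) (c) (f g : MM K) : TT ζ s t c (f + g) = TT ζ s t c f + TT ζ s t c g := by
  ext j; simp [TT, mul_add]
lemma TT_sub (s t : Kˣ) (c) (f g : MM K) : TT ζ s t c (f - g) = TT ζ s t c f - TT ζ s t c g := by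
  ext j; simp [TT, mul_sub]
lemma TT_smul (s t : Kˣ) (c) (a : K) (f : MM K) : TT ζ s t c (a • f) = a • TT ζ s t c f := by
  ext j; simp [TT]; ring

def gam (s t : Kˣ) (u : MM K) (c : Bool) : MM K := cond c (u - TT ζ s t true u) 0

/-- affine action -/
def aff (s t : Kˣ) (u : MM K) (c : Bool) : Equiv.Perm (MM K) where
  toFun f := gam ζ s t u c + TT ζ s t c f
  invFun f := fun i => (hv s t (eta ζ (i, c)) : K)⁻¹ * (f (dp c i) - gam ζ s t u c (dp c i))
  left_inv f := by ext i; simp [TT_apply]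
  right_inv f := by
    ext j
    obtain ⟨i, rfl⟩ := dp_surj c j
    simp [TT_apply]

def TV (s t : Kˣ) : List Bool → MM K → MM K
  | [], f => f
  | c :: v, f => TT ζ s t c (TV s t v f)
def dl (s t : Kˣ) (u : MM K) : List Bool → MM K
  | [] => 0
  | c :: v => gam ζ s t u c + TT ζ s t c (dl s t u v)

variable (s t : Kˣ)
lemma TV_apply (v f i) : TV ζ s t v f (pm v i) = (hv s t (lab ζ v i) : K) * f i := by
  induction v with
  | nil => simp [TV, pm_nil, lab_nil]
  | cons c v ih => rw [TV, pm_cons, TT_apply, ih, lab_cons, map_mul, Units.val_mul, mul_assoc]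

lemma TV_add (v) (f g : MM K) : TV ζ s t v (f + g) = TV ζ s t v f + TV ζ s t v g := by
  induction v with
  | nil => rfl
  | cons c v ih => rw [TV, ih, TT_add]; rfl

lemma TV_app (v v') (f : MM K) : TV ζ s t (v ++ v') f = TV ζ s t v (TV ζ s t v' f) := by
  induction v with
  | nil => rfl
  | cons c v ih => rw [List.cons_append, TV, ih]; rfl

lemma dl_app (u v v') : dl ζ s t u (v ++ v') = dl ζ s t u v + TV ζ s t v (dl ζ s t u v') := by
  induction v with
  | nil => simp [dl, TV]
  | cons c v ih => rw [List.cons_append, dl, ih, dl, TV, TT_add, add_assoc]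

lemma aff_word (u v f) : vl (aff ζ s t u true) (aff ζ s t u false) v f = dl ζ s t u v + TV ζ s t v f := by
  induction v with
  | nil => simp [vl, dl, TV]
  | cons c v ih =>
    have : vl (aff ζ s t u true) (aff ζ s t u false) (c :: v) = aff ζ s t u c *
      vl (aff ζ s t u true) (aff ζ s t u false) v := by cases c <;> simp [vl, lt2]
    rw [this, Equiv.Perm.mul_apply, ih, dl, TV, add_assoc, ← TT_add]; rfl

lemma gam_add (u u') (c) : gam ζ s t (u + u') c = gam ζ s t u c + gam ζ s t u' c := by
  cases c
  · simp [gam]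
  · simp only [gam, cond_true, TT_add]; abel
lemma gam_smul (a : K) (u) (c) : gam ζ s t (a • u) c = a • gam ζ s t u c := by
  cases c
  · simp [gam]
  · simp only [gam, cond_true, TT_smul, smul_sub]

lemma dl_add (u u') (v) : dl ζ s t (u + u') v = dl ζ s t u v + dl ζ s t u' v := by
  induction v with
  | nil => simp [dl]
  | cons c v ih => rw [dl, dl, dl, ih, TT_add, gam_add]; abel
lemma dl_smul (a : K) (u) (v) : dl ζ s t (a • u) v = a • dl ζ s t u v := by
  induction v with
  | nil => simp [dl]
  | cons c v ih => rw [dl, dl, ih, TT_smul, gam_smul, smul_add]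

def dlL (v : List Bool) : MM K →ₗ[K] MM K where
  toFun u := dl ζ s t u v
  map_add' u u' := dl_add ζ s t u u' v
  map_smul' a u := dl_smul ζ s t a u v

lemma dl_X (a : MM K) (ha : TT ζ s t true a = a) (v) : dl ζ s t a v = 0 := by
  induction v with
  | nil => rfl
  | cons c v ih =>
    rw [dl, ih]
    ext j
    cases c <;> simp [gam, ha, TT]

lemma dl_Y (b : MM K) (hb : TT ζ s t false b = b) (v) : dl ζ s t b v = b - TV ζ s t v b := by
  induction v with
  | nil => simp [dl, TV]
  | cons c v ih =>
    rw [dl, ih, TT_sub]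
    cases c
    · rw [hb]; simp [gam, TV]
    · simp [gam, TV]

variable (hζ : (ζ : K) ^ 4 + (ζ : K) ^ 3 + (ζ : K) ^ 2 + (ζ : K) + 1 = 0)

def JJ (A : Mt K) : MM K := fun i => (mn ζ i * A).trace

include hζ in
lemma dl_J (v) : dl ζ 1 1 (JJ ζ (mv ζ 3)) v = JJ ζ (wU ζ v) := by
  have key : ∀ c A, TT ζ 1 1 c (JJ ζ A) = JJ ζ (mA ζ c * A * mAi ζ c) := by
    intro c A
    ext j
    obtain ⟨i, rfl⟩ := dp_surj c j
    rw [TT_apply, JJ, JJ, tr_conj ζ hζ c _ A ((ζ : K) ^ (df c i : ℕ)) (mn ζ i) (by rw [mAn ζ hζ])]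
    simp [hv, eta]
  have ja : ∀ A B : Mt K, JJ ζ (A + B) = JJ ζ A + JJ ζ B := by
    intro A B; ext i; simp [JJ, mul_add]
  have js : ∀ A B : Mt K, JJ ζ (A - B) = JJ ζ A - JJ ζ B := by
    intro A B; ext i; simp [JJ, mul_sub]
  induction v with
  | nil => ext i; simp [dl, wU, JJ]
  | cons c v ih =>
    rw [dl, wU, ja, ih, key]
    congr 1
    cases c
    · ext i; simp [gam, mU, JJ]
    · simp only [gam, mU, cond_true, js, key]

/-- propagation -/
lemma prop0 {f h u : MM K} (hf : TT ζ s t false f = f) (hh : TT ζ s t true h = h)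
    (hu : u = f - h) (h0 : ∀ i ∈ ([0, 6, 1, 7, 3, 5] : List (Fin 12)), u i = 0) (hz : ζ ≠ 1) (hz5 : ζ ^ 4 ≠ 1) :
    u = 0 := by
  have fy : ∀ i, f i = 0 → f (dpy i) = 0 := by
    intro i hi
    have := TT_apply ζ s t false f i
    rw [hf, hi, mul_zero] at this; exact this
  have hx : ∀ i, h i = 0 → h (dpx i) = 0 := by
    intro i hi
    have := TT_apply ζ s t true h i
    rw [hh, hi, mul_zero] at this; exact this
  have e : ∀ i ∈ ([0, 6, 1, 7, 3, 5] : List (Fin 12)), f i = h i := by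
    intro i hi; have := h0 i hi; rw [hu] at this; exact sub_eq_zero.mp this
  have f0 : f 0 = 0 := by
    have := TT_apply ζ s t false f 0
    rw [hf] at this
    have e1 : dp false 0 = 0 := rfl
    have e2 : hv s t (eta ζ (0, false)) = ζ ^ 4 := by simp [hv, eta, dl2]; rfl
    rw [e1, e2] at this
    by_contra hne
    apply hz5
    ext
    rw [Units.val_one]
    exact mul_right_cancel₀ hne (by rw [← this, one_mul])
  have f6 : f 6 = 0 := by
    have := TT_apply ζ s t false f 6
    rw [hf] at this
    have e1 : dp false 6 = 6 := rfl
    have e2 : hv s t (eta ζ (6, false)) = ζ := by simp [hv, eta, dl2]; exact pow_one ζ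
    rw [e1, e2] at this
    by_contra hne
    apply hz
    ext
    rw [Units.val_one]
    exact mul_right_cancel₀ hne (by rw [← this, one_mul])
  have h_0 : h 0 = 0 := by rw [← e 0 (by simp), f0]
  have h_1 : h 1 = 0 := hx 0 h_0
  have h_2 : h 2 = 0 := hx 1 h_1
  have h_6 : h 6 = 0 := by rw [← e 6 (by simp), f6]
  have h_7 : h 7 = 0 := hx 6 h_6
  have h_8 : h 8 = 0 := hx 7 h_7
  have f1 : f 1 = 0 := by rw [e 1 (by simp), h_1]
  have f2 : f 2 = 0 := fy 1 f1
  have f3 : f 3 = 0 := fy 2 f2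
  have f5 : f 5 = 0 := fy 3 f3
  have f4 : f 4 = 0 := fy 5 f5
  have f7 : f 7 = 0 := by rw [e 7 (by simp), h_7]
  have f8 : f 8 = 0 := fy 7 f7
  have f9 : f 9 = 0 := fy 8 f8
  have f11 : f 11 = 0 := fy 9 f9
  have f10 : f 10 = 0 := fy 11 f11
  have h_3 : h 3 = 0 := by rw [← e 3 (by simp), f3]
  have h_4 : h 4 = 0 := hx 3 h_3
  have h_11 : h 11 = 0 := hx 4 h_4
  have h_5 : h 5 = 0 := by rw [← e 5 (by simp), f5]
  have h_9 : h 9 = 0 := hx 5 h_5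
  have h_10 : h 10 = 0 := hx 9 h_9
  rw [hu]
  ext i
  fin_cases i <;> simp [*]

end

section laurent
open Polynomial
variable {K : Type} [Field K]

def LF (K : Type) [Field K] : Subring (Kˣ × Kˣ → K) where
  carrier := {f | ∃ (n : ℕ) (P : K[X][X]), ∀ s t : Kˣ, f (s, t) * ((s * t : Kˣ) : K) ^ n = (P.map (evalRingHom (s : K))).eval (t : K)}
  mul_mem' := by
    rintro f g ⟨n, P, hP⟩ ⟨m, Q, hQ⟩
    refine ⟨n + m, P * Q, fun s t => ?_⟩
    rw [Polynomial.map_mul, eval_mul, ← hP, ← hQ, Pi.mul_apply]; ring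
  one_mem' := ⟨0, 1, fun s t => by simp⟩
  add_mem' := by
    rintro f g ⟨n, P, hP⟩ ⟨m, Q, hQ⟩
    refine ⟨n + m, P * (C X * X) ^ m + Q * (C X * X) ^ n, fun s t => ?_⟩
    rw [Polynomial.map_add, eval_add, Polynomial.map_mul, eval_mul, Polynomial.map_mul, eval_mul, ← hP, ← hQ, Pi.add_apply]
    simp; ring
  zero_mem' := ⟨0, 0, fun s t => by simp⟩
  neg_mem' := by
    rintro f ⟨n, P, hP⟩
    refine ⟨n, -P, fun s t => ?_⟩
    rw [Polynomial.map_neg, eval_neg, ← hP, Pi.neg_apply]; ring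

lemma LF_const (a : K) : (fun _ => a) ∈ LF K := ⟨0, C (C a), fun s t => by simp⟩

lemma LF_unit (f g : Kˣ × Kˣ → Kˣ) (hf : (fun z => (f z : K)) ∈ LF K) (hg : (fun z => (g z : K)) ∈ LF K)
   (hfg : ∀ z, g z = (f z)⁻¹) (n : ℤ) : (fun z => ((f z ^ n : Kˣ) : K)) ∈ LF K := by
  rcases Int.eq_nat_or_neg n with ⟨k, rfl | rfl⟩
  · have := pow_mem hf k
    convert this using 1
    ext z; simp
  · have := pow_mem hg k
    convert this using 1
    ext z; simp [hfg]

lemma LF_hv (h : HH K) : (fun z : Kˣ × Kˣ => (hv z.1 z.2 h : K)) ∈ LF K := by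
  have hs := LF_unit (K := K) (fun z => z.1) (fun z => z.1⁻¹) ⟨0, C X, fun s t => by simp⟩ ⟨1, X, fun s t => by simp⟩
    (fun _ => rfl) h.2.toAdd.1
  have ht := LF_unit (K := K) (fun z => z.2) (fun z => z.2⁻¹) ⟨0, X, fun s t => by simp⟩
    ⟨1, C X, fun s t => by simp [mul_comm (s : K)]⟩ (fun _ => rfl) h.2.toAdd.2
  exact mul_mem (mul_mem (LF_const (h.1 : K)) hs) ht

lemma LF_dl (ζ : Kˣ) (u : MM K) (v) (j) : (fun z : Kˣ × Kˣ => dl ζ z.1 z.2 u v j) ∈ LF K := by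
  have hT : ∀ (g : Kˣ × Kˣ → MM K), (∀ j, (fun z => g z j) ∈ LF K) → ∀ c j,
      (fun z : Kˣ × Kˣ => TT ζ z.1 z.2 c (g z) j) ∈ LF K := by
    intro g hg c j
    exact mul_mem (LF_hv _) (hg _)
  induction v generalizing j with
  | nil => exact LF_const 0
  | cons c v ih =>
    refine add_mem (?_ : (fun z : Kˣ × Kˣ => gam ζ z.1 z.2 u c j) ∈ LF K) (hT _ ih c j)
    cases c
    · exact LF_const 0
    · exact sub_mem (LF_const (u j)) (hT (fun _ => u) (fun j => LF_const _) true j)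

lemma nz_root [IsAlgClosed K] (f : K[X]) (i j : ℕ) (hij : i ≠ j) (hi : f.coeff i ≠ 0) (hj : f.coeff j ≠ 0) :
    ∃ t : K, t ≠ 0 ∧ f.eval t = 0 := by
  have hf : f ≠ 0 := by rintro rfl; simp at hi
  obtain ⟨g, hg, hd⟩ := exists_eq_pow_rootMultiplicity_mul_and_not_dvd f hf 0
  rw [C_0, sub_zero] at hg hd
  have hdeg : g.degree ≠ 0 := by
    intro h0
    have hC := eq_C_of_degree_eq_zero h0
    rw [hg, hC, mul_comm, coeff_C_mul, coeff_X_pow] at hi hj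
    apply hij
    rw [show i = rootMultiplicity 0 f by by_contra h; simp [h] at hi,
      show j = rootMultiplicity 0 f by by_contra h; simp [h] at hj]
  obtain ⟨t, ht⟩ := IsAlgClosed.exists_root g hdeg
  refine ⟨t, ?_, by rw [hg, eval_mul, ht.eq_zero, mul_zero]⟩
  rintro rfl
  exact hd (by simpa using dvd_iff_isRoot.mpr ht)

/-- root lemma -/
lemma root_lemma [CharZero K] [IsAlgClosed K] (q : Kˣ) (hq : Function.Injective (fun n : ℕ => q ^ n))
    (D : Kˣ × Kˣ → K) (hD : D ∈ LF K) (h1 : D (1, 1) = 0) :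
    (D (1, q) = 0) ∨ ∃ n : ℕ, 0 < n ∧ ∃ t : Kˣ, D (q ^ n, t) = 0 := by
  obtain ⟨m, P, hP⟩ := hD
  have hz : ∀ s t : Kˣ, (P.map (evalRingHom (s : K))).eval (t : K) = 0 → D (s, t) = 0 := by
    intro s t h
    rw [← hP] at h
    simpa using h
  set P1 := P.map (evalRingHom ((1 : Kˣ) : K)) with hP1
  by_cases h0 : P1 = 0
  · left; apply hz; rw [← hP1, h0]; simp
  right
  have hr : P1.eval 1 = 0 := by
    have := hP 1 1
    rw [h1, zero_mul, ← hP1] at this; exact this.symm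
  obtain ⟨i, hi⟩ : ∃ i, P1.coeff i ≠ 0 := by
    by_contra h; push Not at h; exact h0 (Polynomial.ext (by simpa using h))
  obtain ⟨j, hij, hj⟩ : ∃ j, i ≠ j ∧ P1.coeff j ≠ 0 := by
    by_contra h; push Not at h
    have : P1 = C (P1.coeff i) * X ^ i := by
      ext k
      rw [coeff_C_mul, coeff_X_pow]
      by_cases hk : k = i
      · simp [hk]
      · simp [hk, h k (Ne.symm hk)]
    rw [this] at hr
    simp at hr
    exact hi hr
  have hPi : P.coeff i * P.coeff j ≠ 0 := by
    rw [hP1, coeff_map] at hi hj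
    intro h
    rcases mul_eq_zero.mp h with h | h
    · rw [h] at hi; simp at hi
    · rw [h] at hj; simp at hj
  obtain ⟨n, hn, hne⟩ : ∃ n : ℕ, 0 < n ∧ (P.coeff i * P.coeff j).eval ((q : K) ^ n) ≠ 0 := by
    by_contra h; push Not at h
    apply hPi
    apply Polynomial.eq_zero_of_infinite_isRoot
    refine Set.Infinite.mono (s := Set.range fun n : ℕ => (q : K) ^ (n + 1)) ?_ (Set.infinite_range_of_injective ?_)
    · rintro _ ⟨n, rfl⟩; exact h _ (Nat.succ_pos _)
    · intro a b hab
      have : q ^ (a + 1) = q ^ (b + 1) := by ext; simpa using hab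
      have := hq this
      omega
  rw [eval_mul] at hne
  obtain ⟨t, ht, hrt⟩ := nz_root (P.map (evalRingHom ((q : K) ^ n))) i j hij
    (by rw [coeff_map]; exact left_ne_zero_of_mul hne) (by rw [coeff_map]; exact right_ne_zero_of_mul hne)
  exact ⟨n, hn, Units.mk0 t ht, hz _ _ (by simpa using hrt)⟩
end laurent

end

section
def uj : Fin 6 → Fin 12 := ![2, 4, 8, 9, 10, 11]

section
variable {K : Type} [Field K] [CharZero K] (ζ : Kˣ)
  (hζ : (ζ : K) ^ 4 + (ζ : K) ^ 3 + (ζ : K) ^ 2 + (ζ : K) + 1 = 0)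

def emb (x : Fin 6 → K) : MM K := ∑ j, x j • (Pi.single (uj j) 1 : MM K)

omit [CharZero K] in
lemma emb_uj (x : Fin 6 → K) (j) : emb x (uj j) = x j := by
  have : ∀ a b, uj a = uj b ↔ a = b := by decide
  simp [emb, Finset.sum_apply, Pi.single_apply, this]
omit [CharZero K] in
lemma emb_S (x : Fin 6 → K) : ∀ i ∈ ([0, 6, 1, 7, 3, 5] : List (Fin 12)), emb x i = 0 := by
  intro i hi
  have : ∀ i ∈ ([0, 6, 1, 7, 3, 5] : List (Fin 12)), ∀ j, i ≠ uj j := by decide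
  simp [emb, Finset.sum_apply, Pi.single_apply, this i hi]

include hζ in
lemma det_lemma (W : List Bool) (hu : wU ζ (W ++ W) = 0) (hp : pm (W ++ W) = 1)
    (hl : ∀ i, lab ζ (W ++ W) i = 1) (hf : ∀ i, pm W i ≠ i) :
    ∃ D ∈ LF K, D (1, 1) = 0 ∧ ∀ s t, D (s, t) = 0 → ∃ u : MM K, u ≠ 0 ∧
      (∀ i ∈ ([0, 6, 1, 7, 3, 5] : List (Fin 12)), u i = 0) ∧ dl ζ s t u (W ++ W) = 0 := by
  have hpp : ∀ i, pm W (pm W i) = i := by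
    intro i; rw [← pm_app, hp]; rfl
  let R : Finset (Fin 12) := Finset.univ.filter fun i => i < pm W i
  have hR : ∀ i, i ∈ R ∨ pm W i ∈ R := by
    intro i
    simp only [R, Finset.mem_filter, Finset.mem_univ, true_and, hpp]
    exact lt_or_gt_of_ne (hf i).symm
  have hcard : R.card = 6 := by
    have h1 : Rᶜ = R.map (pm W).toEmbedding := by
      ext i
      simp only [Finset.mem_compl, Finset.mem_map, Equiv.coe_toEmbedding]
      constructor
      · intro h; exact ⟨pm W i, (hR i).resolve_left h, hpp i⟩
      · rintro ⟨j, hj, rfl⟩ h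
        simp only [R, Finset.mem_filter, Finset.mem_univ, true_and, hpp] at hj h
        exact lt_asymm hj h
    have h2 := Finset.card_add_card_compl R
    rw [h1, Finset.card_map] at h2
    simp at h2; omega
  let e : Fin 6 ≃ R := (Finset.equivFinOfCardEq hcard).symm
  have TVid : ∀ s t (f : MM K), TV ζ s t (W ++ W) f = f := by
    intro s t f; ext i
    have := TV_apply ζ s t (W ++ W) f i
    rw [hp, hl] at this; simpa using this
  have hz : ∀ s t (u : MM K), (∀ r, dl ζ s t u (W ++ W) (e r) = 0) → dl ζ s t u (W ++ W) = 0 := by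
    intro s t u h
    have h1 : ∀ i ∈ R, dl ζ s t u (W ++ W) i = 0 := by
      intro i hi
      have := h (e.symm ⟨i, hi⟩)
      simpa using this
    have h2 : TV ζ s t W (dl ζ s t u (W ++ W)) = dl ζ s t u (W ++ W) := by
      conv_lhs => rw [dl_app, TV_add, ← TV_app, TVid]
      rw [dl_app, add_comm]
    ext i
    rcases hR i with hi | hi
    · exact h1 i hi
    · have h3 := TV_apply ζ s t W (dl ζ s t u (W ++ W)) i
      rw [h2, h1 _ hi] at h3
      simpa using h3.symm
  let N : Kˣ × Kˣ → Matrix (Fin 6) (Fin 6) K := fun z r j =>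
    dl ζ z.1 z.2 (Pi.single (uj j) 1) (W ++ W) (e r)
  have hN : ∀ z x r, (N z).mulVec x r = dl ζ z.1 z.2 (emb x) (W ++ W) (e r) := by
    intro z x r
    have : dl ζ z.1 z.2 (emb x) (W ++ W) = ∑ j, x j • dl ζ z.1 z.2 (Pi.single (uj j) 1) (W ++ W) := by
      change dlL ζ z.1 z.2 (W ++ W) (emb x) = _
      rw [emb, map_sum]
      simp only [map_smul]; rfl
    rw [this]
    simp [Matrix.mulVec, dotProduct, N, mul_comm]
  have hD : ∀ z, (N z).det = 0 ↔ ∃ x ≠ 0, dl ζ z.1 z.2 (emb x) (W ++ W) = 0 := by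
    intro z
    rw [← Matrix.exists_mulVec_eq_zero_iff]
    apply exists_congr; intro x
    apply and_congr_right; intro _
    constructor
    · intro h; apply hz; intro r; rw [← hN, h]; rfl
    · intro h; ext r; rw [hN, h]; rfl
  refine ⟨fun z => (N z).det, ?_, ?_, ?_⟩
  · have : (fun z => (N z).det) = ∑ σ : Equiv.Perm (Fin 6), Equiv.Perm.sign σ • ∏ i, fun z => N z (σ i) i := by
      ext z
      rw [Matrix.det_apply]; simp [Finset.sum_apply, Finset.prod_apply]
    rw [this]
    refine sum_mem fun σ _ => ?_
    have h2 : (∏ i, fun z => N z (σ i) i) ∈ LF K := prod_mem fun i _ => LF_dl ζ _ _ _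
    rcases Int.units_eq_one_or (Equiv.Perm.sign σ) with h | h <;> rw [h]
    · simpa using h2
    · simpa using neg_mem h2
  · rw [hD]
    let a : MM K := fun i => zv (ζ : K) (da i)
    let b : MM K := fun i => zv (ζ : K) (db i)
    have ha : TT ζ 1 1 true a = a := by
      ext j
      obtain ⟨i, rfl⟩ := dp_surj true j
      rw [TT_apply]
      simp only [a, dp, cond_true, ck_a, zv_mul hζ, zv_pw hζ]
      simp [hv, eta, df]
    have hb : TT ζ 1 1 false b = b := by
      ext j
      obtain ⟨i, rfl⟩ := dp_surj false j
      rw [TT_apply]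
      simp only [b, dp, cond_false, ck_b, zv_mul hζ, zv_pw hζ]
      simp [hv, eta, df]
    let u' : MM K := JJ ζ (mv ζ 3) - (a + b)
    have hu' : ∀ i, u' i = zv (ζ : K) (ztr (zmm (dns i) (dvs 3)) - (da i + db i)) := by
      intro i
      simp only [u', Pi.sub_apply, JJ, mn, mv, ← zM_mul hζ, zM_tr, zv_sub, zv_add, a, b, Pi.add_apply]
    have hemb : emb (fun j => u' (uj j)) = u' := by
      ext i
      have hi : i ∈ ([0, 6, 1, 7, 3, 5] : List (Fin 12)) ∨ ∃ j, i = uj j := by revert i; decide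
      rcases hi with hi | ⟨j, rfl⟩
      · rw [emb_S _ i hi, hu', (ck_u i).1 hi, sub_self]; simp [zv]
      · rw [emb_uj]
    refine ⟨fun j => u' (uj j), ?_, ?_⟩
    · intro h
      have h1 := congrFun h 0
      have h2 : u' 2 = 0 := h1
      rw [hu', (ck_u 2).2] at h2
      exact dd_ne ζ hζ h2
    · rw [hemb]
      change dlL ζ 1 1 (W ++ W) (JJ ζ (mv ζ 3) - (a + b)) = 0
      rw [map_sub, map_add]
      change dl ζ 1 1 _ _ - (dl ζ 1 1 _ _ + dl ζ 1 1 _ _) = 0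
      rw [dl_J ζ hζ, hu, dl_X ζ 1 1 a ha, dl_Y ζ 1 1 b hb, TVid]
      ext i; simp [JJ]
  · intro s t h
    obtain ⟨x, hx, h0⟩ := (hD (s, t)).mp h
    refine ⟨emb x, ?_, emb_S x, h0⟩
    intro he
    apply hx
    ext j
    rw [← emb_uj x j, he]; rfl
end

lemma cyc {L : Type} [Group L] (f : L →* Multiplicative ℤ) (l0 : L) (h : bx f l0 ≠ 0) :
    ∃ (χ : L →* Multiplicative ℤ) (d : ℤ) (t : L), 0 < d ∧ bx χ t = 1 ∧ ∀ l, bx f l = d * bx χ l := by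
  let S : AddSubgroup ℤ :=
    { carrier := {n | ∃ l, bx f l = n}
      add_mem' := by rintro _ _ ⟨a, rfl⟩ ⟨b, rfl⟩; exact ⟨a * b, bx_mul _ _ _⟩
      zero_mem' := ⟨1, bx_one _⟩
      neg_mem' := by rintro _ ⟨a, rfl⟩; exact ⟨a⁻¹, bx_inv _ _⟩ }
  obtain ⟨d0, hd0⟩ := Int.subgroup_cyclic S
  have hmem : ∀ n, n ∈ S ↔ d0 ∣ n := by
    intro n; rw [hd0, AddSubgroup.mem_closure_singleton]
    constructor
    · rintro ⟨k, rfl⟩; simp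
    · rintro ⟨k, rfl⟩; exact ⟨k, by simp [mul_comm]⟩
  have hdvd : ∀ l, |d0| ∣ bx f l := fun l => (abs_dvd _ _).mpr ((hmem _).mp ⟨l, rfl⟩)
  have hne : d0 ≠ 0 := by
    rintro rfl
    apply h
    simpa using hdvd l0
  obtain ⟨t, ht⟩ : ∃ t, bx f t = |d0| := (hmem _).mpr (by simp)
  refine ⟨MonoidHom.mk' (fun l => Multiplicative.ofAdd (bx f l / |d0|)) ?_, |d0|, t, abs_pos.mpr hne, ?_, ?_⟩
  · intro a b
    rw [bx_mul, Int.add_ediv_of_dvd_left (hdvd a), ofAdd_add]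
  · change bx f t / |d0| = 1
    rw [ht]; exact Int.ediv_self (abs_pos.mpr hne).ne'
  · intro l
    exact (Int.mul_ediv_cancel' (hdvd l)).symm

end

section
lemma lab_rep {K : Type} [Field K] (ζ : Kˣ) (h5 : ζ ^ 5 = 1) (i) :
    lab ζ (List.replicate 3 true) i = 1 ∧ lab ζ (List.replicate 5 false) i = 1 := by
  have c1 : ∀ i, pm [] i = i := fun _ => rfl
  have p5 : ∀ n : ℕ, n % 5 = 0 → ζ ^ n = 1 := by
    intro n hn; obtain ⟨k, rfl⟩ := Nat.dvd_of_mod_eq_zero hn; rw [pow_mul, h5, one_pow]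
  constructor
  · simp only [List.replicate, lab_cons, lab_nil, eta, pm_cons, c1, Prod.mk_mul_mk, mul_one, ← pow_add, ← ofAdd_add]
    have a1 : ∀ i, dl2 true (dp true (dp true i)) + (dl2 true (dp true i) + dl2 true i) = 0 := by decide
    have a2 : ∀ i, ((df true (dp true (dp true i)) : ℕ) + ((df true (dp true i) : ℕ) + (df true i : ℕ))) % 5 = 0 := by decide
    rw [a1, p5 _ (a2 i)]; rfl
  · simp only [List.replicate, lab_cons, lab_nil, eta, pm_cons, c1, Prod.mk_mul_mk, mul_one, ← pow_add, ← ofAdd_add]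
    rw [p5 _ ?_]
    · rfl
    · revert i; decide

lemma free2_map_inj {S T : Type} [Group S] [Group T] {P Q : S} (f : S →* T) (hf : Function.Injective f)
    (h : Free2 P Q) : Free2 (f P) (f Q) := by
  have : FreeGroup.lift ![f P, f Q] = f.comp (FreeGroup.lift ![P, Q]) := by
    ext i; fin_cases i <;> simp
  unfold Free2
  rw [this, MonoidHom.coe_comp]
  exact hf.comp h

section
variable {K : Type} [NormedField K] [IsUltrametricDist K] [IsAlgClosed K] [CharZero K] (ζ : Kˣ)
  (hζ : (ζ : K) ^ 4 + (ζ : K) ^ 3 + (ζ : K) ^ 2 + (ζ : K) + 1 = 0) (q : Kˣ) (hq : ‖(q : K)‖ = 2⁻¹)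
  (hdisc : ∀ t : Kˣ, ∃ N : ℕ, 0 < N ∧ ∃ β : ℤ, ‖(t : K)‖ ^ N = 2 ^ β)

def bp (b : Bool) : Fin 12 := cond b 0 6

omit [IsUltrametricDist K] [IsAlgClosed K] [CharZero K] in
include hq hdisc in
lemma norm_data (s t : Kˣ) (h : (s = 1 ∧ t = q) ∨ ∃ n : ℕ, 0 < n ∧ s = q ^ n) :
    ∃ N : ℕ, 0 < N ∧ ∃ α β : ℤ, ‖(s : K)‖ ^ N = 2 ^ α ∧ ‖(t : K)‖ ^ N = 2 ^ β ∧ (α ≠ 0 ∨ β ≠ 0) := by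
  rcases h with ⟨rfl, rfl⟩ | ⟨n, hn, rfl⟩
  · exact ⟨1, one_pos, 0, -1, by simp, by simp [hq], by simp⟩
  · obtain ⟨N, hN, β, hβ⟩ := hdisc t
    refine ⟨N, hN, -(n * N), β, ?_, hβ, ?_⟩
    · simp [hq, ← pow_mul]; norm_cast
    · left; simp; omega

include hζ hq hdisc in
theorem B1 (w) (h : (ev (dm (mA ζ true) (mU ζ true * mA ζ true)) (dm (mA ζ false) 0) w).trace = 0) :
    Good w := by
  obtain ⟨hu, hp, hl, hfix⟩ := W_main ζ hζ w h
  obtain ⟨D, hD, hD1, hDz⟩ := det_lemma ζ hζ (wl w) hu hp hl hfix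
  have hz5 := zu5 ζ hζ
  have hz1 : ζ ≠ 1 := by rintro rfl; norm_num at hζ
  have hz4 : ζ ^ 4 ≠ 1 := by
    intro h4; apply hz1
    calc ζ = ζ ^ 5 * (ζ ^ 4)⁻¹ := by group
      _ = 1 := by rw [hz5, h4]; simp
  have hqi : Function.Injective (fun n : ℕ => q ^ n) := by
    intro a b hab
    have h1 : ‖((q ^ a : Kˣ) : K)‖ = ‖((q ^ b : Kˣ) : K)‖ := by
      have h0 : q ^ a = q ^ b := hab
      rw [h0]
    simp only [Units.val_pow_eq_pow_val, norm_pow, hq] at h1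
    exact pow_right_injective₀ (by norm_num) (by norm_num) h1
  obtain ⟨s, t, hst, hd⟩ : ∃ s t : Kˣ, D (s, t) = 0 ∧ ((s = 1 ∧ t = q) ∨ ∃ n : ℕ, 0 < n ∧ s = q ^ n) := by
    rcases root_lemma q hqi D hD hD1 with h | ⟨n, hn, t, h⟩
    · exact ⟨1, q, h, Or.inl ⟨rfl, rfl⟩⟩
    · exact ⟨q ^ n, t, h, Or.inr ⟨n, hn, rfl⟩⟩
  obtain ⟨N, hN, α, β, hα, hβ, hab⟩ := norm_data q hq hdisc s t hd
  obtain ⟨u, hu0, huS, huW⟩ := hDz s t hst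
  clear hDz hD hD1 D hst hd hu
  obtain ⟨G, _, x, y, hU⟩ := exists_univ w
  by_contra hG
  have hnf : ∀ P Q : G, ¬ Free2 P Q := fun P Q h => hG (good_of_univ hU h)
  have hU' := hU
  obtain ⟨-, -, -, hF, hgen⟩ := hU'
  have l3 := fun i => (lab_rep ζ hz5 i).1
  have l5 := fun i => (lab_rep ζ hz5 i).2
  have p3 : pm (List.replicate 3 true) = 1 := by decide
  have p5 : pm (List.replicate 5 false) = 1 := by decide
  have vapp : ∀ {T : Type} [Group T] (X Y : T), vl X Y (wl w ++ wl w) = ev X Y w ^ 2 := by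
    intro T _ X Y; rw [sq, ← vl_wl]; simp [vl]
  -- the permutation
  obtain ⟨p, hpx, hpy⟩ := hF (Equiv.Perm (Fin 12)) _ sx sy (by rw [← p3, pm, vl_rep]; rfl)
    (by rw [← p5, pm, vl_rep]; rfl) (by rw [← vapp]; exact hp)
  have mapv : ∀ {T : Type} [Group T] (F : G →* T) (X Y : T), F x = X → F y = Y → ∀ v, F (vl x y v) = vl X Y v := by
    intro T _ F X Y hX hY v
    induction v with
    | nil => simp [vl]
    | cons c v ih => 
      simp only [vl, List.map_cons, List.prod_cons, map_mul] at ih ⊢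
      rw [ih]; congr 1; cases c; exacts [hY, hX]
  have pv := mapv p sx sy hpx hpy
  -- labels
  have lword : ∀ v, pm v = 1 → (∀ i, lab ζ v i = 1) →
      vl (pX sx sy (MonoidHom.id _) (eta ζ) true) (pX sx sy (MonoidHom.id _) (eta ζ) false) v = 1 := by
    intro v h1 h2
    ext1 a
    rw [pX_word]
    have h2' := h2 a.1
    simp only [lab] at h2'
    have h1' : (MonoidHom.id (Equiv.Perm (Fin 12))) (vl sx sy v) = 1 := h1
    rw [h2', h1']; simp
  obtain ⟨F1, h1x, h1y⟩ := hF (Equiv.Perm (Fin 12 × HH K)) _ (pX sx sy (MonoidHom.id _) (eta ζ) true)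
    (pX sx sy (MonoidHom.id _) (eta ζ) false)
    (by rw [← lword _ p3 l3, vl_rep]; rfl) (by rw [← lword _ p5 l5, vl_rep]; rfl)
    (by rw [← vapp]; exact lword _ hp hl)
  have F1v := mapv F1 _ _ h1x h1y
  have TVid : ∀ v, pm v = 1 → (∀ i, lab ζ v i = 1) → ∀ f : MM K, TV ζ s t v f = f := by
    intro v h1 h2 f
    ext i
    have := TV_apply ζ s t v f i
    rw [h1, h2] at this; simpa using this
  have dt : ∀ n, dl ζ s t u (List.replicate n true) = u - TV ζ s t (List.replicate n true) u := by
    intro n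
    induction n with
    | zero => simp [dl, TV]
    | succ n ih => rw [List.replicate_succ, dl, ih, TT_sub, TV]; simp [gam]
  have df' : ∀ n, dl ζ s t u (List.replicate n false) = 0 := by
    intro n
    induction n with
    | zero => simp [dl]
    | succ n ih => rw [List.replicate_succ, dl, ih]; ext j; simp [gam, TT]
  have aword : ∀ v, pm v = 1 → (∀ i, lab ζ v i = 1) → dl ζ s t u v = 0 →
      vl (aff ζ s t u true) (aff ζ s t u false) v = 1 := by
    intro v h1 h2 h3
    ext1 f
    rw [aff_word, h3, TVid v h1 h2]; simp
  obtain ⟨F2, h2x, h2y⟩ := hF (Equiv.Perm (MM K)) _ (aff ζ s t u true) (aff ζ s t u false)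
    (by rw [← aword _ p3 l3 (by rw [dt, TVid _ p3 l3, sub_self]), vl_rep]; rfl)
    (by rw [← aword _ p5 l5 (df' 5), vl_rep]; rfl)
    (by rw [← vapp]; exact aword _ hp hl huW)
  have F2v := mapv F2 _ _ h2x h2y
  choose wd hwd using hgen
  let lg : G → Fin 12 → HH K := fun g i => lab ζ (wd g) i
  have pg : ∀ g, p g = pm (wd g) := fun g => by conv_lhs => rw [hwd g, pv]
  have F1g : ∀ g i k, F1 g (i, k) = (p g i, lg g i * k) := by
    intro g i k
    rw [pg]
    conv_lhs => rw [hwd g, F1v, pX_word]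
    rfl
  have F2g : ∀ g f i, F2 g f (p g i) = dl ζ s t u (wd g) (p g i) + (hv s t (lg g i) : K) * f i := by
    intro g f i
    have hF2 : F2 g f = dl ζ s t u (wd g) + TV ζ s t (wd g) f := by
      conv_lhs => rw [hwd g, F2v, aff_word]
    rw [hF2, pg, ← TV_apply]
    rfl
  have lgv : ∀ v i, lg (vl x y v) i = lab ζ v i := by
    intro v i
    have h1 := F1g (vl x y v) i 1
    rw [F1v, pX_word] at h1
    have := congrArg Prod.snd h1
    simpa using this.symm
  have lgm : ∀ g k i, lg (g * k) i = lg g (p k i) * lg k i := by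
    intro g k i
    have h1 := F1g (g * k) i 1
    rw [map_mul, Equiv.Perm.mul_apply, F1g, F1g] at h1
    have := congrArg Prod.snd h1
    simpa using this.symm
  have anti : ∀ g i, p g (i + 6) = p g i + 6 := fun g i => by rw [pg, pm_anti]
  have lanti : ∀ g i, (lg g (i + 6)).2 = (lg g i).2⁻¹ := fun g i => lab_anti ζ _ _
  have trans : ∀ i : Fin 12, ∃ g, p g 0 = i := by
    have hall : ∀ i : Fin 12, ∃ v, pm v 0 = i := fun i =>
      ⟨(![[], [true], [true, true], [false, true, true], [true, false, true, true], [false, false, true, true], [true, true, false, false, true, true, false, true, true], [false, false, true, true, false, true, true], [true, false, false, true, true, false, true, true], [true, false, false, true, true], [false, true, true, false, true, true], [true, true, false, true, true]] : Fin 12 → List Bool) i, by revert i; decide⟩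
    intro i
    obtain ⟨v, hv⟩ := hall i
    exact ⟨vl x y v, by rw [pv]; exact hv⟩
  choose g0 hg0 using trans
  let g : Fin 12 → G := fun i => if i = 0 then 1 else g0 i
  have hg : ∀ i, p (g i) 0 = i := by
    intro i
    by_cases hi : i = 0
    · simp [g, hi]
    · simp [g, hi, hg0]
  have hFPP := fpp_stab x y p 0 g hU hg (by simp [g])
  have hLb : ∀ (l : stab p 0) b, p l (bp b) = bp b := by
    intro l b
    have h0 := (mem_stab p 0).mp l.2
    cases b
    · change p l 6 = 6
      have := anti l 0
      rw [h0] at this; exact this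
    · exact h0
  let lgh : Bool → stab p 0 →* HH K := fun b => MonoidHom.mk' (fun l => lg l (bp b)) (by
    intro a c
    rw [Subgroup.coe_mul, lgm, hLb])
  let ρ : Bool → stab p 0 →* K := fun b => (Units.coeHom K).comp ((hv s t).comp (lgh b))
  have hρ : ∀ b l, ρ b l = (hv s t (lg l (bp b)) : K) := fun b l => rfl
  let z : Bool → stab p 0 → K := fun b l => F2 l 0 (bp b)
  have hz : ∀ b l k, z b (l * k) = z b l + ρ b l * z b k := by
    intro b l k
    have h1 := F2g l (F2 k 0) (bp b)
    have h2 := F2g l 0 (bp b)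
    rw [hLb] at h1 h2
    simp only [z, Subgroup.coe_mul, map_mul, Equiv.Perm.mul_apply]
    rw [h1, h2, hρ]; simp
  let eH : HH K →* Multiplicative ℤ := MonoidHom.mk'
    (fun h => Multiplicative.ofAdd (h.2.toAdd.1 * α + h.2.toAdd.2 * β)) (by
      intro a b; rw [← ofAdd_add]; congr 1; simp; ring)
  let f : stab p 0 →* Multiplicative ℤ := eH.comp (lgh true)
  have nrm : ∀ h : HH K, h.1 ^ 5 = 1 → ‖(hv s t h : K)‖ ^ N = 2 ^ (h.2.toAdd.1 * α + h.2.toAdd.2 * β) := by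
    intro h h5
    have h1 : ‖(h.1 : K)‖ = 1 := by
      have : ‖(h.1 : K)‖ ^ 5 = 1 := by rw [← norm_pow, ← Units.val_pow_eq_pow_val, h5]; simp
      exact (pow_eq_one_iff_of_nonneg (norm_nonneg _) (by norm_num)).mp this
    simp only [hv, MonoidHom.mk'_apply, Units.val_mul, norm_mul, h1, one_mul, Units.val_zpow_eq_zpow_val, norm_zpow, mul_pow]
    have c1 : ∀ (r : ℝ) (k : ℤ), (r ^ k) ^ N = (r ^ N) ^ k := by
      intro r k; rw [← zpow_natCast, ← zpow_mul, mul_comm, zpow_mul, zpow_natCast]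
    rw [c1, c1, hα, hβ, ← zpow_mul, ← zpow_mul, ← zpow_add₀ (by norm_num)]
    congr 1; ring
  have nT : ∀ l, ‖ρ true l‖ ^ N = 2 ^ (bx f l) := fun l => nrm _ (lab5 ζ hζ _ _)
  have nF : ∀ l, ‖ρ false l‖ ^ N = 2 ^ (- bx f l) := by
    intro l
    rw [hρ, nrm _ (lab5 ζ hζ _ _)]
    congr 1
    have : (lg l (bp false)).2 = (lg l (bp true)).2⁻¹ := lanti l 0
    rw [this]
    change _ = -((lg l (bp true)).2.toAdd.1 * α + (lg l (bp true)).2.toAdd.2 * β)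
    simp; ring
  obtain ⟨l0, hl0⟩ : ∃ l0, bx f l0 ≠ 0 := by
    by_contra hcon
    push Not at hcon
    have key : ∀ v, pm v 0 = 0 → (lab ζ v 0).2.toAdd.1 * α + (lab ζ v 0).2.toAdd.2 * β = 0 := by
      intro v hv
      have := hcon ⟨vl x y v, by rw [mem_stab, pv]; exact hv⟩
      change (lg (vl x y v) 0).2.toAdd.1 * α + (lg (vl x y v) 0).2.toAdd.2 * β = 0 at this
      rwa [lgv] at this
    have k1 := key [true, false, true] (by decide)
    have k2 := key [true, false, false, true, false, true, true] (by decide)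
    have e1 : (lab ζ [true, false, true] 0).2.toAdd = (-2, 0) := by
      simp only [lab_cons, lab_nil, eta, Prod.snd_mul, toAdd_mul, toAdd_ofAdd, Prod.snd_one, toAdd_one, add_zero]; decide
    have e2 : (lab ζ [true, false, false, true, false, true, true] 0).2.toAdd = (-1, -1) := by
      simp only [lab_cons, lab_nil, eta, Prod.snd_mul, toAdd_mul, toAdd_ofAdd, Prod.snd_one, toAdd_one, add_zero]; decide
    rw [e1] at k1; rw [e2] at k2
    simp at k1 k2
    omega
  obtain ⟨χ, d, tt, hd, hχ, hfχ⟩ := cyc f l0 hl0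
  have hp1 : ∀ r : ℝ, 0 ≤ r → r ^ N = 1 → r = 1 := fun r hr h =>
    (pow_eq_one_iff_of_nonneg hr (by omega)).mp h
  obtain ⟨b, vv, hvv⟩ := bs_aff (Egen x y p 0 g hg) χ tt hFPP hχ
    (fun P Q h => hnf P Q (free2_map_inj (Subgroup.subtype _) (Subgroup.subtype_injective _) h)) ρ z hz
    (by
      intro b l hb
      apply hp1 _ (norm_nonneg _)
      have h0 : bx f l = 0 := by rw [hfχ, hb, mul_zero]
      cases b
      · rw [nF, h0]; simp
      · rw [nT, h0]; simp)
    (by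
      have h1 := nT tt
      rw [hfχ, hχ, mul_one] at h1
      by_contra hle
      push Not at hle
      have h2 : ‖ρ true tt‖ ^ N ≤ 1 := pow_le_one₀ (norm_nonneg _) hle
      rw [h1] at h2
      have : (1 : ℝ) < 2 ^ d := one_lt_zpow₀ (by norm_num) hd
      linarith)
    (by
      have h1 := nF tt
      rw [hfχ, hχ, mul_one] at h1
      by_contra hle
      push Not at hle
      have h2 : 1 ≤ ‖ρ false tt‖ ^ N := one_le_pow₀ hle
      rw [h1] at h2
      have : (1 : ℝ) < 2 ^ d := one_lt_zpow₀ (by norm_num) hd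
      rw [zpow_neg] at h2
      have h3 := inv_lt_one_of_one_lt₀ this
      linarith)
  -- fixed point
  have F2dep : ∀ k (f f' : MM K) i, f i = f' i → F2 k f (p k i) = F2 k f' (p k i) := by
    intro k f f' i hi; rw [F2g, F2g, hi]
  have hfixb : ∀ (l : stab p 0) (f : MM K), f (bp b) = vv → F2 l f (bp b) = vv := by
    intro l f hf
    have h1 := F2g l f (bp b)
    have h2 := F2g l 0 (bp b)
    rw [hLb] at h1 h2
    have h3 := hvv l
    simp only [z] at h3
    rw [h2, hρ] at h3
    rw [h1, hf]
    simp at h3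
    linear_combination h3
  have trb : ∀ i, ∃ k, p k (bp b) = i := by
    intro i
    refine ⟨g i * (g (bp b))⁻¹, ?_⟩
    have : (p (g (bp b)))⁻¹ (bp b) = 0 := by rw [Equiv.Perm.inv_eq_iff_eq, hg]
    rw [map_mul, map_inv, Equiv.Perm.mul_apply, this, hg]
  choose gb hgb using trb
  let a : MM K := fun i => F2 (gb i) (fun _ => vv) i
  have ha : ∀ k i, p k (bp b) = i → ∀ f : MM K, f (bp b) = vv → F2 k f i = a i := by
    intro k i hk f hf
    have hl : (gb i)⁻¹ * k ∈ stab p 0 := by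
      rw [mem_stab]
      have h0 : p ((gb i)⁻¹ * k) (bp b) = bp b := by
        rw [map_mul, map_inv, Equiv.Perm.mul_apply, hk, Equiv.Perm.inv_eq_iff_eq, hgb]
      cases hb : b
      · rw [hb] at h0
        have := anti ((gb i)⁻¹ * k) 6
        have e6 : bp false = 6 := rfl
        rw [e6] at h0
        rw [h0] at this; exact this
      · rw [hb] at h0; exact h0
    have h1 := hfixb ⟨_, hl⟩ f hf
    have h2 : F2 k f = F2 (gb i) (F2 ((gb i)⁻¹ * k) f) := by
      rw [← Equiv.Perm.mul_apply, ← map_mul]; congr 2; group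
    rw [h2]
    have h3 := F2dep (gb i) (F2 ((gb i)⁻¹ * k) f) (fun _ => vv) (bp b) h1
    rw [hgb] at h3; exact h3
  have hfa : ∀ k, F2 k a = a := by
    intro k
    ext j
    obtain ⟨i, rfl⟩ := (p k).surjective j
    have h1 : a i = F2 (gb i) (fun _ => vv) i := rfl
    rw [F2dep k a _ i h1, ← Equiv.Perm.mul_apply, ← map_mul]
    apply ha _ _ _ _ rfl
    rw [map_mul, Equiv.Perm.mul_apply, hgb]
  have hay := hfa y
  have hax := hfa x
  rw [h2y] at hay
  rw [h2x] at hax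
  have hay' : TT ζ s t false a = a := by
    have : gam ζ s t u false + TT ζ s t false a = a := hay
    simpa [gam] using this
  have hax' : TT ζ s t true (a - u) = a - u := by
    have : gam ζ s t u true + TT ζ s t true a = a := hax
    rw [TT_sub]
    simp only [gam, cond_true] at this
    rw [sub_eq_sub_iff_add_eq_add]
    rw [← sub_eq_zero] at this ⊢
    rw [← this]; abel
  exact hu0 (prop0 ζ s t hay' hax' (by abel) huS hz1 hz4)
end

end

section
section tt
variable {A B : Type*} [CommRing A] [CommRing B]

def mX (v : A × A × A × A) : A × A × A × A :=
  (-v.2.1, v.1 - v.2.1, -v.2.2.2, v.2.2.1 - v.2.2.2)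
def mY (θ l : A) (v : A × A × A × A) : A × A × A × A :=
  ((l + θ) * v.2.1 - v.2.2.1 + v.2.2.2, θ * v.2.1 + v.2.2.2, v.1 - v.2.1 + θ * v.2.2.1 + l * v.2.2.2, -v.2.1)
def tc (θ l : A) : List (ℕ × ℕ) → A × A × A × A
  | [] => (1, 0, 0, 0)
  | p :: w => mX^[p.1] ((mY θ l)^[p.2] (tc θ l w))
def tt (θ l : A) (w : List (ℕ × ℕ)) : A :=
  2 * (tc θ l w).1 - (tc θ l w).2.1 + θ * (tc θ l w).2.2.1 + l * (tc θ l w).2.2.2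

def mp4 (f : A →+* B) (v : A × A × A × A) : B × B × B × B := (f v.1, f v.2.1, f v.2.2.1, f v.2.2.2)
lemma tc_map (f : A →+* B) (θ l : A) (w) : mp4 f (tc θ l w) = tc (f θ) (f l) w := by
  have h1 : Function.Semiconj (mp4 f) mX mX := by intro v; simp [mp4, mX]
  have h2 : Function.Semiconj (mp4 f) (mY θ l) (mY (f θ) (f l)) := by intro v; simp [mp4, mY]
  induction w with
  | nil => simp [mp4, tc]
  | cons p w ih => rw [tc, tc, ← ih, h1.iterate_right, h2.iterate_right]
lemma tt_map (f : A →+* B) (θ l : A) (w) : f (tt θ l w) = tt (f θ) (f l) w := by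
  unfold tt
  rw [← tc_map]; simp [mp4, map_ofNat]

def lin (X Y : Matrix (Fin 2) (Fin 2) A) (v : A × A × A × A) : Matrix (Fin 2) (Fin 2) A :=
  v.1 • 1 + v.2.1 • X + v.2.2.1 • Y + v.2.2.2 • (X * Y)

lemma lin_X (X Y : Matrix (Fin 2) (Fin 2) A) (hX : X.det = 1) (tX : X.trace = -1) (v) :
    X * lin X Y v = lin X Y (mX v) := by
  have h : X * X = - X - 1 := by
    rw [Matrix.det_fin_two] at hX
    rw [Matrix.trace_fin_two] at tX
    ext i j
    fin_cases i <;> fin_cases j <;> simp [Matrix.mul_apply, Fin.sum_univ_two]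
    · linear_combination X 0 0 * tX - hX
    · linear_combination X 0 1 * tX
    · linear_combination X 1 0 * tX
    · linear_combination X 1 1 * tX - hX
  have h2 : X * (X * Y) = - (X * Y) - Y := by rw [← mul_assoc, h]; noncomm_ring
  simp only [lin, mX, mul_add, Matrix.mul_smul, h, h2, mul_one]
  module

lemma lin_Y (X Y : Matrix (Fin 2) (Fin 2) A) (θ l : A) (hX : X.det = 1) (tX : X.trace = -1) (hY : Y.det = 1)
    (tY : Y.trace = θ) (tXY : (X * Y).trace = l) (v) :
    Y * lin X Y v = lin X Y (mY θ l v) := by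
  rw [Matrix.det_fin_two] at hX hY
  rw [Matrix.trace_fin_two] at tX tY tXY
  simp only [Matrix.mul_apply, Fin.sum_univ_two] at tXY
  have h : Y * Y = θ • Y - 1 := by
    ext i j
    fin_cases i <;> fin_cases j <;> simp [Matrix.mul_apply, Fin.sum_univ_two]
    · linear_combination Y 0 0 * tY - hY
    · linear_combination Y 0 1 * tY
    · linear_combination Y 1 0 * tY
    · linear_combination Y 1 1 * tY - hY
  have h1 : Y * X = - (X * Y) - Y + θ • X + (l + θ) • 1 := by
    rw [← tY, ← tXY]
    have e : X 1 1 = -1 - X 0 0 := by linear_combination tX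
    ext i j
    fin_cases i <;> fin_cases j <;> simp [Matrix.mul_apply, Fin.sum_univ_two, e] <;> ring
  have h2 : Y * (X * Y) = 1 + X + l • Y := by
    rw [← mul_assoc, h1]
    simp only [add_mul, sub_mul, neg_mul, mul_assoc, h, Matrix.smul_mul, one_mul, mul_sub, Matrix.mul_smul, mul_one]
    module
  simp only [lin, mY, mul_add, Matrix.mul_smul, h, h1, h2, mul_one]
  module

lemma tt_tr (X Y : Matrix (Fin 2) (Fin 2) A) (θ l : A) (hX : X.det = 1) (tX : X.trace = -1) (hY : Y.det = 1)
    (tY : Y.trace = θ) (tXY : (X * Y).trace = l) (w) : (ev X Y w).trace = tt θ l w := by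
  have h : ev X Y w = lin X Y (tc θ l w) := by
    induction w with
    | nil => simp [tc, lin]
    | cons p w ih =>
      rw [ev_cons, ih, tc]
      have h1 : ∀ n v, Y ^ n * lin X Y v = lin X Y ((mY θ l)^[n] v) := by
        intro n
        induction n with
        | zero => simp
        | succ n ih => intro v; rw [pow_succ, mul_assoc, lin_Y X Y θ l hX tX hY tY tXY, ih]; rfl
      have h2 : ∀ n v, X ^ n * lin X Y v = lin X Y (mX^[n] v) := by
        intro n
        induction n with
        | zero => simp
        | succ n ih => intro v; rw [pow_succ, mul_assoc, lin_X X Y hX tX, ih]; rfl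
      rw [mul_assoc, h1, h2]
  rw [h, lin, tt]
  simp only [Matrix.trace_add, Matrix.trace_smul, tX, tY, tXY, Matrix.trace_one, Fintype.card_fin, smul_eq_mul]
  push_cast; ring
end tt

lemma sq_tr {A : Type*} [CommRing A] (Y : Matrix (Fin 2) (Fin 2) A) (hY : Y.det = 1) : Y * Y = Y.trace • Y - 1 := by
  rw [Matrix.det_fin_two] at hY
  rw [Matrix.trace_fin_two]
  ext i j
  fin_cases i <;> fin_cases j <;> simp [Matrix.mul_apply, Fin.sum_univ_two]
  · linear_combination - hY
  · ring
  · ring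
  · linear_combination - hY

lemma cube_one {A : Type*} [CommRing A] (Y : Matrix (Fin 2) (Fin 2) A) (hY : Y.det = 1) (h : Y.trace = -1) :
    Y ^ 3 = 1 := by
  have h2 := sq_tr Y hY
  rw [h] at h2
  rw [pow_succ, sq, h2, sub_mul, Matrix.smul_mul, h2]; simp

lemma five_one {A : Type*} [CommRing A] (Y : Matrix (Fin 2) (Fin 2) A) (hY : Y.det = 1) (t : A) (h : Y.trace = t)
    (ht : t ^ 2 + t - 1 = 0) : Y ^ 5 = 1 := by
  have h2 := sq_tr Y hY
  rw [h] at h2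
  have h3 : Y ^ 3 = (-t) • Y + (-t) • 1 := by
    rw [pow_succ, sq, h2, sub_mul, Matrix.smul_mul, h2, one_mul]
    have : t * t = 1 - t := by linear_combination ht
    rw [smul_sub, smul_smul, this]; module
  have e : Y ^ 5 = Y ^ 3 * (Y * Y) := by noncomm_ring
  rw [e, h3, h2]
  simp only [add_mul, mul_sub, Matrix.smul_mul, Matrix.mul_smul, h2, one_mul, mul_one]
  have e2 : (t ^ 2 + t) • (1 : Matrix (Fin 2) (Fin 2) A) = 1 := by
    rw [show t ^ 2 + t = 1 by linear_combination ht, one_smul]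
  have e3 : (t ^ 3 + t ^ 2 - t) • Y = 0 := by
    rw [show t ^ 3 + t ^ 2 - t = 0 by linear_combination t * ht, zero_smul]
  calc _ = (t ^ 2 + t) • (1 : Matrix (Fin 2) (Fin 2) A) - (t ^ 3 + t ^ 2 - t) • Y := by module
    _ = 1 := by rw [e2, e3, sub_zero]

/-- ring of integers of `ℚ(√5)` -/
abbrev RR := QuadraticAlgebra ℤ 1 (-1)
abbrev th : RR := ⟨0, 1⟩
lemma th_sq : th * th = 1 - th := by decide

def rlift {B : Type*} [CommRing B] (t : B) (h : t ^ 2 + t - 1 = 0) : RR →+* B :=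
  (QuadraticAlgebra.lift (R := ℤ) (A := B) (a := 1) (b := -1) ⟨t, by simp; linear_combination h⟩).toRingHom
lemma rlift_th {B : Type*} [CommRing B] (t : B) (h : t ^ 2 + t - 1 = 0) : rlift t h th = t := by
  simp [rlift]

open Polynomial in
noncomputable def tau (w : List (ℕ × ℕ)) : RR[X] := tt (C th) X w

open Polynomial in
lemma tau_eval {B : Type*} [CommRing B] (f : RR →+* B) (l : B) (w) : eval₂ f l (tau w) = tt (f th) l w := by
  have := tt_map (eval₂RingHom f l) (C th) X w
  simpa [tau] using this

open Polynomial in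
def Yp (n : ℕ) (v : RR[X] × RR[X] × RR[X] × RR[X]) (p q r s : RR) : Prop :=
  (∀ m, n + 2 ≤ m → v.1.coeff m = 0 ∧ v.2.2.1.coeff m = 0) ∧
  (∀ m, n + 1 ≤ m → v.2.1.coeff m = 0 ∧ v.2.2.2.coeff m = 0) ∧ v.1.coeff (n + 1) = p ∧
  v.2.2.1.coeff (n + 1) = q ∧ v.2.2.2.coeff n = r ∧ v.2.1.coeff n = s

open Polynomial in
lemma Yp_step {n v p q r s} (h : Yp n v p q r s) :
    Yp n (mY (C th) X v) (-q + s) (p + th * q + r) (-s) (th * s + r) := by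
  obtain ⟨h1, h2, h3, h4, h5, h6⟩ := h
  refine ⟨?_, ?_, ?_, ?_, ?_, ?_⟩
  · intro m hm
    obtain ⟨m, rfl⟩ : ∃ k, m = k + 1 := ⟨m - 1, by omega⟩
    have a1 := h1 (m + 1) hm
    have a2 := h2 (m + 1) (by omega)
    have a3 := h2 m (by omega)
    simp [mY, add_mul, coeff_X_mul, a1, a2, a3]
  · intro m hm
    have a2 := h2 m hm
    simp [mY, a2]
  all_goals
    have a2 := h2 (n + 1) le_rfl
    simp [mY, add_mul, coeff_X_mul, a2, h3, h4, h5, h6]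
  all_goals ring

open Polynomial in
def Xp (n : ℕ) (v : RR[X] × RR[X] × RR[X] × RR[X]) : Prop :=
  (∀ m, n < m → v.1.coeff m = 0 ∧ v.2.1.coeff m = 0 ∧ v.2.2.1.coeff m = 0 ∧ v.2.2.2.coeff m = 0) ∧
  IsUnit (v.2.2.2.coeff n)

open Polynomial in
lemma Xp_step {n v p q r s} (h : Yp n v p q r s) (hq : IsUnit q) : Xp (n + 1) (mX v) ∧ Xp (n + 1) (mX (mX v)) := by
  obtain ⟨h1, h2, h3, h4, h5, h6⟩ := h
  have a2 := h2 (n + 1) le_rfl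
  refine ⟨⟨?_, ?_⟩, ⟨?_, ?_⟩⟩
  · intro m hm
    have a1 := h1 m hm
    have a3 := h2 m (by omega)
    simp [mX, a1, a3]
  · simpa [mX, a2, h4]
  · intro m hm
    have a1 := h1 m hm
    have a3 := h2 m (by omega)
    simp [mX, a1, a3]
  · simpa [mX, a2, h4]

lemma th_unit : IsUnit th := IsUnit.of_mul_eq_one (th + 1) (by decide)

open Polynomial in
lemma Xp_cons {n v} (h : Xp n v) (p : ℕ × ℕ) (hp : (0 < p.1 ∧ p.1 < 3) ∧ (0 < p.2 ∧ p.2 < 5)) :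
    Xp (n + 1) (mX^[p.1] ((mY (C th) X)^[p.2] v)) := by
  obtain ⟨h1, h2⟩ := h
  have y0 : Yp n v 0 0 (v.2.2.2.coeff n) (v.2.1.coeff n) :=
    ⟨fun m hm => ⟨(h1 m (by omega)).1, (h1 m (by omega)).2.2.1⟩, fun m hm => ⟨(h1 m (by omega)).2.1, (h1 m (by omega)).2.2.2⟩,
     (h1 _ (by omega)).1, (h1 _ (by omega)).2.2.1, rfl, rfl⟩
  generalize v.2.2.2.coeff n = r at *
  generalize v.2.1.coeff n = s at *
  obtain ⟨a, b⟩ := p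
  obtain ⟨⟨ha, ha'⟩, hb, hb'⟩ := hp
  have y1 := Yp_step y0
  have y2 := Yp_step y1
  have y3 := Yp_step y2
  have y4 := Yp_step y3
  have key : ∃ p q r s, Yp n ((mY (C th) X)^[b] v) p q r s ∧ IsUnit q := by
    have t2 := th_sq
    simp only at hb hb'
    interval_cases b
    · refine ⟨_, _, _, _, y1, ?_⟩
      convert h2 using 1; ring
    · refine ⟨_, _, _, _, y2, ?_⟩
      convert th_unit.mul h2 using 1; ring
    · refine ⟨_, _, _, _, y3, ?_⟩
      convert (th_unit.mul h2).neg using 1; linear_combination r * t2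
    · refine ⟨_, _, _, _, y4, ?_⟩
      convert h2.neg using 1; linear_combination (r * th - r) * t2
  obtain ⟨p, q, r', s', hy, hq⟩ := key
  have := Xp_step hy hq
  simp only at ha ha'
  interval_cases a
  · exact this.1
  · exact this.2

open Polynomial in
lemma tc_deg (w : List (ℕ × ℕ)) (hw : ∀ p ∈ w, (0 < p.1 ∧ p.1 < 3) ∧ (0 < p.2 ∧ p.2 < 5)) (hne : w ≠ []) :
    Xp (w.length - 1) (tc (C th) X w) := by
  induction w with
  | nil => exact absurd rfl hne
  | cons p w ih =>
    by_cases h : w = []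
    · subst h
      have st : ∀ c d : RR, mY (C th) X (C c, 0, C d, 0) = (C (-d), 0, C (c + th * d), 0) := by
        intro c d; simp [mY]
      have e0 : ((1 : RR[X]), (0 : RR[X]), (0 : RR[X]), (0 : RR[X])) = (C 1, 0, C 0, 0) := by simp
      obtain ⟨⟨ha, ha'⟩, hb, hb'⟩ := hw p List.mem_cons_self
      obtain ⟨a, b⟩ := p
      simp only at ha ha' hb hb'
      obtain ⟨c, d, hy, hd⟩ : ∃ c d : RR, (mY (C th) X)^[b] (1, 0, 0, 0) = (C c, 0, C d, 0) ∧ IsUnit d := by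
        rw [e0]
        interval_cases b <;> simp only [Function.iterate_succ, Function.iterate_zero, Function.comp, st, id]
        · exact ⟨_, _, rfl, by simp⟩
        · exact ⟨_, _, rfl, by convert th_unit using 1; decide⟩
        · exact ⟨_, _, rfl, by convert th_unit.neg using 1; decide⟩
        · exact ⟨_, _, rfl, by convert (isUnit_one (M := RR)).neg using 1; decide⟩
      have hm : ∀ (m : ℕ) (c : RR), 0 < m → (C c).coeff m = 0 := fun m c h => coeff_C_ne_zero (by omega)
      simp only [tc, hy]
      interval_cases a
      · refine ⟨?_, ?_⟩
        · intro m h; simp [mX, hm m _ h]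
        · simpa [mX]
      · refine ⟨?_, ?_⟩
        · intro m h; simp [mX, hm m _ h]
        · simpa [mX]
    · have := Xp_cons (ih (fun q hq => hw q (List.mem_cons_of_mem _ hq)) h) p (hw p List.mem_cons_self)
      have e : (p :: w).length - 1 = w.length - 1 + 1 := by
        have := List.length_pos_of_ne_nil h
        simp; omega
      rw [e]; exact this

open Polynomial in
lemma tau_deg (w : List (ℕ × ℕ)) (hw : ∀ p ∈ w, (0 < p.1 ∧ p.1 < 3) ∧ (0 < p.2 ∧ p.2 < 5)) (hne : w ≠ []) :
    (tau w).natDegree = w.length ∧ IsUnit (tau w).leadingCoeff := by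
  obtain ⟨h1, h2⟩ := tc_deg w hw hne
  obtain ⟨n, hn⟩ : ∃ n, w.length = n + 1 := ⟨w.length - 1, by have := List.length_pos_of_ne_nil hne; omega⟩
  rw [hn, Nat.add_sub_cancel] at h1 h2
  have c1 : (tau w).coeff (n + 1) = (tc (C th) X w).2.2.2.coeff n := by
    have a1 := h1 (n + 1) (by omega)
    have e2 : (2 : RR[X]) = C 2 := rfl
    simp [tau, tt, coeff_X_mul, a1, e2]
  have d1 : (tau w).natDegree = n + 1 := by
    apply le_antisymm
    · rw [natDegree_le_iff_coeff_eq_zero]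
      intro m hm
      obtain ⟨m, rfl⟩ : ∃ k, m = k + 1 := ⟨m - 1, by omega⟩
      have a1 := h1 (m + 1) (by omega)
      have a2 := h1 m (by omega)
      have e2 : (2 : RR[X]) = C 2 := rfl
      simp [tau, tt, coeff_X_mul, a1, a2, e2]
    · apply le_natDegree_of_ne_zero
      rw [c1]; exact h2.ne_zero
  refine ⟨by rw [d1, hn], ?_⟩
  rw [leadingCoeff, d1, c1]; exact h2

end

section
def lam : Fin 4 → RR := ![0, 1, -th - 1, -th]

local instance fact5 : Fact (Nat.Prime 5) := ⟨by norm_num⟩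
local instance fact2 : Fact (Nat.Prime 2) := ⟨Nat.prime_two⟩

lemma padic_disc (t : (PadicAlgCl 2)ˣ) : ∃ N : ℕ, 0 < N ∧ ∃ β : ℤ, ‖(t : PadicAlgCl 2)‖ ^ N = 2 ^ β := by
  have h := spectralNorm.spectralNorm_eq_norm_coeff_zero_rpow (K := ℚ_[2]) (L := PadicAlgCl 2) (t : PadicAlgCl 2)
  rw [PadicAlgCl.spectralNorm_eq] at h
  have hi : IsIntegral ℚ_[2] (t : PadicAlgCl 2) := (Algebra.IsAlgebraic.isAlgebraic _).isIntegral
  have hd := minpoly.natDegree_pos hi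
  have hc : (minpoly ℚ_[2] (t : PadicAlgCl 2)).coeff 0 ≠ 0 := minpoly.coeff_zero_ne_zero hi t.ne_zero
  refine ⟨_, hd, ?_⟩
  rw [h, ← Real.rpow_natCast, ← Real.rpow_mul (norm_nonneg _), one_div, inv_mul_cancel₀ (by positivity), Real.rpow_one]
  exact ⟨_, by exact_mod_cast Padic.norm_eq_zpow_neg_valuation hc⟩

open Polynomial in
theorem B2 (w) (j : Fin 4) (h : (X - C (lam j)) ^ 2 ∣ tau w) : Good w := by
  obtain ⟨z, hz⟩ := IsAlgClosed.exists_root (cyclotomic 5 (PadicAlgCl 2)) (by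
    rw [degree_cyclotomic]; decide)
  have hz4 : z ^ 4 + z ^ 3 + z ^ 2 + z + 1 = 0 := by
    rw [IsRoot.def, cyclotomic_prime] at hz
    simp [Finset.sum_range_succ] at hz
    linear_combination hz
  have hz0 : z ≠ 0 := by rintro rfl; simp at hz4
  have hz5 : z ^ 5 = 1 := by linear_combination (z - 1) * hz4
  obtain ⟨ζ, rfl⟩ : ∃ ζ : (PadicAlgCl 2)ˣ, (ζ : PadicAlgCl 2) = z := ⟨Units.mk0 z hz0, rfl⟩
  have hq : ‖((Units.mk0 (2 : PadicAlgCl 2) two_ne_zero : (PadicAlgCl 2)ˣ) : PadicAlgCl 2)‖ = 2⁻¹ := by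
    have := PadicAlgCl.norm_extends 2 2
    rw [Units.val_mk0]
    rw [map_ofNat] at this
    rw [this]
    exact_mod_cast Padic.norm_p (p := 2)
  have hB := B1 ζ hz4 _ hq padic_disc
  set K := PadicAlgCl 2
  have ht1 : ((ζ : K) ^ 2 + (ζ : K) ^ 3) ^ 2 + ((ζ : K) ^ 2 + (ζ : K) ^ 3) - 1 = 0 := by
    linear_combination hz4 + ((ζ : K) + 2) * hz5 - (ζ : K) * 0 - 2 + 2
  have ht2 : ((ζ : K) + (ζ : K) ^ 4) ^ 2 + ((ζ : K) + (ζ : K) ^ 4) - 1 = 0 := by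
    linear_combination hz4 + ((ζ : K) ^ 3 + 2) * hz5
  have hYm : mA ζ false = !![(ζ : K) ^ 3, 1; 0, (ζ : K) ^ 2] := by
    ext i j; fin_cases i <;> fin_cases j <;> simp [mA, zM, dA, zv, dY]
  have hXm : mA ζ true = !![0, -(ζ : K) ^ 3; (ζ : K) ^ 2, -1] := by
    ext i j; fin_cases i <;> fin_cases j <;> simp [mA, zM, dA, zv, dX]
  have hu := trU ζ hz4 true
  set U := mU ζ true
  have xd : (dm (mA ζ true) (U * mA ζ true)).det = 1 := dm_det _ _ (mdet ζ hz4 true) hu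
  have yd0 : (dm (mA ζ false) 0).det = 1 := by
    have := dm_det (mA ζ false) 0 (mdet ζ hz4 false) (by simp)
    rwa [zero_mul] at this
  have xt : (dm (mA ζ true) (U * mA ζ true)).trace = -1 := by
    have hA : (mA ζ true).trace = -1 := by rw [hXm]; simp [Matrix.trace_fin_two]
    have hU : (U * mA ζ true).trace = 0 := by
      simp only [U, mU, cond_true, sub_mul, mul_assoc, (mAA ζ hz4 true).2, mul_one, Matrix.trace_sub]
      rw [Matrix.trace_mul_comm, sub_self]
    rw [dm_tr, hA, hU]; simp
  have yt0 : (dm (mA ζ false) 0).trace = TrivSqZeroExt.inl ((ζ : K) ^ 2 + (ζ : K) ^ 3) := by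
    rw [dm_tr, hYm]; simp [Matrix.trace_fin_two]; ring
  have yp : ∀ n : ℕ, (dm (mA ζ false) 0) ^ n = dm (mA ζ false ^ n) 0 := by
    intro n
    induction n with
    | zero => simp [dm_one]
    | succ n ih => rw [pow_succ, ih, dm_mul, pow_succ]; simp
  have key : ∀ (n : ℕ) (t : K) (ht : t ^ 2 + t - 1 = 0) (yt : (mA ζ false ^ n).trace = t)
     (hl : (mA ζ true * mA ζ false ^ n).trace = rlift t ht (lam j)),
     (ev (dm (mA ζ true) (U * mA ζ true)) (dm (mA ζ false) 0 ^ n) w).trace = 0 := by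
    intro n t ht yt hl
    obtain ⟨g, hg⟩ := h
    let f : RR →+* DualNumber K := (algebraMap K (DualNumber K)).comp (rlift t ht)
    have hft : f th = TrivSqZeroExt.inl t := by simp [f, rlift_th]; rfl
    rw [tt_tr _ _ (f th) _ xd xt (by rw [Matrix.det_pow, yd0, one_pow])
      (by rw [yp, dm_tr, yt, hft]; simp) rfl, ← tau_eval f, hg, eval₂_mul, eval₂_pow, eval₂_sub, eval₂_X, eval₂_C]
    rw [yp, dm_mul, dm_tr, hl]
    have : f (lam j) = TrivSqZeroExt.inl (rlift t ht (lam j)) := rfl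
    rw [this, add_sub_cancel_left, sq]
    simp [TrivSqZeroExt.inr_mul_inr]
  have xe3 : (dm (mA ζ true) (U * mA ζ true)) ^ 3 = 1 := cube_one _ xd xt
  have y5 : (dm (mA ζ false) 0) ^ 5 = 1 := by
    refine five_one _ yd0 _ yt0 ?_
    change (algebraMap K (DualNumber K) _) ^ 2 + (algebraMap K (DualNumber K) _) - 1 = 0
    rw [← map_pow, ← map_add, ← map_one (algebraMap K (DualNumber K)), ← map_sub]
    exact (congrArg (algebraMap K (DualNumber K)) ht1).trans (map_zero _)
  have fin : ∀ n n' : ℕ, n * n' % 5 = 1 → (ev (dm (mA ζ true) (U * mA ζ true)) (dm (mA ζ false) 0 ^ n) w).trace = 0 → Good w := by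
    intro n n' hn hh
    refine good_tw 1 n 1 n' (by norm_num) hn (hB _ ?_)
    rw [ev_tw xe3 y5, pow_one]; exact hh
  have m2 : mA ζ false ^ 2 = !![(ζ : K), (ζ : K) ^ 3 + (ζ : K) ^ 2; 0, (ζ : K) ^ 4] := by
    rw [hYm, sq, Matrix.mul_fin_two]
    congr 1
    ext i j; fin_cases i <;> fin_cases j <;> simp
    · linear_combination (ζ : K) * hz5
    · ring
  fin_cases j
  · refine fin 1 1 (by norm_num) (key 1 (ζ ^ 2 + ζ ^ 3) ht1 ?_ ?_)
    · rw [pow_one, hYm]; simp [Matrix.trace_fin_two]; ring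
    · rw [pow_one, hYm, hXm, Matrix.mul_fin_two]; simp [Matrix.trace_fin_two, lam]
  · refine fin 2 3 (by norm_num) (key 2 (ζ + ζ ^ 4) ht2 ?_ ?_)
    · rw [m2]; simp [Matrix.trace_fin_two]
    · rw [m2, hXm, Matrix.mul_fin_two]; simp [Matrix.trace_fin_two, lam]
      linear_combination hz5
  · refine fin 3 2 (by norm_num) (key 3 (ζ + ζ ^ 4) ht2 ?_ ?_)
    · rw [pow_succ, m2, hYm, Matrix.mul_fin_two]; simp [Matrix.trace_fin_two]
      linear_combination (ζ : K) * hz5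
    · rw [pow_succ, m2, hYm, hXm, Matrix.mul_fin_two, Matrix.mul_fin_two]
      simp only [lam, map_sub, map_neg, rlift_th, map_one, Matrix.trace_fin_two, Matrix.cons_val, Matrix.of_apply, Fin.reduceFinMk, Matrix.cons_val', Matrix.cons_val_zero, Matrix.cons_val_one]
      linear_combination hz4 + (ζ : K) ^ 2 * hz5
  · have m4 : mA ζ false ^ 4 = mA ζ false ^ 2 * mA ζ false ^ 2 := by rw [← pow_add]
    refine fin 4 4 (by norm_num) (key 4 (ζ ^ 2 + ζ ^ 3) ht1 ?_ ?_)
    · rw [m4, m2, Matrix.mul_fin_two]; simp [Matrix.trace_fin_two]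
      linear_combination (ζ : K) ^ 3 * hz5
    · rw [m4, m2, hXm, Matrix.mul_fin_two, Matrix.mul_fin_two]
      simp only [lam, map_sub, map_neg, rlift_th, map_one, Matrix.trace_fin_two, Matrix.cons_val, Matrix.of_apply, Fin.reduceFinMk, Matrix.cons_val', Matrix.cons_val_zero, Matrix.cons_val_one]
      linear_combination hz4 + (1 + (ζ : K) + (ζ : K) ^ 4) * hz5

end

section
lemma ppi_neg : ppi (-1) = 1 := by
  ext p
  change (-1 : SL2) • p = p
  have h := Projectivization.mk_eq_mk_iff' ℂ ((-1 : SL2) • p.rep) p.rep ((smul_ne_zero_iff_ne _).mpr p.rep_nonzero) p.rep_nonzero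
  have e : (-1 : SL2) • p = Projectivization.mk ℂ ((-1 : SL2) • p.rep) ((smul_ne_zero_iff_ne _).mpr p.rep_nonzero) := by
    conv_lhs => rw [← p.mk_rep]
    rfl
  rw [e]
  conv_rhs => rw [← p.mk_rep]
  rw [h]
  refine ⟨-1, ?_⟩
  ext i
  fin_cases i
  · simp [sl_smul0]
  · simp [sl_smul1]

lemma trc_eq (A : SL2) : A.1.trace = trc A := Matrix.trace_fin_two _

lemma ppi2 (A : SL2) (h : trc A = 0) : ppi A ^ 2 = 1 := by
  have : A ^ 2 = -1 := by
    apply Subtype.ext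
    have := ch2 A.1 A.2 (by rw [trc_eq, h])
    simpa [sq] using this
  rw [← map_pow, this, ppi_neg]
lemma sl3 (A : SL2) (h : trc A = -1) : A ^ 3 = 1 := by
  apply Subtype.ext
  have := cube_one A.1 A.2 (by rw [trc_eq, h])
  simpa using this
lemma sl5 (A : SL2) (t : ℂ) (h : trc A = t) (ht : t ^ 2 + t - 1 = 0) : A ^ 5 = 1 := by
  apply Subtype.ext
  have := five_one A.1 A.2 t (by rw [trc_eq, h]) ht
  simpa using this
lemma ppi3 (A : SL2) (h : trc A = -1) : ppi A ^ 3 = 1 := by rw [← map_pow, sl3 A h, map_one]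
lemma ppi5 (A : SL2) (t : ℂ) (h : trc A = t) (ht : t ^ 2 + t - 1 = 0) : ppi A ^ 5 = 1 := by
  rw [← map_pow, sl5 A t h ht, map_one]
lemma ppi_negA (A : SL2) : ppi (-A) = ppi A := by
  rw [← neg_one_mul, map_mul, ppi_neg, one_mul]
lemma ppi5' (A : SL2) (t : ℂ) (h : trc A = t) (ht : t ^ 2 - t - 1 = 0) : ppi A ^ 5 = 1 := by
  rw [← ppi_negA]
  refine ppi5 _ (-t) ?_ (by linear_combination ht)
  rw [← h]; simp [trc]; ring

lemma trc_inv (A : SL2) : trc A⁻¹ = trc A := by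
  simp [trc, Matrix.SpecialLinearGroup.coe_inv, Matrix.adjugate_fin_two]; ring

lemma good_sl (X Y : SL2) (θ l : ℂ) (w) (hθ : θ ^ 2 + θ - 1 = 0) (hX : trc X = -1) (hY : trc Y = θ) (hXY : trc (X * Y) = l)
    (hw : tt θ l w = 0) (P Q : SL2) (hP : P ∈ Subgroup.closure {X, Y}) (hQ : Q ∈ Subgroup.closure {X, Y})
    (hf : Free2 (ppi P) (ppi Q)) : Good w := by
  refine ⟨_, _, ppi X, ppi Y, ppi3 X hX, ppi5 Y θ hY hθ, ?_, ppi P, ?_, ppi Q, ?_, hf⟩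
  · rw [← ev_map]
    apply ppi2
    rw [← trc_eq]
    have e : (ev X Y w).1 = ev X.1 Y.1 w :=
      ev_map (⟨⟨Subtype.val, rfl⟩, fun _ _ => rfl⟩ : SL2 →* Matrix (Fin 2) (Fin 2) ℂ) X Y w
    rw [e, tt_tr X.1 Y.1 θ l X.2 (by rw [trc_eq, hX]) Y.2 (by rw [trc_eq, hY]) (by rw [← hXY, ← trc_eq]; rfl), hw]
  all_goals
    have e : Subgroup.closure {ppi X, ppi Y} = (Subgroup.closure {X, Y}).map ppi := by
      rw [MonoidHom.map_closure]; simp [Set.image_pair]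
    rw [e]
  · exact Subgroup.mem_map_of_mem _ hP
  · exact Subgroup.mem_map_of_mem _ hQ

lemma trc_comm (X Y : SL2) (θ l : ℂ) (hX : trc X = -1) (hY : trc Y = θ) (hXY : trc (X * Y) = l) :
    trc (X * (Y * X⁻¹ * Y⁻¹)) = l ^ 2 + θ * l + θ ^ 2 - 1 := by
  have dX := sl_det X
  have dY := sl_det Y
  simp only [trc, sl_mul_apply] at *
  simp [Matrix.SpecialLinearGroup.coe_inv, Matrix.adjugate_fin_two]
  rw [← hY, ← hXY]
  linear_combination (X 0 0 + X 1 1) ^ 2 * dY + (X 0 0 + X 1 1 - 1) * hX + (Y 0 0 + Y 1 1) ^ 2 * dX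
    - (Y 0 0 + Y 1 1) * (X 0 0 * Y 0 0 + X 0 1 * Y 1 0 + (X 1 0 * Y 0 1 + X 1 1 * Y 1 1)) * hX
    - 2 * ((X 0 0 * X 1 1 - X 0 1 * X 1 0) * dY + dX)

lemma exists_z (θ : ℂ) (hθ : θ ^ 2 + θ - 1 = 0) : ∃ e e' o o' : ℂ, e + e' = θ ∧ e * e' = 1 ∧ o + o' = -1 ∧ o * o' = 1 := by
  have q : ∀ t : ℂ, ∃ e e' : ℂ, e + e' = t ∧ e * e' = 1 := by
    intro t
    obtain ⟨s, hs⟩ := IsAlgClosed.exists_pow_nat_eq (t ^ 2 - 4) (n := 2) (by norm_num)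
    exact ⟨(t + s) / 2, (t - s) / 2, by ring, by linear_combination - hs / 4⟩
  obtain ⟨e, e', h1, h2⟩ := q θ
  obtain ⟨o, o', h3, h4⟩ := q (-1)
  exact ⟨e, e', o, o', h1, h2, h3, h4⟩

lemma ev_diag (a b c d : ℂ) (w) : ev !![a, 0; 0, b] !![c, 0; 0, d] w = !![ev a c w, 0; 0, ev b d w] := by
  have hp : ∀ (a b : ℂ) (n : ℕ), !![a, 0; 0, b] ^ n = !![a ^ n, 0; 0, b ^ n] := by
    intro a b n
    induction n with
    | zero => simp [Matrix.one_fin_two]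
    | succ n ih => rw [pow_succ, ih, Matrix.mul_fin_two]; simp [pow_succ]
  induction w with
  | nil => simp [Matrix.one_fin_two]
  | cons p w ih => rw [ev_cons, ih, hp, hp, ev_cons, ev_cons]; simp [Matrix.mul_fin_two, mul_assoc]
lemma ev_mulc (a b c d : ℂ) (w) : ev a c w * ev b d w = ev (a * b) (c * d) w := by
  induction w with
  | nil => simp
  | cons p w ih => rw [ev_cons, ev_cons, ev_cons, ← ih, mul_pow, mul_pow]; ring
lemma ev_powc (a c : ℂ) (w) (n : ℕ) : ev a c w ^ n = ev (a ^ n) (c ^ n) w := by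
  induction n with
  | zero =>
    simp only [pow_zero]
    induction w with
    | nil => simp
    | cons p w ih => rw [ev_cons, ← ih]; simp
  | succ n ih => rw [pow_succ, ih, ev_mulc, ← pow_succ, ← pow_succ]
lemma no_red0 (θ l o o' e e' : ℂ) (w) (hθ : θ ^ 2 + θ - 1 = 0) (hw : tt θ l w = 0) (h3 : o + o' = -1) (h4 : o * o' = 1)
    (h1 : e + e' = θ) (h2 : e * e' = 1) (h : l = o * e + o' * e') : False := by
  have h5 : e ^ 5 = 1 := by
    have h0 : e ^ 2 = θ * e - 1 := by linear_combination e * h1 - h2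
    have a3 : e ^ 3 = -θ * e - θ := by linear_combination (e + θ) * h0 + e * hθ
    linear_combination e ^ 2 * a3 - θ * (e + 1) * h0 - θ ^ 2 * h0 + (1 - θ * e) * hθ
  have h6 : o ^ 3 = 1 := by linear_combination (o - 1) * (o * h3 - h4)
  have t1 := tt_tr !![o, 0; 0, o'] !![e, 0; 0, e'] θ l (by simp [h4]) (by simp [Matrix.trace_fin_two, h3])
      (by simp [h2]) (by simp [Matrix.trace_fin_two, h1]) (by simp [Matrix.mul_fin_two, Matrix.trace_fin_two, h]) w
  rw [ev_diag, hw, Matrix.trace_fin_two] at t1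
  simp at t1
  have e1 : ev (1 : ℂ) 1 w = 1 := by have := ev_powc 1 1 w 0; simp only [pow_zero] at this; exact this.symm
  have t3 : ev o e w ^ 15 = 1 := by
    have a1 : o ^ 15 = 1 := by have : o ^ 15 = (o ^ 3) ^ 5 := by ring
                               rw [this, h6, one_pow]
    have a2 : e ^ 15 = 1 := by have : e ^ 15 = (e ^ 5) ^ 3 := by ring
                               rw [this, h5, one_pow]
    rw [ev_powc, a1, a2, e1]
  have t4 : ev o e w * ev o' e' w = 1 := by rw [ev_mulc, h4, h2, e1]
  have t5 : ev o e w ^ 2 = -1 := by linear_combination ev o e w * t1 - t4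
  have : (ev o e w ^ 2) ^ 15 = 1 := by rw [← pow_mul, mul_comm, pow_mul, t3, one_pow]
  rw [t5] at this; norm_num at this

lemma no_red (θ l : ℂ) (w) (hθ : θ ^ 2 + θ - 1 = 0) (hw : tt θ l w = 0) : l ^ 2 + θ * l - θ ≠ 2 := by
  intro hl
  obtain ⟨e, e', o, o', h1, h2, h3, h4⟩ := exists_z θ hθ
  have : (l - (o * e + o' * e')) * (l - (o * e' + o' * e)) = 0 := by
    have : (l - (o * e + o' * e')) * (l - (o * e' + o' * e)) = l ^ 2 - l * (o + o') * (e + e') +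
      ((o + o') ^ 2 - 2 * (o * o')) * (e * e') + (o * o') * ((e + e') ^ 2 - 2 * (e * e')) := by ring
    rw [this, h1, h2, h3, h4]; linear_combination hl + hθ
  rcases mul_eq_zero.mp this with h | h
  · exact no_red0 θ l o o' e e' w hθ hw h3 h4 h1 h2 (by linear_combination h)
  · exact no_red0 θ l o o' e' e w hθ hw h3 h4 (by rw [add_comm, h1]) (by rw [mul_comm, h2]) (by linear_combination h)

lemma root_good (θ : ℝ) (hθ : θ ^ 2 + θ - 1 = 0) (l : ℂ) (w) (h : tt (θ : ℂ) l w = 0) :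
    Good w ∨ ∃ r : ℝ, l = r ∧ r ^ 2 + θ * r - θ < 2 := by
  have hc : (θ : ℂ) ^ 2 + θ - 1 = 0 := by exact_mod_cast hθ
  have hred := no_red θ l w hc h
  obtain ⟨X, Y, hX, hY, hXY⟩ : ∃ X Y : SL2, trc X = -1 ∧ trc Y = θ ∧ trc (X * Y) = l := by
    obtain ⟨e, e', o, o', h1, h2, h3, h4⟩ := exists_z θ hc
    refine ⟨⟨!![o, 1; 0, o'], by rw [Matrix.det_fin_two]; simp [h4]⟩,
      ⟨!![e, 0; l - o * e - o' * e', e'], by rw [Matrix.det_fin_two]; simp [h2]⟩, ?_, ?_, ?_⟩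
    · simpa [trc]
    · simpa [trc]
    · rw [← trc_eq]
      change (!![o, 1; 0, o'] * !![e, 0; l - o * e - o' * e', e']).trace = l
      rw [Matrix.mul_fin_two, Matrix.trace_fin_two]; simp; ring
  have mX : X ∈ Subgroup.closure {X, Y} := Subgroup.subset_closure (by simp)
  have mY : Y ∈ Subgroup.closure {X, Y} := Subgroup.subset_closure (by simp)
  have mem : ∀ (P Q : SL2), P ∈ Subgroup.closure {X, Y} → Q ∈ Subgroup.closure {X, Y} →
      (∃ n, Free2 (ppi ((P * Q) ^ n)) (ppi (P * (P * Q) ^ n * P⁻¹))) → Good w := by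
    rintro P Q hP hQ ⟨n, hn⟩
    have := pow_mem (mul_mem hP hQ) n
    exact good_sl X Y θ l w hc hX hY hXY h _ _ this (mul_mem (mul_mem hP this) (inv_mem hP)) hn
  set t := l ^ 2 + θ * l - θ with ht
  by_cases h1 : ∀ c : ℝ, 0 ≤ c → c ≤ 4 → t ^ 2 ≠ c
  · left
    refine mem X (Y * X⁻¹ * Y⁻¹) mX (mul_mem (mul_mem mY (inv_mem mX)) (inv_mem mY))
      (pp_tr _ _ (-1) (-1) t hX ?_ ?_ h1 ?_ ?_)
    · have : trc (Y * X⁻¹ * Y⁻¹) = trc X⁻¹ := by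
        rw [← trc_eq, ← trc_eq]
        have : (Y * X⁻¹ * Y⁻¹).1 = Y.1 * (X⁻¹).1 * (Y⁻¹).1 := rfl
        rw [this, Matrix.trace_mul_comm, ← mul_assoc]
        have e : (Y⁻¹).1 * Y.1 = 1 := by
          have := congrArg Subtype.val (inv_mul_cancel Y); exact this
        rw [e, one_mul]
      rw [this, trc_inv, hX]
    · rw [trc_comm X Y θ l hX hY hXY]; linear_combination hc
    · intro h0
      have : (t - 2) * (t + 1) = 0 := by linear_combination h0
      rcases mul_eq_zero.mp this with h | h
      · exact hred (by linear_combination h)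
      · exact h1 1 (by norm_num) (by norm_num) (by push_cast; linear_combination (t - 1) * h)
    · intro h0
      exact hred (by linear_combination -h0)
  · push Not at h1
    obtain ⟨c, hc0, hc4, htc⟩ := h1
    have tre : ∃ s : ℝ, t = s ∧ s ^ 2 ≤ 4 := by
      have : t = (Real.sqrt c : ℝ) ∨ t = -(Real.sqrt c : ℝ) := by
        apply sq_eq_sq_iff_eq_or_eq_neg.mp
        rw [htc]; norm_cast; rw [Real.sq_sqrt hc0]
      rcases this with h | h
      · exact ⟨_, h, by rw [Real.sq_sqrt hc0]; exact hc4⟩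
      · exact ⟨-Real.sqrt c, by rw [h]; push_cast; rfl, by rw [neg_sq, Real.sq_sqrt hc0]; exact hc4⟩
    obtain ⟨s, hs, hs4⟩ := tre
    by_cases hl : l.im = 0
    · right
      refine ⟨l.re, by apply Complex.ext <;> simp [hl], ?_⟩
      have hl' : l = (l.re : ℂ) := by apply Complex.ext <;> simp [hl]
      have : l.re ^ 2 + θ * l.re - θ = s := by
        have := hs; rw [ht, hl'] at this; exact_mod_cast this
      rw [this]
      apply lt_of_le_of_ne
      · nlinarith
      · intro h2; apply hred; rw [hs, h2]; norm_num
    · left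
      have θ0 : θ ≠ 0 := by rintro rfl; norm_num at hθ
      refine mem X Y mX mY (pp_tr _ _ (-1) θ l hX hY hXY ?_ ?_ ?_)
      · intro c hc0 _ hlc
        have : l = (Real.sqrt c : ℝ) ∨ l = -(Real.sqrt c : ℝ) := by
          apply sq_eq_sq_iff_eq_or_eq_neg.mp
          rw [hlc]; norm_cast; rw [Real.sq_sqrt hc0]
        rcases this with h | h <;> rw [h] at hl <;> simp at hl
      · intro h0
        exact hred (by linear_combination h0 - hc)
      · intro h0
        have := congrArg Complex.im h0
        simp [sq] at this
        tauto

end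

section
open Polynomial

lemma root_bd (θ r : ℝ) (hθ : θ ^ 2 + θ - 1 = 0) (h : r ^ 2 + θ * r - θ < 2) :
    |r * (r - 1) * (r + θ + 1) * (r + θ)| < 2 + θ := by
  have h0 : -2 < θ ∧ θ < 1 := by constructor <;> nlinarith
  obtain ⟨t, ht⟩ : ∃ t, t = r ^ 2 + θ * r - θ := ⟨_, rfl⟩
  have e : r * (r - 1) * (r + θ + 1) * (r + θ) = (t + θ) * (t - 1) := by rw [ht]; ring
  rw [e, abs_lt]
  rw [← ht] at h
  have h1 : -1 - θ < t := by nlinarith [sq_nonneg (r + θ / 2)]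
  constructor
  · nlinarith [sq_nonneg (2 * t + θ - 1)]
  · nlinarith [mul_pos (sub_pos.mpr h) (sub_pos.mpr h1)]

lemma mprod (s : Multiset ℂ) (g : ℂ → ℝ) (c : ℝ) (hc : 0 < c) (h : ∀ r ∈ s, 0 ≤ g r ∧ g r < c) :
    0 ≤ (s.map g).prod ∧ (s.map g).prod ≤ c ^ s.card ∧ (s ≠ 0 → (s.map g).prod < c ^ s.card) := by
  induction s using Multiset.induction with
  | empty => simp
  | cons a s ih =>
    obtain ⟨i1, i2, -⟩ := ih fun r hr => h r (Multiset.mem_cons_of_mem hr)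
    obtain ⟨a1, a2⟩ := h a (Multiset.mem_cons_self a s)
    have : g a * (s.map g).prod < c ^ s.card * c := by
      have := pow_pos hc s.card
      nlinarith
    rw [Multiset.map_cons, Multiset.prod_cons, Multiset.card_cons, pow_succ]
    exact ⟨mul_nonneg a1 i1, this.le, fun _ => this⟩

lemma emb_bd (f : RR →+* ℂ) (θ : ℝ) (hθ : θ ^ 2 + θ - 1 = 0) (hf : f th = θ) (p : RR[X]) (u : IsUnit p.leadingCoeff)
    (hp : ∀ l : ℂ, eval₂ f l p = 0 → ∃ r : ℝ, l = r ∧ r ^ 2 + θ * r - θ < 2) (hd : 0 < p.natDegree) :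
    ‖f (∏ i, p.eval (lam i))‖ < ‖f p.leadingCoeff‖ ^ 4 * (2 + θ) ^ p.natDegree := by
  have u' : f p.leadingCoeff ≠ 0 := (u.map f).ne_zero
  have hsp : (p.map f).Splits := IsAlgClosed.splits _
  have hnd : (p.map f).natDegree = p.natDegree := natDegree_map_of_leadingCoeff_ne_zero f u'
  have hlc : (p.map f).leadingCoeff = f p.leadingCoeff := leadingCoeff_map_of_leadingCoeff_ne_zero f u'
  have hcard : (p.map f).roots.card = p.natDegree := by rw [← hnd, hsp.natDegree_eq_card_roots]
  have hev : ∀ x, f (p.eval x) = f p.leadingCoeff * ((p.map f).roots.map (fun r => f x - r)).prod := by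
    intro x
    rw [← eval_map_apply, hsp.eval_eq_prod_roots, hlc]
  have h2 : (0:ℝ) < 2 + θ := by nlinarith
  have key := mprod (p.map f).roots (fun r => ‖(f (lam 0) - r) * (f (lam 1) - r) * (f (lam 2) - r) * (f (lam 3) - r)‖) (2 + θ) h2 (by
    intro l hl
    refine ⟨norm_nonneg _, ?_⟩
    have hl' := (mem_roots'.mp hl).2
    rw [IsRoot, eval_map] at hl'
    obtain ⟨r, rfl, hr⟩ := hp l hl'
    have := root_bd θ r hθ hr
    have e : (f (lam 0) - r) * (f (lam 1) - r) * (f (lam 2) - r) * (f (lam 3) - r) = ((r * (r - 1) * (r + θ + 1) * (r + θ) : ℝ) : ℂ) := by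
      simp only [lam, Matrix.cons_val, map_sub, map_neg, hf, map_one, map_zero]; push_cast; ring
    rw [e, Complex.norm_real]; exact this)
  have k3 := key.2.2 (by rw [← Multiset.card_pos, hcard]; exact hd)
  rw [hcard] at k3
  have e : ‖f (∏ i, p.eval (lam i))‖ = ‖f p.leadingCoeff‖ ^ 4 * ((p.map f).roots.map (fun r => ‖(f (lam 0) - r) * (f (lam 1) - r) * (f (lam 2) - r) * (f (lam 3) - r)‖)).prod := by
    rw [map_prod, Fin.prod_univ_four, hev, hev, hev, hev]
    have : ((p.map f).roots.map (fun r => ‖(f (lam 0) - r) * (f (lam 1) - r) * (f (lam 2) - r) * (f (lam 3) - r)‖)).prod =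
       ‖((p.map f).roots.map (fun r => (f (lam 0) - r) * (f (lam 1) - r) * (f (lam 2) - r) * (f (lam 3) - r))).prod‖ := by
      induction (p.map f).roots using Multiset.induction with
      | empty => simp
      | cons a s ih => rw [Multiset.map_cons, Multiset.prod_cons, ih, ← norm_mul, Multiset.map_cons, Multiset.prod_cons]
    rw [this, Multiset.prod_map_mul, Multiset.prod_map_mul, Multiset.prod_map_mul]
    simp only [norm_mul]; ring
  rw [e]
  exact mul_lt_mul_of_pos_left k3 (by positivity)

lemma nrm_ge (θ1 θ2 : ℝ) (hs : θ1 + θ2 = -1) (hp : θ1 * θ2 = -1) (h1 : Irrational θ1) (h2 : Irrational θ2)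
    (f1 f2 : RR →+* ℂ) (e1 : f1 th = θ1) (e2 : f2 th = θ2) (x : RR) (hx : x ≠ 0) : 1 ≤ ‖f1 x‖ * ‖f2 x‖ := by
  have form : ∀ (f : RR →+* ℂ) (θ : ℝ), f th = θ → f x = ((x.re + x.im * θ : ℝ) : ℂ) := by
    intro f θ hf
    have : x = (x.re : RR) + (x.im : RR) * th := by
      ext <;> simp [th]
    rw [this, map_add, map_mul, hf]; simp [th]
  have nz : ∀ θ : ℝ, Irrational θ → (x.re + x.im * θ : ℝ) ≠ 0 := by
    intro θ hθ h
    by_cases hi : x.im = 0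
    · apply hx; ext
      · rw [hi] at h; simpa using h
      · exact hi
    · apply hθ
      refine ⟨-x.re / x.im, ?_⟩
      have : (x.im : ℝ) ≠ 0 := by exact_mod_cast hi
      push_cast; field_simp; linear_combination -h
  rw [← norm_mul, form f1 θ1 e1, form f2 θ2 e2, ← Complex.ofReal_mul, Complex.norm_real]
  have e : (x.re + x.im * θ1 : ℝ) * (x.re + x.im * θ2) = ((x.re ^ 2 - x.re * x.im - x.im ^ 2 : ℤ) : ℝ) := by
    push_cast; linear_combination (x.re * x.im : ℝ) * hs + (x.im ^ 2 : ℝ) * hp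
  have n0 := mul_ne_zero (nz θ1 h1) (nz θ2 h2)
  rw [e] at n0 ⊢
  rw [Real.norm_eq_abs]
  exact_mod_cast Int.one_le_abs (by exact_mod_cast n0)

lemma factor (θ1 θ2 : ℝ) (hs : θ1 + θ2 = -1) (hp : θ1 * θ2 = -1) (h1 : Irrational θ1) (h2 : Irrational θ2)
    (f1 f2 : RR →+* ℂ) (e1 : f1 th = θ1) (e2 : f2 th = θ2) (n : ℕ) : ∀ (p : RR[X]), p.natDegree = n → IsUnit p.leadingCoeff →
    (∀ l : ℂ, eval₂ f1 l p = 0 → ∃ r : ℝ, l = r ∧ r ^ 2 + θ1 * r - θ1 < 2) →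
    (∀ l : ℂ, eval₂ f2 l p = 0 → ∃ r : ℝ, l = r ∧ r ^ 2 + θ2 * r - θ2 < 2) →
    ∃ (L : List (Fin 4)) (c : RR), IsUnit c ∧ L.length = n ∧ p = C c * (L.map fun i => X - C (lam i)).prod := by
  induction n with
  | zero =>
    intro p hd hu _ _
    rw [eq_C_of_natDegree_eq_zero hd] at hu ⊢
    rw [leadingCoeff_C] at hu
    exact ⟨[], _, hu, rfl, by simp⟩
  | succ n ih =>
    intro p hd hu r1 r2
    by_cases hz : ∃ i, p.eval (lam i) = 0
    · obtain ⟨i, hi⟩ := hz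
      obtain ⟨q, rfl⟩ := dvd_iff_isRoot.mpr hi
      have hm := monic_X_sub_C (lam i)
      have hl : ((X - C (lam i)) * q).leadingCoeff = q.leadingCoeff := leadingCoeff_monic_mul hm
      have q0 : q ≠ 0 := by rintro rfl; simp at hd
      rw [hm.natDegree_mul' q0, natDegree_X_sub_C] at hd
      rw [hl] at hu
      obtain ⟨L, c, hc, hL, he⟩ := ih q (by omega) hu (fun l h => r1 l (by rw [eval₂_mul, h, mul_zero]))
        (fun l h => r2 l (by rw [eval₂_mul, h, mul_zero]))
      refine ⟨i :: L, c, hc, by simp [hL], ?_⟩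
      conv_lhs => rw [he]
      rw [List.map_cons, List.prod_cons]; ring
    · exfalso
      push Not at hz
      have q1 : θ1 ^ 2 + θ1 - 1 = 0 := by linear_combination θ1 * hs - hp
      have q2 : θ2 ^ 2 + θ2 - 1 = 0 := by linear_combination θ2 * hs - hp
      have b1 := emb_bd f1 θ1 q1 e1 p hu r1 (by omega)
      have b2 := emb_bd f2 θ2 q2 e2 p hu r2 (by omega)
      have hge := nrm_ge θ1 θ2 hs hp h1 h2 f1 f2 e1 e2
      have c1 : ‖f1 p.leadingCoeff‖ * ‖f2 p.leadingCoeff‖ = 1 := by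
        obtain ⟨u, hu⟩ := hu
        have a := hge u u.ne_zero
        have b := hge (u⁻¹ : RRˣ) (u⁻¹).ne_zero
        have m1 : ‖f1 u‖ * ‖f1 (u⁻¹ : RRˣ)‖ = 1 := by rw [← norm_mul, ← map_mul, Units.mul_inv, map_one, norm_one]
        have m2 : ‖f2 u‖ * ‖f2 (u⁻¹ : RRˣ)‖ = 1 := by rw [← norm_mul, ← map_mul, Units.mul_inv, map_one, norm_one]
        rw [← hu]
        have e : (‖f1 u‖ * ‖f2 u‖) * (‖f1 (u⁻¹ : RRˣ)‖ * ‖f2 (u⁻¹ : RRˣ)‖) = 1 := by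
          calc _ = (‖f1 u‖ * ‖f1 (u⁻¹ : RRˣ)‖) * (‖f2 u‖ * ‖f2 (u⁻¹ : RRˣ)‖) := by ring
            _ = 1 := by rw [m1, m2, one_mul]
        nlinarith
      have c2 : 1 ≤ ‖f1 (∏ i, p.eval (lam i))‖ * ‖f2 (∏ i, p.eval (lam i))‖ := by
        rw [map_prod, map_prod, norm_prod, norm_prod, ← Finset.prod_mul_distrib]
        calc (1:ℝ) = ∏ i : Fin 4, 1 := by simp
          _ ≤ _ := Finset.prod_le_prod (fun _ _ => zero_le_one) fun i _ => hge _ (hz i)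
      have c3 : (2 + θ1) * (2 + θ2) = 1 := by linear_combination 2 * hs + hp
      have := mul_lt_mul'' b1 b2 (norm_nonneg _) (norm_nonneg _)
      have e : ‖f1 p.leadingCoeff‖ ^ 4 * (2 + θ1) ^ p.natDegree * (‖f2 p.leadingCoeff‖ ^ 4 * (2 + θ2) ^ p.natDegree) = 1 := by
        calc _ = (‖f1 p.leadingCoeff‖ * ‖f2 p.leadingCoeff‖) ^ 4 * ((2 + θ1) * (2 + θ2)) ^ p.natDegree := by rw [mul_pow, mul_pow]; ring
          _ = 1 := by rw [c1, c3]; simp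
      linarith

theorem dich (w : List (ℕ × ℕ)) (hw : ∀ p ∈ w, (0 < p.1 ∧ p.1 < 3) ∧ (0 < p.2 ∧ p.2 < 5)) (hne : w ≠ []) :
    Good w ∨ ∃ L : List (Fin 4), L.Nodup ∧ L.length = w.length ∧ ∀ i ∈ L, tt th (lam i) w = 0 := by
  by_cases hg : Good w
  · exact Or.inl hg
  obtain ⟨hd, hu⟩ := tau_deg w hw hne
  have s1 := Real.goldenRatio_add_goldenConj
  have s2 := Real.goldenRatio_mul_goldenConj
  have q1 : (-Real.goldenRatio) ^ 2 + (-Real.goldenRatio) - 1 = 0 := by linear_combination Real.goldenRatio_sq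
  have q2 : (-Real.goldenConj) ^ 2 + (-Real.goldenConj) - 1 = 0 := by linear_combination Real.goldenConj_sq
  have key : ∀ (θ : ℝ) (hθ : θ ^ 2 + θ - 1 = 0) (f : RR →+* ℂ), f th = θ → ∀ l : ℂ, eval₂ f l (tau w) = 0 → ∃ r : ℝ, l = r ∧ r ^ 2 + θ * r - θ < 2 := by
    intro θ hθ f hf l hl
    rw [tau_eval, hf] at hl
    exact (root_good θ hθ l w hl).resolve_left hg
  obtain ⟨L, c, hc, hL, he⟩ := factor (-Real.goldenRatio) (-Real.goldenConj) (by linarith) (by linarith)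
    Real.goldenRatio_irrational.neg Real.goldenConj_irrational.neg
    (rlift ((-Real.goldenRatio : ℝ) : ℂ) (by exact_mod_cast q1)) (rlift ((-Real.goldenConj : ℝ) : ℂ) (by exact_mod_cast q2))
    (rlift_th _ _) (rlift_th _ _) _ (tau w) hd hu (key _ q1 _ (rlift_th _ _)) (key _ q2 _ (rlift_th _ _))
  right
  refine ⟨L, ?_, hL, ?_⟩
  · by_contra hn
    obtain ⟨i, hi⟩ := (List.exists_duplicate_iff_not_nodup).mpr hn
    apply hg
    apply B2 w i
    rw [he]
    apply Dvd.dvd.mul_left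
    have := (List.duplicate_iff_sublist.mp hi).map (fun i => X - C (lam i))
    have := this.prod_dvd_prod
    simpa [sq] using this
  · intro i hi
    have h1 := tau_eval (RingHom.id RR) (lam i) w
    rw [RingHom.id_apply] at h1
    rw [← h1, he, eval₂_mul]
    have : (X - C (lam i)) ∣ (L.map fun i => X - C (lam i)).prod := List.dvd_prod (List.mem_map_of_mem hi)
    obtain ⟨q, hq⟩ := this
    rw [hq, eval₂_mul]; simp

end

section
lemma ext3 (θ0 θ1 t01 : ℂ) (hk : θ0 ^ 2 + θ1 ^ 2 + t01 ^ 2 - θ0 * θ1 * t01 - 4 ≠ 0) :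
    ∃ A B : SL2, trc A = θ0 ∧ trc B = θ1 ∧ trc (A * B) = t01 ∧
      ∀ θ t0 t1 : ℂ, ∃ D : SL2, trc D = θ ∧ trc (A * D) = t0 ∧ trc (B * D) = t1 := by
  have q : ∀ t : ℂ, ∃ e e' : ℂ, e + e' = t ∧ e * e' = 1 := by
    intro t
    obtain ⟨s, hs⟩ := IsAlgClosed.exists_pow_nat_eq (t ^ 2 - 4) (n := 2) (by norm_num)
    exact ⟨(t + s) / 2, (t - s) / 2, by ring, by linear_combination - hs / 4⟩
  obtain ⟨e, e', h1, h2⟩ := q θ0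
  obtain ⟨f, f', h3, h4⟩ := q θ1
  obtain ⟨z, hz⟩ : ∃ z, z = t01 - e * f - e' * f' := ⟨_, rfl⟩
  have kz : z * (z + (e - e') * (f - f')) ≠ 0 := by
    convert hk using 1
    rw [← h1, ← h3, hz]
    linear_combination (f ^ 2 + f' ^ 2 - 2) * h2 + (e ^ 2 + e' ^ 2 - 2) * h4
  have z0 : z ≠ 0 := left_ne_zero_of_mul kz
  have z1 := right_ne_zero_of_mul kz
  refine ⟨⟨!![e, 1; 0, e'], by rw [Matrix.det_fin_two]; simp [h2]⟩, ⟨!![f, 0; z, f'], by rw [Matrix.det_fin_two]; simp [h4]⟩, ?_, ?_, ?_, ?_⟩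
  · simpa [trc]
  · simpa [trc]
  · rw [← trc_eq]
    change (!![e, 1; 0, e'] * !![f, 0; z, f']).trace = _
    rw [Matrix.mul_fin_two, Matrix.trace_fin_two]; simp [hz]; ring
  · intro θ t0 t1
    obtain ⟨p, hp⟩ : ∃ p : ℂ, (z + (e - e') * (f - f')) * (p * p) + (-z * θ - (t0 - e' * θ) * (f - f') - (t1 - f' * θ) * (e - e')) * p
        + (z + (t1 - f' * θ) * (t0 - e' * θ)) = 0 := by
      obtain ⟨s, hs⟩ := IsAlgClosed.exists_pow_nat_eq (discrim (z + (e - e') * (f - f')) (-z * θ - (t0 - e' * θ) * (f - f') - (t1 - f' * θ) * (e - e')) (z + (t1 - f' * θ) * (t0 - e' * θ))) (n := 2) (by norm_num)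
      exact exists_quadratic_eq_zero z1 ⟨s, by rw [← hs, sq]⟩
    obtain ⟨r, hr⟩ : ∃ r, r = t0 - e * p - e' * (θ - p) := ⟨_, rfl⟩
    obtain ⟨q, hq⟩ : ∃ q, z * q = t1 - f * p - f' * (θ - p) := ⟨(t1 - f * p - f' * (θ - p)) / z, by field_simp⟩
    refine ⟨⟨!![p, q; r, θ - p], ?_⟩, ?_, ?_, ?_⟩
    · rw [Matrix.det_fin_two]; simp
      apply mul_left_cancel₀ z0
      rw [hr]; linear_combination -hp - (t0 - e * p - e' * (θ - p)) * hq
    · simp [trc]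
    · rw [← trc_eq]
      change (!![e, 1; 0, e'] * !![p, q; r, θ - p]).trace = _
      rw [Matrix.mul_fin_two, Matrix.trace_fin_two]; simp [hr]; ring
    · rw [← trc_eq]
      change (!![f, 0; z, f'] * !![p, q; r, θ - p]).trace = _
      rw [Matrix.mul_fin_two, Matrix.trace_fin_two]; simp; linear_combination hq

section cp
variable {n : ℕ}
def st (σ : Fin n → Fin n) (M : Fin n → SL2) (z : Fin n × SL2) : Fin n × SL2 := (σ z.1, M z.1 * z.2)
def run (σ τ : Fin n → Fin n) (M N : Fin n → SL2) : List (ℕ × ℕ) → Fin n → Fin n × SL2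
  | [], i => (i, 1)
  | p :: w, i => (st σ M)^[p.1] ((st τ N)^[p.2] (run σ τ M N w i))
noncomputable def fm (σ : Fin n → Fin n) (M : Fin n → SL2) (z : Fin n × PL) : Fin n × PL := (σ z.1, ppi (M z.1) z.2)

noncomputable def im (v : PL) (z : Fin n × SL2) : Fin n × PL := (z.1, ppi z.2 v)
lemma im_st (σ : Fin n → Fin n) (M : Fin n → SL2) (v : PL) : Function.Semiconj (im v) (st σ M) (fm σ M) := by
  intro z; simp [im, st, fm]
lemma fm_it (σ : Fin n → Fin n) (M : Fin n → SL2) (m : ℕ) (h : ∀ i, ((st σ M)^[m] (i, 1)).1 = i ∧ ppi ((st σ M)^[m] (i, 1)).2 = 1) (z) :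
    (fm σ M)^[m] z = z := by
  obtain ⟨i, v⟩ := z
  have := (im_st σ M v).iterate_right m (i, 1)
  obtain ⟨h1, h2⟩ := h i
  have e : im v (i, 1) = (i, v) := by simp [im]
  rw [← e, ← this, im, h1, h2]; simp [im]

noncomputable def fp (σ : Fin n → Fin n) (M : Fin n → SL2) (m : ℕ) (h : ∀ z, (fm σ M)^[m + 1] z = z) : Equiv.Perm (Fin n × PL) :=
  ⟨fm σ M, (fm σ M)^[m], fun z => by rw [← Function.iterate_succ_apply]; exact h z,
    fun z => by have := h z; rw [Function.iterate_succ_apply'] at this; exact this⟩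

lemma lift_fib (p q : Equiv.Perm (Fin n × PL)) (i : Fin n) (P Q : Equiv.Perm PL) (hp : ∀ v, p (i, v) = (i, P v))
    (hq : ∀ v, q (i, v) = (i, Q v)) (h : Free2 P Q) : Free2 p q := by
  have inv : ∀ (p : Equiv.Perm (Fin n × PL)) (P : Equiv.Perm PL), (∀ v, p (i, v) = (i, P v)) → ∀ v, p⁻¹ (i, v) = (i, P⁻¹ v) := by
    intro p P hp v
    rw [Equiv.Perm.inv_eq_iff_eq, hp]; simp
  have key : ∀ g : FreeGroup (Fin 2), ∀ v, FreeGroup.lift ![p, q] g (i, v) = (i, FreeGroup.lift ![P, Q] g v) := by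
    have gen : ∀ (k : Fin 2) v, ![p, q] k (i, v) = (i, ![P, Q] k v) := by
      intro k v; fin_cases k
      · exact hp v
      · exact hq v
    intro g
    induction g using FreeGroup.induction_on with
    | C1 => intro v; simp
    | of k => intro v; simpa using gen k v
    | inv_of k _ => intro v; rw [map_inv, map_inv, FreeGroup.lift_apply_of, FreeGroup.lift_apply_of]; exact inv _ _ (gen k) v
    | mul a b ha hb => intro v; rw [map_mul, map_mul, Equiv.Perm.mul_apply, hb, ha]; rfl
  unfold Free2 at *
  rw [injective_iff_map_eq_one] at h ⊢
  intro g hg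
  apply h
  ext v : 1
  have := key g v
  rw [hg] at this
  simpa using (congrArg Prod.snd this).symm

lemma ev_mem {T : Type*} [Group T] (X Y : T) (w) : ev X Y w ∈ Subgroup.closure {X, Y} := by
  induction w with
  | nil => simp
  | cons p w ih =>
    rw [ev_cons]
    exact mul_mem (mul_mem (pow_mem (Subgroup.subset_closure (by simp)) _) (pow_mem (Subgroup.subset_closure (by simp)) _)) ih

lemma good_cp (σ τ : Fin n → Fin n) (M N : Fin n → SL2) (w : List (ℕ × ℕ))
    (hx : ∀ i, ((st σ M)^[3] (i, 1)).1 = i ∧ ppi ((st σ M)^[3] (i, 1)).2 = 1)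
    (hy : ∀ i, ((st τ N)^[5] (i, 1)).1 = i ∧ ppi ((st τ N)^[5] (i, 1)).2 = 1)
    (hw : ∀ i, (run σ τ M N w (run σ τ M N w i).1).1 = i ∧ ppi ((run σ τ M N w (run σ τ M N w i).1).2 * (run σ τ M N w i).2) = 1)
    (i : Fin n) (w1 w2 : List (ℕ × ℕ)) (P Q : SL2) (h1 : run σ τ M N w1 i = (i, P)) (h2 : run σ τ M N w2 i = (i, Q))
    (a b t : ℂ) (ha : trc P = a) (hb : trc Q = b) (ht : trc (P * Q) = t)
    (k1 : ∀ c : ℝ, 0 ≤ c → c ≤ 4 → t ^ 2 ≠ c) (k2 : a ^ 2 + b ^ 2 + t ^ 2 - a * b * t - 4 ≠ 0)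
    (k3 : a ^ 2 - a * b * t + b ^ 2 ≠ 0) : Good w := by
  obtain ⟨m, hm⟩ := pp_tr P Q a b t ha hb ht k1 k2 k3
  have hx' := fm_it σ M 3 hx
  have hy' := fm_it τ N 5 hy
  obtain ⟨x, ex⟩ : ∃ x, x = fp σ M 2 hx' := ⟨_, rfl⟩
  obtain ⟨y, ey⟩ : ∃ y, y = fp τ N 4 hy' := ⟨_, rfl⟩
  have fx : ∀ k z, (x ^ k) z = (fm σ M)^[k] z := by
    intro k z; rw [← Equiv.Perm.iterate_eq_pow, ex]; rfl
  have fy : ∀ k z, (y ^ k) z = (fm τ N)^[k] z := by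
    intro k z; rw [← Equiv.Perm.iterate_eq_pow, ey]; rfl
  have fr : ∀ w i v, ev x y w (i, v) = im v (run σ τ M N w i) := by
    intro w i v
    induction w with
    | nil => simp [run, im]
    | cons p w ih =>
      rw [ev_cons, Equiv.Perm.mul_apply, Equiv.Perm.mul_apply, ih, fx, fy, run,
        ← (im_st τ N v).iterate_right, ← (im_st σ M v).iterate_right]
  have e1 : ∀ v, ev x y w1 (i, v) = (i, ppi P v) := by intro v; rw [fr, h1]; rfl
  have e2 : ∀ v, ev x y w2 (i, v) = (i, ppi Q v) := by intro v; rw [fr, h2]; rfl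
  have e3 : ∀ v, (ev x y w1 * ev x y w2) (i, v) = (i, ppi (P * Q) v) := by
    intro v; rw [Equiv.Perm.mul_apply, e2, e1, map_mul]; rfl
  have e4 : ∀ k v, ((ev x y w1 * ev x y w2) ^ k) (i, v) = (i, ppi ((P * Q) ^ k) v) := by
    intro k
    induction k with
    | zero => intro v; simp
    | succ k ih => intro v; rw [pow_succ, Equiv.Perm.mul_apply, e3, ih, pow_succ, map_mul ppi ((P * Q) ^ k)]; rfl
  have mem := pow_mem (mul_mem (ev_mem x y w1) (ev_mem x y w2)) m
  refine ⟨_, _, x, y, ?_, ?_, ?_, _, mem, _, mul_mem (mul_mem (ev_mem x y w1) mem) (inv_mem (ev_mem x y w1)),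
    lift_fib _ _ i _ _ (e4 m) ?_ hm⟩
  · ext1 z; rw [fx, hx']; rfl
  · ext1 z; rw [fy, hy']; rfl
  · ext1 ⟨i, v⟩
    obtain ⟨q1, q2⟩ := hw i
    rw [sq, Equiv.Perm.mul_apply, fr, im, fr, im, q1, ← Equiv.Perm.mul_apply, ← map_mul, q2]; rfl
  · intro v
    have : (ev x y w1)⁻¹ (i, v) = (i, ppi P⁻¹ v) := by
      rw [Equiv.Perm.inv_eq_iff_eq, e1, ← Equiv.Perm.mul_apply, ← map_mul]; simp
    rw [Equiv.Perm.mul_apply, Equiv.Perm.mul_apply, this, e4, e1, map_mul, map_mul]; rfl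
end cp

end

section
lemma trc_cyc (A B : SL2) : trc (A * B) = trc (B * A) := by
  simp only [trc, sl_mul_apply]; ring
lemma trc_mi (A B : SL2) : trc (A * B⁻¹) = trc A * trc B - trc (A * B) := by
  simp only [trc, sl_mul_apply]
  simp [Matrix.SpecialLinearGroup.coe_inv, Matrix.adjugate_fin_two]; ring
lemma trc_mm (A B : SL2) : trc (A * B ^ 2) = trc (A * B) * trc B - trc A := by
  have := trc_mi (A * B) B
  rw [mul_inv_cancel_right] at this
  rw [sq, ← mul_assoc]; linear_combination this
lemma ppi4 (A : SL2) (h : ppi A ^ 5 = 1) : ppi (A ^ 4) = ppi A⁻¹ := by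
  rw [map_pow, map_inv, eq_inv_iff_mul_eq_one, ← pow_succ, h]

lemma exF : ∃ φ : ℝ, φ ^ 2 = φ + 1 ∧ 1 < φ ∧ φ < 2 :=
  ⟨_, Real.goldenRatio_sq, Real.one_lt_goldenRatio, Real.goldenRatio_lt_two⟩

lemma nonreal (φ : ℝ) (h1 : 1 < φ) (t : ℂ) (ht : t ^ 2 + t + φ = 0) (c : ℝ) : t ^ 2 ≠ c := by
  intro h
  have e : t = ((-φ - c : ℝ) : ℂ) := by push_cast; linear_combination ht - h
  rw [e] at h
  have h' : (-φ - c) ^ 2 = c := by exact_mod_cast h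
  nlinarith [sq_nonneg (φ + c - 1 / 2)]
lemma bigt (φ : ℝ) (h : φ ^ 2 = φ + 1) (h1 : 1 < φ) (t : ℂ) (ht : t = -φ ^ 2) (c : ℝ) (_ : 0 ≤ c) (hc : c ≤ 4) : t ^ 2 ≠ c := by
  intro e
  rw [ht] at e
  have : (-φ ^ 2) ^ 2 = c := by exact_mod_cast e
  rw [h] at this; nlinarith
lemma sq5 (φ : ℝ) (h : φ ^ 2 = φ + 1) (A : SL2) (hA : trc A = φ ∨ trc A = 1 - φ) : ppi A ^ 5 = 1 := by
  have h' : (φ : ℂ) ^ 2 = φ + 1 := by exact_mod_cast h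
  rcases hA with hA | hA
  · exact ppi5' A _ hA (by linear_combination h')
  · exact ppi5' A _ hA (by linear_combination h')

lemma good3 (w) (Y : Fin 3 → SL2) (φ : ℝ) (hφ : φ ^ 2 = φ + 1) (hY : ∀ i, trc (Y i) = φ ∨ trc (Y i) = 1 - φ) (W : Fin 3 → SL2)
    (hr : ∀ i, run (fun i : Fin 3 => i + 2) id 1 Y w i = (i, W i)) (h0 : ∀ i, ppi (W i) ^ 2 = 1) (i : Fin 3)
    (a b t : ℂ) (ha : trc (Y i) = a) (hb : trc (Y (i + 2)) = b) (ht : trc (Y i * Y (i + 2)) = t)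
    (k1 : ∀ c : ℝ, 0 ≤ c → c ≤ 4 → t ^ 2 ≠ c) (k2 : a ^ 2 + b ^ 2 + t ^ 2 - a * b * t - 4 ≠ 0)
    (k3 : a ^ 2 - a * b * t + b ^ 2 ≠ 0) : Good w := by
  refine good_cp (fun i : Fin 3 => i + 2) id 1 Y w ?_ ?_ ?_ i [(0, 1)] [(2, 1), (1, 0)] (Y i) (Y (i + 2)) ?_ ?_ a b t ha hb ht k1 k2 k3
  · intro i; fin_cases i <;> simp [st]
  · intro i
    have := sq5 φ hφ _ (hY i)
    simp only [st, Function.iterate_succ, Function.iterate_zero, Function.comp, id]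
    refine ⟨trivial, ?_⟩
    simpa [pow_succ, mul_assoc] using this
  · intro i
    simp only [hr]
    exact ⟨trivial, by rw [map_mul, ← sq, h0]⟩
  · simp [run, st]
  · simp [run, st]; fin_cases i <;> rfl

lemma C2b : Good [(1, 1), (2, 2)] := by
  obtain ⟨φ, hφ, h1, h2⟩ := exF
  have hF : (φ : ℂ) ^ 2 = φ + 1 := by exact_mod_cast hφ
  have n2 : (φ : ℂ) - 2 ≠ 0 := by exact_mod_cast (sub_neg.mpr h2).ne
  have n0 : (φ : ℂ) ≠ 0 := by exact_mod_cast (by linarith : φ ≠ 0)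
  obtain ⟨A, B, hA, hB, hAB, hD⟩ := ext3 φ φ 1 (by convert n2 using 1; linear_combination hF)
  obtain ⟨D, hD, hAD, hBD⟩ := hD (1 - φ) (-φ ^ 2) (φ - 2)
  have hr : ∀ i, run (fun i : Fin 3 => i + 2) id 1 ![A, B, D] [(1, 1), (2, 2)] i = (i, ![A, B, D] (i + 1) * ![A, B, D] i ^ 2) := by
    intro i; fin_cases i <;> simp [run, st, sq] <;> rfl
  refine good3 _ ![A, B, D] φ hφ ?_ _ hr ?_ 0 φ (1 - φ) (-φ ^ 2) hA hD hAD (bigt φ hφ h1 _ rfl) ?_ ?_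
  · intro i; fin_cases i <;> simp [hA, hB, hD]
  · intro i
    apply ppi2
    rw [trc_mm]
    fin_cases i
    · change trc (B * A) * trc A - trc B = 0
      rw [trc_cyc, hAB, hA, hB]; ring
    · change trc (D * B) * trc B - trc D = 0
      rw [trc_cyc, hBD, hB, hD]; linear_combination hF
    · change trc (A * D) * trc D - trc A = 0
      rw [hAD, hD, hA]; linear_combination φ * hF
  · convert mul_ne_zero two_ne_zero n0 using 1
    linear_combination (φ ^ 2 + φ + 1 - (1 - φ) * φ - 2 * φ ^ 2 + φ + 2) * hF
  · convert neg_ne_zero.mpr n2 using 1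
    linear_combination (1 - φ ^ 2) * hF

lemma C4a : Good [(1, 1), (1, 2), (2, 1), (2, 4)] := by
  obtain ⟨φ, hφ, h1, h2⟩ := exF
  have hF : (φ : ℂ) ^ 2 = φ + 1 := by exact_mod_cast hφ
  have n2 : (φ : ℂ) + 1 ≠ 0 := by exact_mod_cast (by linarith : φ + 1 ≠ 0)
  obtain ⟨s, hs⟩ := IsAlgClosed.exists_pow_nat_eq (1 - 4 * φ : ℂ) (n := 2) (by norm_num)
  obtain ⟨a, ha⟩ : ∃ a : ℂ, a ^ 2 + a + φ = 0 := ⟨(s - 1) / 2, by linear_combination hs / 4⟩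
  have k2 : (φ : ℂ) ^ 2 + (1 - φ) ^ 2 + a ^ 2 - φ * (1 - φ) * a - 4 ≠ 0 := by
    convert neg_ne_zero.mpr n2 using 1; linear_combination ha + (a + 2) * hF
  obtain ⟨A, B, hA, hB, hAB, hD⟩ := ext3 φ (1 - φ) a k2
  obtain ⟨D, hD, hAD, hBD⟩ := hD (1 - φ) (-(2 - φ) * a - 3 + φ) (a + 3 - φ)
  have hr : ∀ i, run (fun i : Fin 3 => i + 2) id 1 ![A, B, D] [(1, 1), (1, 2), (2, 1), (2, 4)] i =
      (i, ![A, B, D] (i + 1) * ![A, B, D] (i + 2) ^ 2 * ![A, B, D] (i + 1) * ![A, B, D] i ^ 4) := by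
    intro i; fin_cases i <;> simp [run, st, pow_succ, mul_assoc] <;> rfl
  have hY : ∀ i, trc (![A, B, D] i) = φ ∨ trc (![A, B, D] i) = 1 - φ := by
    intro i; fin_cases i <;> simp [hA, hB, hD]
  have tr : ∀ P Q R : SL2, trc (P * Q ^ 2 * P * R⁻¹) = (trc (P * Q) * trc Q - trc P) * (trc P * trc R - trc (P * R)) - (trc (Q * R) * trc Q - trc R) := by
    intro P Q R
    have e1 := trc_mi (P * Q ^ 2) (R * P⁻¹)
    have e2 : trc (P * Q ^ 2 * (R * P⁻¹)) = trc (R * Q ^ 2) := by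
      rw [← mul_assoc, trc_cyc, trc_cyc R]; congr 1; group
    rw [e2, trc_mm, trc_mm, trc_mi R P, trc_cyc R Q, trc_cyc R P] at e1
    rw [show P * Q ^ 2 * P * R⁻¹ = P * Q ^ 2 * (R * P⁻¹)⁻¹ by group, e1]; ring
  refine good3 _ ![A, B, D] φ hφ hY _ hr ?_ 1 (1 - φ) φ a hB hA (by rw [← hAB, trc_cyc]; rfl) (fun c _ _ => nonreal φ h1 a ha c) ?_ ?_
  · intro i
    rw [map_mul, ppi4 _ (sq5 φ hφ _ (hY i)), ← map_mul]
    apply ppi2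
    rw [tr]
    fin_cases i
    · change (trc (B * D) * trc D - trc B) * (trc B * trc A - trc (B * A)) - (trc (D * A) * trc D - trc A) = 0
      rw [trc_cyc B A, trc_cyc D A, hAB, hAD, hBD, hA, hB, hD]; linear_combination (-1 + φ) * ha + (-φ ^ 2 + φ * (a + 5) - 2 * a - 7 + a - 2 * φ + 4) * hF
    · change (trc (D * A) * trc A - trc D) * (trc D * trc B - trc (D * B)) - (trc (A * B) * trc A - trc B) = 0
      rw [trc_cyc D B, trc_cyc D A, hAB, hAD, hBD, hA, hB, hD]; linear_combination (2 * φ - φ ^ 2) * ha + (φ ^ 2 - φ - 3 + a * (φ ^ 2 - 2 * φ - 1)) * hF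
    · change (trc (A * B) * trc B - trc A) * (trc A * trc D - trc (A * D)) - (trc (B * D) * trc B - trc D) = 0
      rw [hAB, hAD, hBD, hA, hB, hD]; linear_combination (1 - φ) * (2 - φ) * ha + (a * φ + 2) * hF
  · convert k2 using 1; ring
  · intro h
    refine nonreal φ h1 a ha 9 ?_
    have : a = -3 := by linear_combination h - (a + 2) * hF
    rw [this]; norm_num

lemma C4c : Good [(1, 1), (2, 1), (1, 2), (2, 4)] := by
  obtain ⟨φ, hφ, h1, h2⟩ := exF
  have hF : (φ : ℂ) ^ 2 = φ + 1 := by exact_mod_cast hφ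
  have n2 : (φ : ℂ) - 2 ≠ 0 := by exact_mod_cast (sub_neg.mpr h2).ne
  have n1 : (φ : ℂ) + 1 ≠ 0 := by exact_mod_cast (by linarith : φ + 1 ≠ 0)
  obtain ⟨s, hs⟩ := IsAlgClosed.exists_pow_nat_eq (1 - 4 * φ : ℂ) (n := 2) (by norm_num)
  obtain ⟨a, ha⟩ : ∃ a : ℂ, a ^ 2 + a + φ = 0 := ⟨(s - 1) / 2, by linear_combination hs / 4⟩
  obtain ⟨s', hs'⟩ := IsAlgClosed.exists_pow_nat_eq (1 - 4 * (1 - φ) : ℂ) (n := 2) (by norm_num)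
  obtain ⟨b, hb⟩ : ∃ b : ℂ, b ^ 2 + b + (1 - φ) = 0 := ⟨(s' - 1) / 2, by linear_combination hs' / 4⟩
  obtain ⟨A, B, hA, hB, hAB, hD⟩ := ext3 φ φ 1 (by convert n2 using 1; linear_combination hF)
  obtain ⟨D, hD, hAD, hBD⟩ := hD (1 - φ) b a
  have hr : ∀ i, run (fun i : Fin 3 => i + 2) id 1 ![A, B, D] [(1, 1), (2, 1), (1, 2), (2, 4)] i =
      (i, ![A, B, D] (i + 1) * ![A, B, D] i * ![A, B, D] (i + 1) ^ 2 * ![A, B, D] i ^ 4) := by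
    intro i; fin_cases i <;> simp [run, st, pow_succ, mul_assoc] <;> rfl
  have hY : ∀ i, trc (![A, B, D] i) = φ ∨ trc (![A, B, D] i) = 1 - φ := by
    intro i; fin_cases i <;> simp [hA, hB, hD]
  have tr : ∀ P Q : SL2, trc (P * Q * P ^ 2 * Q⁻¹) = (trc (P * Q) * trc P - trc Q) * (trc P * trc Q - trc (P * Q)) - (trc (P * Q) * trc Q - trc P) := by
    intro P Q
    have e1 := trc_mi (P * Q * P) (Q * P⁻¹)
    have e2 : trc (P * Q * P * (Q * P⁻¹)) = trc (P * Q ^ 2) := by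
      rw [← mul_assoc, trc_cyc, show P⁻¹ * (P * Q * P * Q) = Q * (P * Q) by group, trc_cyc, sq, mul_assoc]
    have e3 : trc (P * Q * P) = trc (Q * P ^ 2) := by
      rw [trc_cyc, trc_cyc Q]; congr 1; simp only [sq]; group
    rw [e2, e3, trc_mm, trc_mm, trc_mi Q P, trc_cyc Q P] at e1
    rw [show P * Q * P ^ 2 * Q⁻¹ = P * Q * P * (Q * P⁻¹)⁻¹ by simp only [sq]; group, e1]; ring
  refine good3 _ ![A, B, D] φ hφ hY _ hr ?_ 2 (1 - φ) φ a hD hB (by rw [← hBD, trc_cyc]; rfl) (fun c _ _ => nonreal φ h1 a ha c) ?_ ?_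
  · intro i
    rw [map_mul, ppi4 _ (sq5 φ hφ _ (hY i)), ← map_mul]
    apply ppi2
    rw [tr]
    fin_cases i
    · change (trc (B * A) * trc B - trc A) * (trc B * trc A - trc (B * A)) - (trc (B * A) * trc A - trc B) = 0
      rw [trc_cyc B A, hAB, hA, hB]; ring
    · change (trc (D * B) * trc D - trc B) * (trc D * trc B - trc (D * B)) - (trc (D * B) * trc B - trc D) = 0
      rw [trc_cyc D B, hBD, hB, hD]; linear_combination -(1 - φ) * (ha + (1 + a) * hF)
    · change (trc (A * D) * trc A - trc D) * (trc A * trc D - trc (A * D)) - (trc (A * D) * trc D - trc A) = 0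
      rw [hAD, hD, hA]; linear_combination -φ * (hb + (1 + b) * hF)
  · convert neg_ne_zero.mpr n1 using 1; linear_combination ha + (a + 2) * hF
  · intro h
    refine nonreal φ h1 a ha 9 ?_
    have : a = -3 := by linear_combination h - (a + 2) * hF
    rw [this]; norm_num

end

section
lemma good5 : ∃ X : Fin 5 → SL2, (∀ i, trc (X i) = -1) ∧ (∀ i, trc (X i * X (i + 1)) = 0) ∧
    ∀ w, (∀ i, (run id (fun i : Fin 5 => i + 4) X 1 w i).1 = i ∧ trc (run id (fun i : Fin 5 => i + 4) X 1 w i).2 = 0) → Good w := by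
  obtain ⟨B, C, hB, hC, hBC, hD⟩ := ext3 (-1) (-1) 0 (by norm_num)
  obtain ⟨A, hA, hBA, hCA⟩ := hD (-1) 0 3
  obtain ⟨D, hD, hBD, hCD⟩ := hD (-1) 0 0
  have h1 : ∀ i, trc (![A, B, C, D, B] i) = -1 := by intro i; fin_cases i <;> simpa
  refine ⟨![A, B, C, D, B], h1, ?_, ?_⟩
  · intro i; fin_cases i
    · exact (trc_cyc _ _).trans hBA
    · exact hBC
    · exact hCD
    · exact (trc_cyc _ _).trans hBD
    · exact hBA
  · intro w hw
    refine good_cp (n := 5) id (fun i => i + 4) ![A, B, C, D, B] 1 w ?_ ?_ ?_ 0 [(1, 0)] [(0, 2), (1, 3)] A C ?_ ?_ (-1) (-1) 3 hA hC ((trc_cyc _ _).trans hCA) ?_ ?_ ?_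
    · intro i
      have := ppi3 _ (h1 i)
      simp only [st, Function.iterate_succ, Function.iterate_zero, Function.comp, id]
      refine ⟨trivial, ?_⟩
      simpa [pow_succ, mul_assoc] using this
    · intro i; fin_cases i <;> simp [st]
    · intro i
      obtain ⟨e1, e2⟩ := hw i
      simp only [e1]
      exact ⟨trivial, by rw [map_mul, ← sq, ppi2 _ e2]⟩
    · simp [run, st]
    · simp [run, st]
    · intro c _ hc h
      have : (3:ℝ) ^ 2 = c := by exact_mod_cast h
      linarith
    · norm_num
    · norm_num

lemma C2a : Good [(1, 1), (1, 4)] := by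
  obtain ⟨X, h1, h2, h⟩ := good5
  apply h
  intro i
  have e : run id (fun i : Fin 5 => i + 4) X 1 [(1, 1), (1, 4)] i = (i, X i * X (i + 1)) := by
    fin_cases i <;> simp [run, st]
  rw [e]; exact ⟨rfl, h2 i⟩

lemma C4b : Good [(1, 1), (1, 3), (2, 2), (1, 4)] := by
  obtain ⟨X, h1, h2, h⟩ := good5
  apply h
  intro i
  have e : run id (fun i : Fin 5 => i + 4) X 1 [(1, 1), (1, 3), (2, 2), (1, 4)] i = (i, X i * X (i + 1) * X (i + 4) ^ 2 * X (i + 1)) := by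
    fin_cases i <;> simp [run, st, sq, mul_assoc] <;> rfl
  rw [e]; refine ⟨rfl, ?_⟩
  have s3 := sl3 _ (h1 (i + 4))
  have s2 : X (i + 4) ^ 2 = (X (i + 4))⁻¹ := by rw [eq_inv_iff_mul_eq_one, ← pow_succ, s3]
  have h3 := h2 (i + 4)
  have h4 : i + 4 + 1 = i := by rw [add_assoc]; exact add_zero i
  rw [h4] at h3
  change trc (X i * X (i + 1) * X (i + 4) ^ 2 * X (i + 1)) = 0
  have t := trc_mi (X i * X (i + 1)) ((X (i + 1))⁻¹ * X (i + 4))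
  rw [mul_inv_rev, inv_inv, h2, ← mul_assoc, ← mul_assoc, mul_inv_cancel_right, trc_cyc (X i), h3, ← s2] at t
  rw [t]; ring

lemma good_rev3 (h : Good [(1, 4), (2, 1), (1, 1)]) : Good [(1, 1), (1, 1), (2, 4)] := by
  obtain ⟨T, _, X, Y, h1, h2, h3, P, hP, Q, hQ, hf⟩ := h
  have e : Subgroup.closure {X⁻¹, Y⁻¹} = Subgroup.closure {X, Y} := by
    rw [← Subgroup.closure_inv {X, Y}]; simp [Set.inv_insert]
  refine ⟨T, _, X⁻¹, Y⁻¹, by simp [h1], by simp [h2], ?_, P, by rwa [e], Q, by rwa [e], hf⟩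
  have : ev X⁻¹ Y⁻¹ [(1, 1), (1, 1), (2, 4)] = X⁻¹ * (ev X Y [(1, 4), (2, 1), (1, 1)])⁻¹ * X := by
    simp [ev, pow_succ, mul_assoc]
  rw [this, sq]
  rw [sq] at h3
  have h4 := congrArg (·⁻¹) h3
  simp only [mul_inv_rev, inv_one] at h4
  calc _ = X⁻¹ * ((ev X Y [(1, 4), (2, 1), (1, 1)])⁻¹ * (ev X Y [(1, 4), (2, 1), (1, 1)])⁻¹) * X := by group
    _ = 1 := by rw [h4]; group

lemma good_rev4 (h : Good [(1, 1), (2, 1), (1, 2), (2, 4)]) : Good [(1, 4), (2, 2), (1, 1), (2, 1)] := by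
  obtain ⟨T, _, X, Y, h1, h2, h3, P, hP, Q, hQ, hf⟩ := h
  have e : Subgroup.closure {X⁻¹, Y⁻¹} = Subgroup.closure {X, Y} := by
    rw [← Subgroup.closure_inv {X, Y}]; simp [Set.inv_insert]
  refine ⟨T, _, X⁻¹, Y⁻¹, by simp [h1], by simp [h2], ?_, P, by rwa [e], Q, by rwa [e], hf⟩
  have : ev X⁻¹ Y⁻¹ [(1, 4), (2, 2), (1, 1), (2, 1)] = X⁻¹ * (ev X Y [(1, 1), (2, 1), (1, 2), (2, 4)])⁻¹ * X := by
    simp [ev, pow_succ, mul_assoc]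
  rw [this, sq]
  rw [sq] at h3
  have h4 := congrArg (·⁻¹) h3
  simp only [mul_inv_rev, inv_one] at h4
  calc _ = X⁻¹ * ((ev X Y [(1, 1), (2, 1), (1, 2), (2, 4)])⁻¹ * (ev X Y [(1, 1), (2, 1), (1, 2), (2, 4)])⁻¹) * X := by group
    _ = 1 := by rw [h4]; group

lemma mat_aba (A B : SL2) : (A * B * A).1 = trc (A * B) • A.1 - (B⁻¹).1 := by
  have dA := sl_det A
  have dB := sl_det B
  ext i j
  simp only [trc, sl_mul_apply]
  fin_cases i <;> fin_cases j <;> simp [Matrix.SpecialLinearGroup.coe_inv, Matrix.adjugate_fin_two]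
  · linear_combination -B 1 1 * dA
  · linear_combination B 0 1 * dA
  · linear_combination B 1 0 * dA
  · linear_combination -B 0 0 * dA

lemma mat_inv (A : SL2) : (A⁻¹).1 = trc A • 1 - A.1 := by
  ext i j
  simp only [trc]
  fin_cases i <;> fin_cases j <;> simp [Matrix.SpecialLinearGroup.coe_inv, Matrix.adjugate_fin_two]

lemma mat_h (A B C : Matrix (Fin 2) (Fin 2) ℂ) (t u φ : ℂ) (r1 : B * A * B = t • B + A) (r2 : C * B * C = u • C + B)
    (r3 : C * A * C = (-φ ^ 2) • C + A) (r4 : A * C * A = (-φ ^ 2) • A + 1 + C) (r5 : A * B * A = t • A + B)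
    (r9 : A * A = -1) (hu : t * u = 2) (ht : t ^ 2 = 1 - φ) (hF : φ ^ 2 = φ + 1) :
    A * (C * (B * A * B) * C) * A = (1 - φ) • 1 + (1 - φ) • C + t • B := by
  have e1 : C * (B * A * B) * C = (1 - φ) • C + t • B + A := by
    rw [r1, mul_add, add_mul, Matrix.mul_smul, Matrix.smul_mul, r2, r3]
    have e : (1 - φ) = t * u + -φ ^ 2 := by linear_combination hF - hu
    rw [e]; module
  rw [e1, mul_add, mul_add, add_mul, add_mul, Matrix.mul_smul, Matrix.smul_mul, Matrix.mul_smul, Matrix.smul_mul, r4, r5, r9]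
  have e : (1 - φ) * -φ ^ 2 + t * t - 1 = 0 := by linear_combination ht + φ * hF
  have : (1 - φ) • ((-φ ^ 2) • A + 1 + C) + t • (t • A + B) + -1 * A = ((1 - φ) * -φ ^ 2 + t * t - 1) • A + ((1 - φ) • 1 + (1 - φ) • C + t • B) := by
    rw [neg_one_mul]; module
  rw [this, e, zero_smul, zero_add]

lemma C3 : Good [(1, 4), (2, 1), (1, 1)] := by
  obtain ⟨φ, hφ, h1, h2⟩ := exF
  have hF : (φ : ℂ) ^ 2 = φ + 1 := by exact_mod_cast hφ
  obtain ⟨t, ht⟩ := IsAlgClosed.exists_pow_nat_eq (1 - φ : ℂ) (n := 2) (by norm_num)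
  have n0 : (1 - φ : ℂ) ≠ 0 := by exact_mod_cast (by linarith : 1 - φ ≠ 0)
  have t0 : t ≠ 0 := by rintro rfl; apply n0; rw [← ht]; norm_num
  obtain ⟨u, hu⟩ : ∃ u, t * u = 2 := ⟨2 / t, by field_simp⟩
  have n4 : (3 + φ : ℂ) ≠ 0 := by exact_mod_cast (by linarith : 3 + φ ≠ 0)
  obtain ⟨a, b, ha, hb, hab, hc⟩ := ext3 0 0 t (by convert neg_ne_zero.mpr n4 using 1; linear_combination ht)
  obtain ⟨c, hc, hac, hbc⟩ := hc (-1) (-φ ^ 2) u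
  have hba : trc (b * a) = t := (trc_cyc _ _).trans hab
  have hca : trc (c * a) = -φ ^ 2 := (trc_cyc _ _).trans hac
  have hcb : trc (c * b) = u := (trc_cyc _ _).trans hbc
  obtain ⟨h, hh⟩ : ∃ h : SL2, h = a * (c * (b * a * b) * c) * a := ⟨_, rfl⟩
  have r1 := mat_aba b a
  have r2 := mat_aba c b
  have r3 := mat_aba c a
  have r4 := mat_aba a c
  have r5 := mat_aba a b
  have r6 := mat_inv a
  have r7 := mat_inv b
  have r8 := mat_inv c
  have r9 : a.1 * a.1 = -1 := ch2 a.1 a.2 (by rw [trc_eq, ha])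
  have r10 : b.1 * b.1 = -1 := ch2 b.1 b.2 (by rw [trc_eq, hb])
  have r11 : c.1 * c.1 = -1 - c.1 := by
    have := mat_aba c 1
    have e : (c * 1 * c).1 = c.1 * c.1 := by rw [mul_one]; rfl
    rw [e, mul_one, hc, inv_one] at this
    rw [this]; simp [sub_eq_add_neg, add_comm]
  have f3 : ∀ A B : SL2, (A * B * A).1 = A.1 * B.1 * A.1 := fun _ _ => rfl
  rw [f3, hba, r6, ha] at r1
  rw [f3, hcb, r7, hb] at r2
  rw [f3, hca, r6, ha] at r3
  rw [f3, hac, r8, hc] at r4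
  rw [f3, hab, r7, hb] at r5
  have r1' : b.1 * a.1 * b.1 = t • b.1 + a.1 := by rw [r1]; module
  have hm : h.1 = (1 - φ : ℂ) • 1 + (1 - φ : ℂ) • c.1 + t • b.1 := by
    rw [hh]
    refine mat_h a.1 b.1 c.1 t u φ r1' (by rw [r2]; module) (by rw [r3]; module) (by rw [r4]; module) (by rw [r5]; module) r9 hu ht hF
  have m1 : ∀ A B : SL2, (A * B).1 = A.1 * B.1 := fun _ _ => rfl
  have th : trc h = 1 - φ := by
    rw [← trc_eq, hm]
    simp only [Matrix.trace_add, Matrix.trace_smul, trc_eq, hb, hc, Matrix.trace_one]; simp; ring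
  have tbh : trc (b * h) = 0 := by
    rw [← trc_eq, m1, hm, mul_add, mul_add, Matrix.mul_smul, Matrix.mul_smul, Matrix.mul_smul, r10, ← m1, mul_one]
    simp only [Matrix.trace_add, Matrix.trace_smul, trc_eq, hb, hbc, Matrix.trace_neg, Matrix.trace_one]; simp
    linear_combination -u * ht + t * hu
  have tch : trc (c * b * a * h) = 0 := by
    rw [← trc_eq, m1, hm, mul_add, mul_add, Matrix.mul_smul, Matrix.mul_smul, Matrix.mul_smul, mul_one]
    have e1 : ((c * b * a).1 * c.1).trace = - t - trc (c * b * a) := by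
      rw [Matrix.trace_mul_comm, m1, m1, mul_assoc, ← mul_assoc c.1, r11, sub_mul, neg_one_mul, Matrix.trace_sub, Matrix.trace_neg, ← m1, ← m1, trc_eq, trc_eq, hba, mul_assoc]
    have e2 : ((c * b * a).1 * b.1).trace = t * u - φ ^ 2 := by
      rw [m1, m1, mul_assoc, mul_assoc, ← mul_assoc b.1, r1', mul_add, Matrix.mul_smul, Matrix.trace_add, Matrix.trace_smul, ← m1, ← m1, trc_eq, trc_eq, hcb, hca]
      simp; ring
    rw [Matrix.trace_add, Matrix.trace_add, Matrix.trace_smul, Matrix.trace_smul, Matrix.trace_smul, e1, e2, trc_eq]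
    simp only [smul_eq_mul]
    linear_combination t * hu - t * hF
  have A2 : ppi a ^ 2 = 1 := ppi2 _ ha
  have B2 : ppi b ^ 2 = 1 := ppi2 _ hb
  have G3 : ppi c ^ 3 = 1 := ppi3 _ hc
  have H5 : ppi h ^ 5 = 1 := sq5 φ hφ _ (Or.inr th)
  have hH : ppi h = ppi a * (ppi c * (ppi b * ppi a * ppi b) * ppi c) * ppi a := by rw [hh]; simp only [map_mul]
  obtain ⟨d, hd⟩ : ∃ d : SL2, d = (c * b * a)⁻¹ := ⟨_, rfl⟩
  have hD : ppi d = (ppi c * ppi b * ppi a)⁻¹ := by rw [hd]; simp only [map_mul, map_inv]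
  have q1 : (ppi b⁻¹ * ppi h) ^ 2 = 1 := by
    rw [← map_mul]; apply ppi2; rw [trc_cyc, trc_mi, hb, trc_cyc, tbh]; ring
  have q2 : (ppi h ^ 4 * ppi d) ^ 2 = 1 := by
    have : ppi h ^ 4 * ppi d = ppi ((c * b * a * h)⁻¹) := by
      rw [← map_pow, ppi4 _ H5, ← map_mul, hd]; simp only [mul_inv_rev, mul_assoc]
    rw [this, map_inv, inv_pow, ppi2 _ tch, inv_one]
  have hr : ∀ i : Fin 6, run ![1, 2, 0, 4, 5, 3] ![0, 3, 5, 2, 1, 4] 1 ![h, 1, b, a, d, c] [(1, 4), (2, 1), (1, 1)] i =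
      (![0, 1, 5, 4, 3, 2] i, ![a * d * c * h, h ^ 4 * d, c * b * a * a * b, d * c * b * h * a, b * a * d * b * d, d * c * b * a * c * c] i) := by
    intro i; fin_cases i <;> simp [run, st, pow_succ, mul_assoc]
  refine good_cp (n := 6) ![1, 2, 0, 4, 5, 3] ![0, 3, 5, 2, 1, 4] 1 ![h, 1, b, a, d, c] _ ?_ ?_ ?_ 3 [(0, 1), (2, 1)] [(2, 1), (2, 0)] a c ?_ ?_ 0 (-1) (-φ ^ 2) ha hc hac (bigt φ hφ h1 _ rfl) ?_ ?_
  · intro i; fin_cases i <;> simp [st]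
  · intro i
    fin_cases i
    · simp only [st, Function.iterate_succ, Function.iterate_zero, Function.comp, id]
      refine ⟨by simp, ?_⟩
      have := H5
      simpa [pow_succ, mul_assoc] using this
    all_goals simp [st, hD, mul_assoc]
  · have w3 : ppi (b * a * d * b * d) * ppi (d * c * b * h * a) = 1 := by
      simp only [map_mul, hD, hH]
      generalize ppi a = α at *
      generalize ppi b = β at *
      generalize ppi c = γ at *
      have A' : α * α = 1 := by rw [← sq, A2]
      have B' : β * β = 1 := by rw [← sq, B2]
      calc _ = γ⁻¹ * (β * (α⁻¹ * β⁻¹ * γ⁻¹) * γ * β * α * β * γ) * (α * α) := by group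
        _ = γ⁻¹ * (β * β) * γ := by rw [A']; group
        _ = 1 := by rw [B']; group
    have w2 : ppi (d * c * b * a * c * c) * ppi (c * b * a * a * b) = 1 := by
      simp only [map_mul, hD, hH]
      generalize ppi a = α at *
      generalize ppi b = β at *
      generalize ppi c = γ at *
      have A' : α * α = 1 := by rw [← sq, A2]
      have B' : β * β = 1 := by rw [← sq, B2]
      have G' : γ * γ * γ = 1 := by rw [← G3, pow_succ, sq]
      calc _ = (γ * γ * γ) * β * (α * α) * β := by group
        _ = 1 := by rw [A', G', one_mul, mul_one, B']
    have sw : ∀ p q : Equiv.Perm PL, p * q = 1 → q * p = 1 := fun p q e => by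
      rw [eq_inv_of_mul_eq_one_left e]; group
    intro i
    simp only [hr]
    fin_cases i
    · refine ⟨by simp, ?_⟩
      change ppi ((a * d * c * h) * (a * d * c * h)) = 1
      rw [show a * d * c = b⁻¹ by rw [hd]; group, map_mul, map_mul, ← sq, q1]
    · refine ⟨by simp, ?_⟩
      change ppi ((h ^ 4 * d) * (h ^ 4 * d)) = 1
      rw [map_mul, map_mul, map_pow, ← sq, q2]
    · exact ⟨by simp, (map_mul ppi _ _).trans w2⟩
    · exact ⟨by simp, (map_mul ppi _ _).trans w3⟩
    · exact ⟨by simp, (map_mul ppi _ _).trans (sw _ _ w3)⟩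
    · exact ⟨by simp, (map_mul ppi _ _).trans (sw _ _ w2)⟩
  · simp [run, st]
  · simp [run, st]
  · intro h
    have h' : (-1 : ℝ) ^ 2 + (-φ ^ 2) ^ 2 - 4 = 0 := by
      have : (-1 : ℂ) ^ 2 + (-φ ^ 2) ^ 2 - 4 = 0 := by linear_combination h
      exact_mod_cast this
    rw [hφ] at h'; nlinarith
  · norm_num

end

section
def lz : Fin 4 → ℤ := ![0, 1, -1001, -1000]
def zc (w : List (ℕ × ℕ)) (i : Fin 4) : Bool := tt (1000 : ℤ) (lz i) w % 1000999 == 0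
def reps : List (List (ℕ × ℕ)) := [[(1, 1), (1, 4)], [(1, 1), (2, 2)], [(1, 1), (1, 1), (2, 4)], [(1, 4), (2, 1), (1, 1)],
  [(1, 1), (1, 2), (2, 1), (2, 4)], [(1, 1), (1, 3), (2, 2), (1, 4)], [(1, 1), (2, 1), (1, 2), (2, 4)], [(1, 4), (2, 2), (1, 1), (2, 1)]]
def chk (w : List (ℕ × ℕ)) : Bool :=
  !(Nat.ble w.length (([0, 1, 2, 3] : List (Fin 4)).filter (zc w)).length) ||
  ([0, 1, 2, 3].any fun n => [(1, 1), (2, 2)].any fun (e : ℕ × ℕ) => [(1, 1), (2, 3), (3, 2), (4, 4)].any fun (j : ℕ × ℕ) => reps.contains (tw e.1 j.1 (w.rotate n)))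
def P8 : List (ℕ × ℕ) := [(1, 1), (1, 2), (1, 3), (1, 4), (2, 1), (2, 2), (2, 3), (2, 4)]

lemma enum2 : (P8.all fun p => chk [(1, 1), p]) = true := by decide +kernel
lemma enum3 : (P8.all fun p => P8.all fun q => chk [(1, 1), p, q]) = true := by decide +kernel
lemma enum4 : (P8.all fun p => P8.all fun q => P8.all fun r => chk [(1, 1), p, q, r]) = true := by decide +kernel

lemma good_reps : ∀ w ∈ reps, Good w := by
  simp only [reps, List.forall_mem_cons]
  exact ⟨C2a, C2b, good_rev3 C3, C3, C4a, C4b, C4c, good_rev4 C4c, by simp⟩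

lemma zc_of (w) (i) (h : tt th (lam i) w = 0) : zc w i = true := by
  have h0 : ((1000 : ℤ) : ZMod 1000999) ^ 2 + ((1000 : ℤ) : ZMod 1000999) - 1 = 0 := by decide +kernel
  have h1 := tt_map (rlift _ h0) th (lam i) w
  have h2 := tt_map (Int.castRingHom (ZMod 1000999)) 1000 (lz i) w
  have h3 : rlift _ h0 (lam i) = Int.castRingHom (ZMod 1000999) (lz i) := by
    fin_cases i
    · change rlift _ h0 0 = Int.castRingHom _ 0; simp
    · change rlift _ h0 1 = Int.castRingHom _ 1; simp
    · change rlift _ h0 (-th - 1) = Int.castRingHom _ (-1001); rw [map_sub, map_neg, rlift_th, map_one, eq_intCast]; push_cast; ring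
    · change rlift _ h0 (-th) = Int.castRingHom _ (-1000); rw [map_neg, rlift_th, eq_intCast]; push_cast; ring
  rw [h, map_zero, h3, rlift_th] at h1
  rw [eq_intCast, eq_intCast _ (1000 : ℤ), ← h1, ZMod.intCast_zmod_eq_zero_iff_dvd] at h2
  simp only [zc, beq_iff_eq]
  exact Int.emod_eq_zero_of_dvd (by exact_mod_cast h2)

lemma good_chk (w) (h : chk w = true) (L : List (Fin 4)) (hL : L.Nodup) (hl : L.length = w.length)
    (hz : ∀ i ∈ L, tt th (lam i) w = 0) : Good w := by
  have : w.length ≤ (([0, 1, 2, 3] : List (Fin 4)).filter (zc w)).length := by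
    rw [← hl]
    refine (hL.subperm ?_).length_le
    intro i hi
    rw [List.mem_filter]
    exact ⟨by fin_cases i <;> simp, zc_of w i (hz i hi)⟩
  simp only [chk, Bool.or_eq_true, Bool.not_eq_true', Nat.ble_eq_true_of_le this, Bool.true_eq_false, false_or, List.any_eq_true] at h
  obtain ⟨n, -, e, he, j, hj, hc⟩ := h
  have hg : Good (w.rotate n) := by
    refine good_tw e.1 j.1 e.2 j.2 ?_ ?_ (good_reps _ (List.contains_iff_mem.mp hc))
    · simp at he; rcases he with rfl | rfl <;> rfl
    · simp at hj; rcases hj with rfl | rfl | rfl | rfl <;> rfl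
  rw [List.rotate_eq_drop_append_take_mod] at hg
  have := good_rot hg
  rwa [List.take_append_drop] at this

lemma mem8 (p : ℕ × ℕ) (h : (0 < p.1 ∧ p.1 < 3) ∧ (0 < p.2 ∧ p.2 < 5)) : p ∈ P8 := by
  obtain ⟨a, b⟩ := p
  obtain ⟨⟨h1, h2⟩, h3, h4⟩ := h
  dsimp only at *
  interval_cases a <;> interval_cases b <;> decide

lemma good_norm (v : List (ℕ × ℕ)) (hv : ∀ p ∈ v, (0 < p.1 ∧ p.1 < 3) ∧ (0 < p.2 ∧ p.2 < 5)) (hne : v ≠ []) : Good ((1, 1) :: v) := by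
  have hv' : ∀ p ∈ v, p ∈ P8 := fun p hp => mem8 p (hv p hp)
  rcases dich ((1, 1) :: v) (by simpa using hv) (by simp) with h | ⟨L, h1, h2, h3⟩
  · exact h
  have h4 : L.length ≤ 4 := by simpa using h1.length_le_card
  rw [h2] at h4
  refine good_chk _ ?_ L h1 h2 h3
  match v, hne, hv', h4 with
  | [p], _, hv, _ =>
    exact List.all_eq_true.mp enum2 p (hv p (by simp))
  | [p, q], _, hv, _ =>
    exact List.all_eq_true.mp (List.all_eq_true.mp enum3 p (hv p (by simp))) q (hv q (by simp))
  | [p, q, r], _, hv, _ =>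
    exact List.all_eq_true.mp (List.all_eq_true.mp (List.all_eq_true.mp enum4 p (hv p (by simp))) q (hv q (by simp))) r (hv r (by simp))
  | _ :: _ :: _ :: _ :: _, _, _, h => simp at h; omega

lemma good_all (w : List (ℕ × ℕ)) (hw : ∀ p ∈ w, (0 < p.1 ∧ p.1 < 3) ∧ (0 < p.2 ∧ p.2 < 5)) (hl : 2 ≤ w.length) : Good w := by
  match w, hw, hl with
  | p :: v, hw, hl =>
    obtain ⟨e, he, he'⟩ : ∃ e, e * p.1 % 3 = 1 ∧ (e = 1 ∨ e = 2) := by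
      have := (hw p (by simp)).1
      have : p.1 = 1 ∨ p.1 = 2 := by omega
      rcases this with h | h <;> rw [h]
      exacts [⟨1, by simp⟩, ⟨2, by simp⟩]
    obtain ⟨j, hj, hj'⟩ : ∃ j, j * p.2 % 5 = 1 ∧ (j = 1 ∨ j = 2 ∨ j = 3 ∨ j = 4) := by
      have := (hw p (by simp)).2
      have : p.2 = 1 ∨ p.2 = 2 ∨ p.2 = 3 ∨ p.2 = 4 := by omega
      rcases this with h | h | h | h <;> rw [h]
      exacts [⟨1, by simp⟩, ⟨3, by simp⟩, ⟨2, by simp⟩, ⟨4, by simp⟩]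
    refine good_tw e j p.1 p.2 he hj ?_
    have : tw e j (p :: v) = (1, 1) :: tw e j v := by simp [tw, he, hj]
    rw [this]
    refine good_norm _ ?_ ?_
    · intro q hq
      simp only [tw, List.mem_map] at hq
      obtain ⟨r, hr, rfl⟩ := hq
      have := hw r (by simp [hr])
      dsimp only
      constructor
      · rcases he' with rfl | rfl <;> omega
      · rcases hj' with rfl | rfl | rfl | rfl <;> omega
    · intro h
      have : (tw e j v).length = 0 := by rw [h]; rfl
      simp [tw] at this
      simp [this] at hl

end

lemma tc12 {Q : Type*} (X Y : Q → Q) (hX : ∀ q, X (X (X q)) = q) (hY : ∀ q, Y (Y (Y (Y (Y q)))) = q)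
    (hW : ∀ q, X (Y (X (Y q))) = q) (v0 : Q) (h0 : Y v0 = v0) :
    ∃ S : Set Q, S.Finite ∧ v0 ∈ S ∧ ∀ s ∈ S, X s ∈ S ∧ Y s ∈ S := by
  have k1 : ∀ q, Y (X (Y q)) = X (X q) := fun q => by rw [← hX (Y (X (Y q))), hW]
  have k3 : ∀ q, X (Y q) = Y (Y (Y (Y (X (X q))))) := fun q => by rw [← k1, hY]
  obtain ⟨v1, a1⟩ : ∃ v, X v0 = v := ⟨_, rfl⟩
  obtain ⟨v2, a2⟩ : ∃ v, X v1 = v := ⟨_, rfl⟩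
  obtain ⟨v3, b2⟩ : ∃ v, Y v2 = v := ⟨_, rfl⟩
  obtain ⟨v4, b3⟩ : ∃ v, Y v3 = v := ⟨_, rfl⟩
  obtain ⟨v5, b4⟩ : ∃ v, Y v4 = v := ⟨_, rfl⟩
  obtain ⟨u0, a5⟩ : ∃ v, X v5 = v := ⟨_, rfl⟩
  obtain ⟨u1, c0⟩ : ∃ v, Y u0 = v := ⟨_, rfl⟩
  obtain ⟨u2, c1⟩ : ∃ v, Y u1 = v := ⟨_, rfl⟩
  obtain ⟨u3, c2⟩ : ∃ v, Y u2 = v := ⟨_, rfl⟩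
  obtain ⟨u4, c3⟩ : ∃ v, Y u3 = v := ⟨_, rfl⟩
  obtain ⟨w, d3⟩ : ∃ v, X u3 = v := ⟨_, rfl⟩
  have e2 : X v2 = v0 := by rw [← a2, ← a1, hX]
  have b1 : Y v1 = v2 := by have := k1 v0; rwa [h0, a1, a2] at this
  have b5 : Y v5 = v1 := by have := hY v1; rwa [b1, b2, b3, b4] at this
  have a3 : X v3 = v5 := by have := k3 v2; rwa [e2, a1, b1, b2, b3, b4] at this
  have d0 : X u0 = v3 := by have := hX v3; rwa [a3, a5] at this
  have a4 : X v4 = u4 := by have := k3 v3; rwa [a3, a5, b3, c0, c1, c2, c3] at this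
  have c4 : Y u4 = u0 := by have := hY u0; rwa [c0, c1, c2, c3] at this
  have d1 : X u1 = v4 := by have := k3 u0; rwa [d0, a3, c0, b5, b1, b2, b3] at this
  have d4 : X u4 = u1 := by have := hX u1; rwa [d1, a4] at this
  have d2 : X u2 = u3 := by have := k3 u1; rwa [d1, a4, c1, c4, c0, c1, c2] at this
  have dw : X w = u2 := by have := hX u2; rwa [d2, d3] at this
  have cw : Y w = w := by
    have := k3 u2; rw [d2, d3, c2, d3] at this
    have h := hY w; rwa [← this] at h
  refine ⟨{v0, v1, v2, v3, v4, v5, u0, u1, u2, u3, u4, w}, Set.toFinite _, by simp, ?_⟩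
  rintro s (rfl | rfl | rfl | rfl | rfl | rfl | rfl | rfl | rfl | rfl | rfl | rfl) <;> simp only [*] <;> simp

lemma fin_tri {G : Type*} [Group G] (x y : G) (hx : x ^ 3 = 1) (hy : y ^ 5 = 1) (hw : (x * y) ^ 2 = 1)
    (hg : Subgroup.closure {x, y} = ⊤) : ∃ H : Subgroup G, H.FiniteIndex ∧ IsSolvable H := by
  refine ⟨Subgroup.zpowers y, ?_, isSolvable_of_comm (fun p q => Std.Commutative.comm p q)⟩
  obtain ⟨S, hS, h0, hc⟩ := tc12 (Q := G ⧸ Subgroup.zpowers y) (x • ·) (y • ·)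
    (fun q => by simp only [smul_smul]; rw [← mul_assoc, ← sq, ← pow_succ, hx, one_smul])
    (fun q => by simp only [smul_smul]; rw [show y * (y * (y * (y * y))) = y ^ 5 by simp only [pow_succ, pow_zero, one_mul, mul_assoc], hy, one_smul])
    (fun q => by simp only [smul_smul]; rw [show x * (y * (x * y)) = (x * y) ^ 2 by simp only [sq, mul_assoc], hw, one_smul])
    ((1 : G) : G ⧸ Subgroup.zpowers y)
    (by
      change ((y * 1 : G) : G ⧸ Subgroup.zpowers y) = _
      rw [QuotientGroup.eq]; simp)
  have key : ∀ g ∈ Subgroup.closure {x, y}, (g : G ⧸ Subgroup.zpowers y) ∈ S := by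
    intro g hgm
    induction hgm using Subgroup.closure_induction_left with
    | one => exact h0
    | mul_left z hz g _ ih =>
      rcases hz with rfl | rfl
      · exact (hc _ ih).1
      · exact (hc _ ih).2
    | inv_mul_cancel z hz g _ ih =>
      rcases hz with rfl | rfl
      · rw [show z⁻¹ = z * z by rw [inv_eq_iff_mul_eq_one, ← sq, ← pow_succ', hx], mul_assoc]
        exact (hc _ (hc _ ih).1).1
      · rw [show z⁻¹ = z * (z * (z * z)) by rw [inv_eq_iff_mul_eq_one, ← hy]; simp only [pow_succ, pow_zero, one_mul, mul_assoc], mul_assoc, mul_assoc, mul_assoc]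
        exact (hc _ (hc _ (hc _ (hc _ ih).2).2).2).2
  have : Finite (G ⧸ Subgroup.zpowers y) := by
    have hu : (Set.univ : Set (G ⧸ Subgroup.zpowers y)) ⊆ S := by
      intro q _
      obtain ⟨g, rfl⟩ := QuotientGroup.mk_surjective q
      exact key g (by rw [hg]; trivial)
    exact Set.finite_univ_iff.mp (hS.subset hu)
  exact Subgroup.finiteIndex_of_finite_quotient

lemma tri_one (a b : Fin 1 → ℕ) (ha : ∀ i, 0 < a i ∧ a i < 3) (hb : ∀ i, 0 < b i ∧ b i < 5) :
    ∃ H : Subgroup (TriGroup 1 a b), H.FiniteIndex ∧ IsSolvable H := by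
  obtain ⟨X, hX⟩ : ∃ X : TriGroup 1 a b, X = PresentedGroup.of 0 := ⟨_, rfl⟩
  obtain ⟨Y, hY⟩ : ∃ Y : TriGroup 1 a b, Y = PresentedGroup.of 1 := ⟨_, rfl⟩
  have rel : ∀ r ∈ triRels 1 a b, PresentedGroup.mk (triRels 1 a b) r = 1 := fun r hr =>
    PresentedGroup.one_of_mem hr
  have mx : PresentedGroup.mk (triRels 1 a b) xgen = X := hX.symm
  have my : PresentedGroup.mk (triRels 1 a b) ygen = Y := hY.symm
  have h3 : X ^ 3 = 1 := by rw [← mx, ← map_pow]; exact rel _ (by simp [triRels])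
  have h5 : Y ^ 5 = 1 := by rw [← my, ← map_pow]; exact rel _ (by simp [triRels])
  have h2 : (X ^ a 0 * Y ^ b 0) ^ 2 = 1 := by
    have := rel (Wword 1 a b ^ 2) (by simp [triRels])
    simpa [Wword, mx, my] using this
  refine fin_tri (X ^ a 0) (Y ^ b 0) (by rw [← pow_mul, mul_comm, pow_mul, h3, one_pow]) (by rw [← pow_mul, mul_comm, pow_mul, h5, one_pow]) h2 ?_
  rw [eq_top_iff, ← PresentedGroup.closure_range_of, Subgroup.closure_le]
  have hx : X ^ a 0 ∈ Subgroup.closure {X ^ a 0, Y ^ b 0} := Subgroup.subset_closure (by simp)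
  have hy : Y ^ b 0 ∈ Subgroup.closure {X ^ a 0, Y ^ b 0} := Subgroup.subset_closure (by simp)
  rintro _ ⟨i, rfl⟩
  fin_cases i
  · have : X = (X ^ a 0) ^ a 0 := by
      rw [← pow_mul, ← pow_mod_of h3]
      have h := ha 0
      have : a 0 = 1 ∨ a 0 = 2 := by omega
      rcases this with e | e <;> simp [e]
    change PresentedGroup.of 0 ∈ _
    rw [← hX]
    have h := pow_mem hx (a 0)
    rwa [← this] at h
  · obtain ⟨m, hm⟩ : ∃ m, Y = (Y ^ b 0) ^ m := by
      refine ⟨b 0 ^ 3, ?_⟩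
      rw [← pow_mul, ← pow_mod_of h5]
      have h := hb 0
      have : b 0 = 1 ∨ b 0 = 2 ∨ b 0 = 3 ∨ b 0 = 4 := by omega
      rcases this with e | e | e | e <;> simp [e]
    change PresentedGroup.of 1 ∈ _
    rw [← hY]
    have := pow_mem hy m
    rwa [← hm] at this

/-- **Rosenberger conjecture for type (3,5,2)**: a generalised triangle group of type
(3,5,2) is virtually soluble or contains a nonabelian free subgroup (of rank 2). -/
theorem trigroup_virtually_soluble_or_free
    (k : ℕ) (hk : 1 ≤ k) (a b : Fin k → ℕ)
    (ha : ∀ i, 0 < a i ∧ a i < 3) (hb : ∀ i, 0 < b i ∧ b i < 5) :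
    (∃ H : Subgroup (TriGroup k a b), H.FiniteIndex ∧ IsSolvable H) ∨
      (∃ H : Subgroup (TriGroup k a b), Nonempty (H ≃* FreeGroup (Fin 2))) := by
  rcases hk.eq_or_lt with rfl | hk
  · exact Or.inl (tri_one a b ha hb)
  · refine Or.inr (free_of_good a b (good_all _ ?_ (by simp [toW]; omega)))
    intro p hp
    simp only [toW, List.mem_ofFn] at hp
    obtain ⟨i, rfl⟩ := hp
    exact ⟨ha i, hb i⟩
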